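/- Let i ≥ 1 be such that #f_i = 1, #f_{i+1} = 2, and either i = 1 or #f_{i−1} = 1; write f_i = {d}, and let J be an invariant-factor count function for d. Then for every x ∈ ℝ, lim_{n→∞} (1/n)·#{1 ≤ m ≤ n : J(m) ≤ μ_i·log log n + x·σ_i·(log log n)^{1/2}} = Φ(x; −ν_{i+1}/(σ_i² + σ_{i;1,2}²)^{1/2}). -/

import Mathlib

open MeasureTheory ProbabilityTheory Filter

noncomputable section

/-- A key encoding the lexicographic order on pairs `(φ(q), q)`; this is a valid
encoding on prime powers since every prime power satisfies `q ≤ 2 * φ(q)`. -/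
def ppKey (q : ℕ) : ℕ := 2 * Nat.totient q ^ 2 + q

/-- The `n`-th smallest key of a prime power (0-indexed). -/
def ppNthKey (n : ℕ) : ℕ := Nat.nth (fun k => ∃ q : ℕ, IsPrimePow q ∧ ppKey q = k) n

/-- The total φ-sequence `q̃_i` (1-indexed): the enumeration of all prime powers
ordered by nondecreasing totient, with ties broken by increasing size. -/
def qt (i : ℕ) : ℕ := sInf {q : ℕ | IsPrimePow q ∧ ppKey q = ppNthKey (i - 1)}

/-- `lcm(q̃_1, …, q̃_i)`. -/
def Lseq (i : ℕ) : ℕ := (Finset.Icc 1 i).lcm qt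

/-- The universal factor order set `f_i`. -/
def UFO (i : ℕ) : Set ℕ :=
  if Nat.totient (qt i) < Nat.totient (qt (i + 1)) then {Lseq i}
  else {Lseq i, Nat.lcm (Lseq (i - 1)) (qt (i + 1))}

/-- `φ(q̃_i)` as a real number. -/
def phiQ (i : ℕ) : ℝ := (Nat.totient (qt i) : ℝ)

/-- `μ_i = 1/φ(q̃_i) − 1/φ(q̃_{i+1})`. -/
def muSeq (i : ℕ) : ℝ := 1 / phiQ i - 1 / phiQ (i + 1)

/-- `σ_i = (1/φ(q̃_i) + 1/φ(q̃_{i+1}) − 2/(φ(q̃_i)·φ(q̃_{i+1})))^{1/2}`. -/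
def sigSeq (i : ℕ) : ℝ :=
  Real.sqrt (1 / phiQ i + 1 / phiQ (i + 1) - 2 / (phiQ i * phiQ (i + 1)))

/-- `σ_{i;a,b} = (φ(q̃_i)^{−a} + φ(q̃_{i+1})^{−b} − 2/(φ(q̃_i)·φ(q̃_{i+1})))^{1/2}`. -/
def sigAB (i a b : ℕ) : ℝ :=
  Real.sqrt (1 / phiQ i ^ a + 1 / phiQ (i + 1) ^ b - 2 / (phiQ i * phiQ (i + 1)))

/-- `ν_j = (φ(q̃_j)^{−1}·(1 − φ(q̃_j)^{−1}))^{1/2}`. -/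
def nuSeq (j : ℕ) : ℝ := Real.sqrt (1 / phiQ j * (1 - 1 / phiQ j))

/-- `J` is an invariant-factor count function for `d`: whenever `(ℤ/mℤ)ˣ` is isomorphic to
a direct product of cyclic groups `ℤ/λ_1 × ⋯ × ℤ/λ_K` with `1 < λ_1 ∣ λ_2 ∣ ⋯ ∣ λ_K`,
`J m` is the number of indices `j` with `λ_j = d`. -/
def IsInvCount (d : ℕ) (J : ℕ → ℕ) : Prop :=
  ∀ m : ℕ, 1 ≤ m → ∀ K : ℕ, ∀ lam : Fin K → ℕ,
    (∀ j, 1 < lam j) →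
    (∀ j k : Fin K, j ≤ k → lam j ∣ lam k) →
    Nonempty ((ZMod m)ˣ ≃* Multiplicative (∀ j : Fin K, ZMod (lam j))) →
    J m = (Finset.univ.filter fun j : Fin K => lam j = d).card

/-- The number of `m ∈ {1, …, n}` satisfying `P`. -/
def cnt (P : ℕ → Prop) (n : ℕ) : ℕ := {m : ℕ | 1 ≤ m ∧ m ≤ n ∧ P m}.ncard

/-- The average `(1/n)·∑_{m=1}^n J(m)`. -/
def avg (J : ℕ → ℕ) (n : ℕ) : ℝ := (∑ m ∈ Finset.Icc 1 n, (J m : ℝ)) / n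

/-- `log log n`. -/
def LL (n : ℕ) : ℝ := Real.log (Real.log n)

/-- The standard normal cumulative distribution function. -/
def Phi (x : ℝ) : ℝ := (Real.sqrt (2 * Real.pi))⁻¹ * ∫ t in Set.Iic x, Real.exp (-t ^ 2 / 2)

/-- Owen's T-function. -/
def OwenT (h a : ℝ) : ℝ :=
  (2 * Real.pi)⁻¹ * ∫ t in (0:ℝ)..a, Real.exp (-(1 + t ^ 2) * h ^ 2 / 2) / (1 + t ^ 2)

/-- The skew-normal cumulative distribution function with parameter `α`. -/
def PhiSkew (x α : ℝ) : ℝ := Phi x - 2 * OwenT x α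

/-- The standard Gaussian probability measure `γ^k` on `ℝ^k`. -/
def stdGaussian (k : ℕ) : Measure (Fin k → ℝ) :=
  Measure.pi fun _ => gaussianReal 0 1

/-- `ω(m;q,1)`: the number of distinct primes `p ∣ m` with `p ≡ 1 (mod q)`. -/
def omegaQ (m q : ℕ) : ℕ := (m.primeFactors.filter fun p => p % q = 1 % q).card

/-- The correction term `Ē(m;p^α)`. -/
def Ebar (m p α : ℕ) : ℕ :=
  if p ^ α = 2 ∧ 8 ∣ m then 2
  else if p ^ α = 2 ∧ 4 ∣ m ∧ ¬(8 ∣ m) then 1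
  else if p = 2 ∧ 2 ≤ α ∧ 2 ^ (α + 2) ∣ m then 1
  else if p ≠ 2 ∧ p ^ (α + 1) ∣ m then 1
  else 0

/-- `prm(m;q)` for a prime power `q = p^α`: the unique `k` such that `p^k` is the cardinality
of the subgroup `{x ∈ (ℤ/mℤ)ˣ : x^p = 1 and x = y^{p^{α−1}} for some y}` (obtained here as the
`p`-adic valuation of that cardinality; note `p = q.minFac` and `p^{α−1} = q / p`). -/
def prm (m q : ℕ) : ℕ :=
  (Nat.card {x : (ZMod m)ˣ // x ^ q.minFac = 1 ∧ ∃ y : (ZMod m)ˣ, y ^ (q / q.minFac) = x}).factorization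
    q.minFac

/-- `m` is `y`-typical: for all prime powers `q₁, q₂` with `φ(q₁) ≤ y` and `φ(q₁) < φ(q₂)`
one has `prm(m;q₁) > prm(m;q₂)`. -/
def yTypical (y : ℝ) (m : ℕ) : Prop :=
  ∀ q₁ q₂ : ℕ, IsPrimePow q₁ → IsPrimePow q₂ →
    (Nat.totient q₁ : ℝ) ≤ y → Nat.totient q₁ < Nat.totient q₂ →
    prm m q₂ < prm m q₁


/-- The sum of `w p / p` over the primes `p ≤ n`. -/
def primeSum (w : ℕ → ℝ) (n : ℕ) : ℝ := ∑ p ∈ (Finset.Icc 1 n).filter Nat.Prime, w p / p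

/-- The indicator function of the residue class of `1` modulo `q`. -/
def indOne (q p : ℕ) : ℝ := if p % q = 1 % q then 1 else 0

lemma LSeries_ofReal_eq {f : ℕ → ℝ} (h0 : f 0 = 0) (x : ℝ) :
    LSeries (fun n => (f n : ℂ)) (x : ℂ) = ((∑' n : ℕ, f n / (n : ℝ) ^ x : ℝ) : ℂ) := by
  rw [LSeries, Complex.ofReal_tsum]
  refine tsum_congr fun n => ?_
  rw [LSeries.term]
  split_ifs with hn
  · simp [hn, h0]
  · simp only [Complex.ofReal_div, Complex.ofReal_cpow (Nat.cast_nonneg _), Complex.ofReal_natCast]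

lemma LSeriesSummable_ofReal {f : ℕ → ℝ} (h0 : f 0 = 0) {x : ℝ}
    (h : LSeriesSummable (fun n => (f n : ℂ)) (x : ℂ)) :
    Summable fun n : ℕ => f n / (n : ℝ) ^ x := by
  rw [← Complex.summable_ofReal]
  refine Summable.congr h fun n => ?_
  rw [LSeries.term]
  split_ifs with hn
  · simp [hn, h0]
  · simp only [Complex.ofReal_div, Complex.ofReal_cpow (Nat.cast_nonneg _), Complex.ofReal_natCast]

open ArithmeticFunction.vonMangoldt in
lemma exists_abs_tsum_residueClass_sub_le {q : ℕ} [NeZero q] :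
    ∃ C : ℝ, ∀ x ∈ Set.Ioc (1 : ℝ) 2,
      |∑' n : ℕ, residueClass (1 : ZMod q) n / (n : ℝ) ^ x - (q.totient : ℝ)⁻¹ / (x - 1)| ≤ C := by
  have H {x : ℝ} (hx : 1 < x) :
      ∑' n : ℕ, residueClass (1 : ZMod q) n / (n : ℝ) ^ x - (q.totient : ℝ)⁻¹ / (x - 1) =
        (LFunctionResidueClassAux (1 : ZMod q) x).re := by
    have h1 := eqOn_LFunctionResidueClassAux (q := q) (a := 1) isUnit_one
      (x := (x : ℂ)) (by simpa using hx)
    rw [h1]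
    simp only
    rw [LSeries_ofReal_eq (f := residueClass (1 : ZMod q)) (by simp)]
    rw [← Complex.ofReal_re (∑' n : ℕ, residueClass (1 : ZMod q) n / (n : ℝ) ^ x -
      (q.totient : ℝ)⁻¹ / (x - 1))]
    congr 1
    push_cast
    rfl
  have hc : ContinuousOn (fun x : ℝ ↦ (LFunctionResidueClassAux (1 : ZMod q) x).re)
      (Set.Icc 1 2) :=
    Complex.continuous_re.continuousOn.comp (t := Set.univ)
      (continuousOn_LFunctionResidueClassAux (1 : ZMod q))
      (fun ⦃x⦄ a ↦ trivial) |>.comp Complex.continuous_ofReal.continuousOn fun x hx ↦ by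
        simpa only [Set.mem_ofPred_eq, Complex.ofReal_re] using hx.1
  obtain ⟨C, hC⟩ := isCompact_Icc.exists_bound_of_continuousOn hc
  refine ⟨C, fun x hx => ?_⟩
  rw [H hx.1]
  exact hC x (Set.Ioc_subset_Icc_self hx)

/-- The indicator function of the primes congruent to `1` modulo `q`. -/
def indPrimeOne (q n : ℕ) : ℝ := if n.Prime then indOne q n else 0

lemma indPrimeOne_nonneg (q n : ℕ) : 0 ≤ indPrimeOne q n := by
  unfold indPrimeOne indOne; split_ifs <;> norm_num

lemma indPrimeOne_le_one (q n : ℕ) : indPrimeOne q n ≤ 1 := by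
  unfold indPrimeOne indOne; split_ifs <;> norm_num

lemma indPrimeOne_zero (q : ℕ) : indPrimeOne q 0 = 0 := by
  simp [indPrimeOne, Nat.not_prime_zero]

lemma abscissaOfAbsConv_indPrimeOne_le (q : ℕ) :
    LSeries.abscissaOfAbsConv (fun n => (indPrimeOne q n : ℂ)) ≤ 1 := by
  refine LSeries.abscissaOfAbsConv_le_of_le_const ⟨1, fun n _ => ?_⟩
  rw [Complex.norm_real, Real.norm_eq_abs, abs_of_nonneg (indPrimeOne_nonneg q n)]
  exact indPrimeOne_le_one q n

lemma logMul_indPrimeOne (q : ℕ) : LSeries.logMul (fun n => (indPrimeOne q n : ℂ)) =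
    fun n => ((indPrimeOne q n * Real.log n : ℝ) : ℂ) := by
  ext n
  simp [LSeries.logMul, mul_comm, Complex.natCast_log]

lemma abscissa_lt {q : ℕ} {x : ℝ} (hx : 1 < x) :
    LSeries.abscissaOfAbsConv (fun n => (indPrimeOne q n : ℂ)) < ((x : ℂ).re : ℝ) :=
  (abscissaOfAbsConv_indPrimeOne_le q).trans_lt (by simpa using mod_cast hx)

lemma summable_indPrimeOne_div {q : ℕ} {x : ℝ} (hx : 1 < x) :
    Summable fun n : ℕ => indPrimeOne q n / (n : ℝ) ^ x :=
  LSeriesSummable_ofReal (indPrimeOne_zero q)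
    (LSeriesSummable_of_abscissaOfAbsConv_lt_re (abscissa_lt hx))

lemma summable_indPrimeOne_mul_log_div {q : ℕ} {x : ℝ} (hx : 1 < x) :
    Summable fun n : ℕ => indPrimeOne q n * Real.log n / (n : ℝ) ^ x := by
  have h := LSeriesSummable_logMul_of_lt_re (abscissa_lt (q := q) hx)
  rw [logMul_indPrimeOne] at h
  exact LSeriesSummable_ofReal (by simp) h

lemma hasDerivAt_tsum_indPrimeOne {q : ℕ} {x : ℝ} (hx : 1 < x) :
    HasDerivAt (fun x : ℝ => ∑' n : ℕ, indPrimeOne q n / (n : ℝ) ^ x)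
      (-∑' n : ℕ, indPrimeOne q n * Real.log n / (n : ℝ) ^ x) x := by
  have h := (LSeries_hasDerivAt (abscissa_lt (q := q) hx)).comp_ofReal
  rw [logMul_indPrimeOne, LSeries_ofReal_eq (by simp)] at h
  have h2 := (Complex.reCLM.hasFDerivAt.comp_hasDerivAt x h)
  simp only [Complex.reCLM_apply, Complex.neg_re, Complex.ofReal_re] at h2
  refine h2.congr_of_eventuallyEq (Eventually.of_forall fun y => ?_)
  simp only [Function.comp, Complex.reCLM_apply]
  rw [LSeries_ofReal_eq (indPrimeOne_zero q), Complex.ofReal_re]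

lemma exists_abs_tsum_indPrimeOne_mul_log_sub_le (q : ℕ) [NeZero q] :
    ∃ C : ℝ, ∀ x ∈ Set.Ioc (1 : ℝ) 2,
      |∑' n : ℕ, indPrimeOne q n * Real.log n / (n : ℝ) ^ x - (q.totient : ℝ)⁻¹ / (x - 1)| ≤ C := by
  obtain ⟨C, hC⟩ := exists_abs_tsum_residueClass_sub_le (q := q)
  have hs := ArithmeticFunction.vonMangoldt.summable_residueClass_non_primes_div (1 : ZMod q)
  set r := ArithmeticFunction.vonMangoldt.residueClass (1 : ZMod q) with hr
  have hr0 : ∀ n, 0 ≤ r n := ArithmeticFunction.vonMangoldt.residueClass_nonneg _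
  set D := ∑' n : ℕ, (if n.Prime then 0 else r n) / (n : ℝ)
  refine ⟨C + D, fun x hx => ?_⟩
  have hle : ∀ n : ℕ, (if n.Prime then 0 else r n) / (n : ℝ) ^ x ≤
      (if n.Prime then 0 else r n) / (n : ℝ) := by
    intro n
    rcases Nat.eq_zero_or_pos n with rfl | hn
    · simp [hr]
    have hn1 : (1 : ℝ) ≤ n := mod_cast hn
    apply div_le_div_of_nonneg_left _ (by positivity)
    · exact Real.self_le_rpow_of_one_le hn1 hx.1.le
    · split_ifs; exacts [le_rfl, hr0 n]
  have h0 : ∀ n : ℕ, 0 ≤ (if n.Prime then 0 else r n) / (n : ℝ) ^ x := by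
    intro n
    have := hr0 n
    split_ifs <;> positivity
  have hs2 : Summable fun n : ℕ => (if n.Prime then 0 else r n) / (n : ℝ) ^ x :=
    Summable.of_nonneg_of_le h0 hle hs
  have key : ∑' n : ℕ, r n / (n : ℝ) ^ x =
      ∑' n : ℕ, indPrimeOne q n * Real.log n / (n : ℝ) ^ x +
        ∑' n : ℕ, (if n.Prime then 0 else r n) / (n : ℝ) ^ x := by
    rw [← (summable_indPrimeOne_mul_log_div hx.1).tsum_add hs2]
    refine tsum_congr fun n => ?_
    rw [← add_div]
    congr 1
    by_cases hp : n.Prime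
    · simp only [hp, if_true, indPrimeOne, indOne, hr, Set.indicator_apply, Set.mem_ofPred_eq,
        ArithmeticFunction.vonMangoldt_apply_prime hp]
      have : ((n : ZMod q) = 1) ↔ n % q = 1 % q := by
        have := ZMod.natCast_eq_natCast_iff' n 1 q
        simpa using this
      simp only [this]
      split_ifs <;> simp
    · simp [hp, indPrimeOne]
  have h1 := hC x hx
  rw [key] at h1
  have h2 := hs2.tsum_le_tsum hle hs
  have h3 : 0 ≤ ∑' n : ℕ, (if n.Prime then 0 else r n) / (n : ℝ) ^ x := tsum_nonneg h0
  have hD : ∑' n : ℕ, (if n.Prime then 0 else r n) / (n : ℝ) = D := rfl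
  rw [abs_le] at h1 ⊢
  constructor <;> linarith [h1.1, h1.2]

lemma exists_abs_tsum_indPrimeOne_add_log_le (q : ℕ) [NeZero q] :
    ∃ C : ℝ, ∀ x ∈ Set.Ioc (1 : ℝ) 2,
      |∑' n : ℕ, indPrimeOne q n / (n : ℝ) ^ x + (q.totient : ℝ)⁻¹ * Real.log (x - 1)| ≤ C := by
  obtain ⟨C, hC⟩ := exists_abs_tsum_indPrimeOne_mul_log_sub_le q
  set h : ℝ → ℝ := fun x =>
    ∑' n : ℕ, indPrimeOne q n / (n : ℝ) ^ x + (q.totient : ℝ)⁻¹ * Real.log (x - 1) with hh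
  have hd : ∀ x ∈ Set.Ioc (1 : ℝ) 2, HasDerivWithinAt h
      (-∑' n : ℕ, indPrimeOne q n * Real.log n / (n : ℝ) ^ x + (q.totient : ℝ)⁻¹ * (1 / (x - 1)))
      (Set.Ioc 1 2) x := by
    intro x hx
    refine (HasDerivAt.add (hasDerivAt_tsum_indPrimeOne hx.1) ?_).hasDerivWithinAt
    exact (((hasDerivAt_id x).sub_const 1).log (by simpa using (sub_pos.2 hx.1).ne')).const_mul _
  have hd_le : ∀ x ∈ Set.Ioc (1 : ℝ) 2, ‖-∑' n : ℕ, indPrimeOne q n * Real.log n / (n : ℝ) ^ x +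
      (q.totient : ℝ)⁻¹ * (1 / (x - 1))‖ ≤ C := by
    intro x hx
    rw [Real.norm_eq_abs, ← abs_neg]
    convert! hC x hx using 2
    ring
  refine ⟨C + |h 2|, fun x hx => ?_⟩
  have h1 := (convex_Ioc (1 : ℝ) 2).norm_image_sub_le_of_norm_hasDerivWithin_le hd hd_le
    (Set.right_mem_Ioc.2 (by norm_num : (1 : ℝ) < 2)) hx
  have hC0 : 0 ≤ C := (abs_nonneg _).trans (hC x hx)
  have h2 : ‖x - 2‖ ≤ 1 := by
    rw [Real.norm_eq_abs, abs_le]; constructor <;> linarith [hx.1, hx.2]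
  have h3 : ‖h x - h 2‖ ≤ C := h1.trans (by nlinarith)
  have h4 : |h x| ≤ |h x - h 2| + |h 2| := by
    simpa using abs_add_le (h x - h 2) (h 2)
  rw [Real.norm_eq_abs] at h3
  exact h4.trans (by linarith)

lemma primeSum_indOne_eq_tsum (q n : ℕ) :
    primeSum (indOne q) n = ∑' m : ℕ, if m ≤ n then indPrimeOne q m / (m : ℝ) else 0 := by
  rw [tsum_eq_sum (s := Finset.Icc 1 n)]
  · rw [primeSum, Finset.sum_filter]
    refine Finset.sum_congr rfl fun m hm => ?_
    rw [if_pos (Finset.mem_Icc.1 hm).2, indPrimeOne]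
    split_ifs <;> simp
  · intro m hm
    split_ifs with h
    · have : m = 0 := by
        by_contra h0
        exact hm (Finset.mem_Icc.2 ⟨Nat.pos_of_ne_zero h0, h⟩)
      simp [this]
    · rfl

lemma one_lt_log_natCast {n : ℕ} (hn : 3 ≤ n) : 1 < Real.log n := by
  rw [Real.lt_log_iff_exp_lt (by positivity)]
  have h1 := Real.exp_one_lt_d9
  have h2 : (3 : ℝ) ≤ n := mod_cast hn
  linarith

/-- Mertens' theorem for the primes congruent to `1` modulo `q`. -/
theorem exists_abs_primeSum_indOne_sub_le (q : ℕ) [NeZero q] :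
    ∃ C : ℝ, ∀ n : ℕ, 3 ≤ n → |primeSum (indOne q) n - LL n / q.totient| ≤ C := by
  obtain ⟨C₁, h₁⟩ := exists_abs_tsum_indPrimeOne_mul_log_sub_le q
  obtain ⟨C₂, h₂⟩ := exists_abs_tsum_indPrimeOne_add_log_le q
  refine ⟨Real.exp 1 * (1 + C₁) + C₂, fun n hn => ?_⟩
  have hL := one_lt_log_natCast hn
  set L := Real.log n with hLdef
  have hL0 : 0 < L := by linarith
  have hn0 : (0 : ℝ) < n := by positivity
  set x : ℝ := 1 + 1 / L with hx
  have hx1 : x ∈ Set.Ioc (1 : ℝ) 2 := by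
    have h3 : 1 / L ≤ 1 := by rw [div_le_one hL0]; exact hL.le
    have h4 : 0 < 1 / L := by positivity
    constructor <;> linarith
  have hsG := summable_indPrimeOne_mul_log_div (q := q) hx1.1
  have hsP := summable_indPrimeOne_div (q := q) hx1.1
  have hterm : ∀ m : ℕ, |indPrimeOne q m / (m : ℝ) ^ x -
      (if m ≤ n then indPrimeOne q m / (m : ℝ) else 0)| ≤
      Real.exp 1 / L * (indPrimeOne q m * Real.log m / (m : ℝ) ^ x) := by
    intro m
    rcases Nat.eq_zero_or_pos m with rfl | hm
    · simp [indPrimeOne_zero]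
    have hm0 : (0 : ℝ) < m := mod_cast hm
    have hu := indPrimeOne_nonneg q m
    have hlog : 0 ≤ Real.log m := Real.log_nonneg (by exact_mod_cast hm)
    have hpow : 0 < (m : ℝ) ^ x := by positivity
    have hsplit : (m : ℝ) ^ x = m * Real.exp (Real.log m / L) := by
      rw [hx, Real.rpow_add hm0, Real.rpow_one, Real.rpow_def_of_pos hm0]
      ring_nf
    have hexp0 := Real.exp_pos (Real.log m / L)
    split_ifs with h
    · have ht : Real.log m / L ≤ 1 := by
        rw [div_le_one hL0]
        exact Real.log_le_log hm0 (by exact_mod_cast h)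
      have ht0 : 0 ≤ Real.log m / L := by positivity
      set t := Real.log m / L
      have he : Real.exp t - 1 ≤ t * Real.exp 1 := by
        have h5 := Real.add_one_le_exp (-t)
        have h6 : Real.exp t * Real.exp (-t) = 1 := by rw [← Real.exp_add]; simp
        have h7 : Real.exp t ≤ Real.exp 1 := Real.exp_le_exp.2 ht
        nlinarith
      have he1 : 1 ≤ Real.exp t := Real.one_le_exp ht0
      have e1 : indPrimeOne q m / (m : ℝ) ^ x - indPrimeOne q m / (m : ℝ) =
          -(indPrimeOne q m / (m : ℝ) ^ x * (Real.exp t - 1)) := by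
        rw [hsplit]; field_simp; ring
      rw [e1, abs_neg, abs_of_nonneg (mul_nonneg (by positivity) (by linarith))]
      calc indPrimeOne q m / (m : ℝ) ^ x * (Real.exp t - 1)
          ≤ indPrimeOne q m / (m : ℝ) ^ x * (t * Real.exp 1) := by gcongr
        _ = _ := by simp only [t]; ring
    · rw [sub_zero, abs_of_nonneg (by positivity)]
      have h5 : L ≤ Real.log m := Real.log_le_log hn0 (by exact_mod_cast (not_le.1 h).le)
      have h6 : 1 ≤ Real.exp 1 := Real.one_le_exp (by norm_num)
      have h7 : 1 ≤ Real.exp 1 / L * Real.log m := by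
        rw [div_mul_eq_mul_div, le_div_iff₀ hL0]; nlinarith
      calc indPrimeOne q m / (m : ℝ) ^ x = indPrimeOne q m / (m : ℝ) ^ x * 1 := by ring
        _ ≤ indPrimeOne q m / (m : ℝ) ^ x * (Real.exp 1 / L * Real.log m) := by gcongr
        _ = _ := by ring
  have hsS : Summable fun m : ℕ => if m ≤ n then indPrimeOne q m / (m : ℝ) else 0 := by
    apply summable_of_hasFiniteSupport
    refine (Set.finite_Iic n).subset fun m hm => ?_
    by_contra h
    exact hm (if_neg h)
  have hdiff : |∑' m : ℕ, indPrimeOne q m / (m : ℝ) ^ x - primeSum (indOne q) n| ≤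
      Real.exp 1 / L * ∑' m : ℕ, (indPrimeOne q m * Real.log m / (m : ℝ) ^ x) := by
    rw [primeSum_indOne_eq_tsum, ← hsP.tsum_sub hsS, ← tsum_mul_left]
    have hs' := hsG.mul_left (Real.exp 1 / L)
    simp_rw [← Real.norm_eq_abs] at hterm ⊢
    exact tsum_of_norm_bounded hs'.hasSum hterm
  have hG := (abs_le.1 (h₁ x hx1)).2
  have hP := h₂ x hx1
  have hx' : x - 1 = 1 / L := by simp [hx]
  rw [hx'] at hG hP
  have htot : (q.totient : ℝ)⁻¹ ≤ 1 := by
    have : (1 : ℝ) ≤ q.totient := mod_cast Nat.totient_pos.2 (Nat.pos_of_neZero q)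
    exact inv_le_one_of_one_le₀ this
  have hC₁ : 0 ≤ C₁ := (abs_nonneg _).trans (h₁ x hx1)
  have hG2 : ∑' m : ℕ, (indPrimeOne q m * Real.log m / (m : ℝ) ^ x) ≤ L * (1 + C₁) := by
    have : (q.totient : ℝ)⁻¹ / (1 / L) ≤ L := by
      rw [div_div_eq_mul_div, div_one]; nlinarith
    nlinarith
  have hdiff2 : |∑' m : ℕ, indPrimeOne q m / (m : ℝ) ^ x - primeSum (indOne q) n| ≤
      Real.exp 1 * (1 + C₁) := by
    refine hdiff.trans ?_
    calc _ ≤ Real.exp 1 / L * (L * (1 + C₁)) := by gcongr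
      _ = _ := by field_simp
  rw [one_div, Real.log_inv] at hP
  have e2 : LL n / q.totient = (q.totient : ℝ)⁻¹ * Real.log L := by
    rw [LL, ← hLdef]; field_simp
  rw [e2]
  rw [abs_le] at hdiff2 hP ⊢
  constructor <;> linarith [hdiff2.1, hdiff2.2, hP.1, hP.2]

/-- The primes congruent to `1` modulo `q` in `(K, K * q + 1]`. -/
def blockPrimes (q K : ℕ) : Finset ℕ :=
  (Finset.Icc (K + 1) (K * q + 1)).filter fun p => p.Prime ∧ p % q = 1 % q

open Nat in
lemma ordCompl_factorial_dvd_prod {q : ℕ} (hq : q.Prime) (K : ℕ) :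
    K ! / q ^ (K !).factorization q ∣ ∏ k ∈ Finset.range K, ((k + 1) * q + 1) := by
  set u := K ! / q ^ (K !).factorization q with hu
  have hcop : Nat.Coprime q u := Nat.coprime_ordCompl hq (Nat.factorial_ne_zero K)
  have hunit : IsUnit ((q : ℕ) : ZMod u) := (ZMod.isUnit_iff_coprime q u).2 hcop
  have hu0 : u ≠ 0 := (Nat.ordCompl_pos q (Nat.factorial_ne_zero K)).ne'
  have : NeZero u := ⟨hu0⟩
  obtain ⟨v, hv⟩ := hunit
  set r : ℕ := ((v⁻¹ : (ZMod u)ˣ) : ZMod u).val with hr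
  have hqr : (q : ZMod u) * (r : ZMod u) = 1 := by
    rw [hr, ZMod.natCast_val, ZMod.cast_id, ← hv, Units.mul_inv]
  rw [← ZMod.natCast_eq_zero_iff]
  have h1 : ((∏ k ∈ Finset.range K, ((k + 1) * q + 1) : ℕ) : ZMod u) =
      ((q ^ K * (r + 1).ascFactorial K : ℕ) : ZMod u) := by
    rw [Nat.ascFactorial_eq_prod_range]
    push_cast
    have : (q : ZMod u) ^ K = ∏ k ∈ Finset.range K, (q : ZMod u) := by simp
    rw [this, ← Finset.prod_mul_distrib]
    refine Finset.prod_congr rfl fun k _ => ?_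
    linear_combination -hqr
  rw [h1, ZMod.natCast_eq_zero_iff]
  exact Dvd.dvd.mul_left ((Nat.ordCompl_dvd _ _).trans (Nat.factorial_dvd_ascFactorial _ _)) _

open Nat in
lemma prod_blockPrimes_le {q : ℕ} (hq : q.Prime) (K : ℕ) :
    ∏ p ∈ blockPrimes q K, p ≤ q ^ (3 * K) := by
  set v := (K !).factorization q with hv
  set u := K ! / q ^ v with hu
  set D := ∏ k ∈ Finset.range K, ((k + 1) * q + 1) with hD
  have hu0 : 0 < u := Nat.ordCompl_pos q (Nat.factorial_ne_zero K)
  obtain ⟨N, hN⟩ := ordCompl_factorial_dvd_prod hq K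
  rw [← hv, ← hu, ← hD] at hN
  have hD0 : 0 < D := Finset.prod_pos fun k _ => by positivity
  have hN0 : 0 < N := Nat.pos_of_ne_zero fun h => by simp [h] at hN; omega
  have hvK : v ≤ K := by
    have h1 := Nat.sub_one_mul_factorization_factorial (n := K) hq
    have h2 : 1 ≤ q - 1 := by have := hq.two_le; omega
    have h3 : (q - 1) * v ≤ K := by rw [hv, h1]; exact Nat.sub_le _ _
    exact (Nat.le_mul_of_pos_left v h2).trans h3
  have hdvd : ∏ p ∈ blockPrimes q K, p ∣ N := by
    refine Finset.prod_primes_dvd N (fun p hp => ?_) fun p hp => ?_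
    · exact (Finset.mem_filter.1 hp).2.1.prime
    · obtain ⟨hpI, hpp, hpq⟩ := Finset.mem_filter.1 hp
      rw [Finset.mem_Icc] at hpI
      have hpD : p ∣ D := by
        have h1q : 1 % q = 1 := Nat.mod_eq_of_lt hq.one_lt
        rw [h1q] at hpq
        have hdm := Nat.div_add_mod p q
        rw [hpq] at hdm
        have hk1 : 1 ≤ p / q := by
          rcases Nat.eq_zero_or_pos (p / q) with h0 | h0
          · rw [h0] at hdm; have := hpp.one_lt; omega
          · exact h0
        have hkK : p / q ≤ K := by
          have h4 : q * (p / q) ≤ q * K := by rw [mul_comm q K]; omega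
          exact Nat.le_of_mul_le_mul_left h4 hq.pos
        have : p = (p / q - 1 + 1) * q + 1 := by
          rw [Nat.sub_add_cancel hk1, mul_comm]; exact hdm.symm
        rw [hD, this]
        exact Finset.dvd_prod_of_mem (fun k => (k + 1) * q + 1)
          (Finset.mem_range.2 (by omega : p / q - 1 < K))
      rw [hN] at hpD
      rcases (Nat.Prime.dvd_mul hpp).1 hpD with h | h
      · have := (Nat.Prime.dvd_factorial hpp).1 (h.trans (Nat.ordCompl_dvd _ _))
        omega
      · exact h
  refine (Nat.le_of_dvd hN0 hdvd).trans ?_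
  have hDle : D ≤ (K + 1)! * q ^ K := by
    have : (K + 1)! * q ^ K = ∏ k ∈ Finset.range K, ((k + 2) * q) := by
      rw [Finset.prod_mul_distrib, Finset.prod_const, Finset.card_range]
      congr 1
      rw [← Finset.prod_range_add_one_eq_factorial, Finset.prod_range_succ']
      simp [add_assoc]
    rw [this]
    refine Finset.prod_le_prod' fun k _ => ?_
    have := hq.one_le
    nlinarith
  have hfac : K ! = q ^ v * u := (Nat.ordProj_mul_ordCompl_eq_self (K !) q).symm
  have hqv : q ^ v ≤ q ^ K := Nat.pow_le_pow_right hq.pos hvK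
  have h5 : u * N ≤ u * ((K + 1) * q ^ (2 * K)) := by
    calc u * N = D := hN.symm
      _ ≤ (K + 1) * (q ^ v * u) * q ^ K := by rw [← hfac]; exact hDle
      _ ≤ (K + 1) * (q ^ K * u) * q ^ K := by gcongr
      _ = _ := by ring
  have h6 := Nat.le_of_mul_le_mul_left h5 hu0
  have h7 : K + 1 ≤ q ^ K := (Nat.succ_le_of_lt (Nat.lt_two_pow_self)).trans
    (Nat.pow_le_pow_left hq.two_le K)
  calc N ≤ (K + 1) * q ^ (2 * K) := h6
    _ ≤ q ^ K * q ^ (2 * K) := by gcongr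
    _ = _ := by rw [← pow_add]; congr 1; ring

lemma sum_log_blockPrimes_le {q : ℕ} (hq : q.Prime) (K : ℕ) :
    ∑ p ∈ blockPrimes q K, Real.log p ≤ 3 * K * Real.log q := by
  have h0 : ∀ p ∈ blockPrimes q K, (p : ℝ) ≠ 0 := fun p hp =>
    Nat.cast_ne_zero.2 (Finset.mem_filter.1 hp).2.1.ne_zero
  rw [← Real.log_prod h0]
  have h1 : ((∏ p ∈ blockPrimes q K, p : ℕ) : ℝ) ≤ ((q ^ (3 * K) : ℕ) : ℝ) :=
    mod_cast prod_blockPrimes_le hq K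
  have hpos : (0 : ℝ) < ∏ p ∈ blockPrimes q K, (p : ℝ) :=
    Finset.prod_pos fun p hp => Nat.cast_pos.2 (Finset.mem_filter.1 hp).2.1.pos
  push_cast at h1
  have h2 := Real.log_le_log hpos h1
  rw [Real.log_pow] at h2
  push_cast at h2
  exact h2

lemma sum_inv_dyadic_le {q : ℕ} (hq : q.Prime) {j : ℕ} (hj : 1 ≤ j) :
    ∑ p ∈ (blockPrimes q (2 ^ j)).filter (fun p => q * 2 ^ (j - 1) < p), (1 / p : ℝ) ≤
      9 * (Real.log q / q) * (1 / j) := by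
  have hq0 : (0 : ℝ) < q := mod_cast hq.pos
  have hlq : 0 ≤ Real.log q := Real.log_nonneg (mod_cast hq.one_le)
  have hj0 : (0 : ℝ) < j := mod_cast hj
  have hl2 : 2 / 3 < Real.log 2 := by have := Real.log_two_gt_d9; linarith
  set c : ℝ := 2 / 3 * j * (q * 2 ^ (j - 1)) with hc
  have hc0 : 0 < c := by positivity
  have hterm : ∀ p ∈ (blockPrimes q (2 ^ j)).filter (fun p => q * 2 ^ (j - 1) < p),
      (1 / p : ℝ) ≤ Real.log p / c := by
    intro p hp
    obtain ⟨hp1, hp2⟩ := Finset.mem_filter.1 hp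
    have hp3 : (q * 2 ^ (j - 1) : ℝ) ≤ p := by exact_mod_cast hp2.le
    have hp0 : (0 : ℝ) < p := lt_of_lt_of_le (by positivity) hp3
    have hlog : 2 / 3 * j ≤ Real.log p := by
      have h2j : (2 : ℝ) ^ j ≤ p := by
        refine le_trans ?_ hp3
        obtain ⟨k, rfl⟩ : ∃ k, j = k + 1 := ⟨j - 1, by omega⟩
        rw [pow_succ, Nat.add_sub_cancel, mul_comm]
        gcongr
        exact_mod_cast hq.two_le
      have := Real.log_le_log (by positivity) h2j
      rw [Real.log_pow] at this
      nlinarith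
    rw [div_le_div_iff₀ hp0 hc0, one_mul, hc]
    gcongr
  refine (Finset.sum_le_sum hterm).trans ?_
  rw [← Finset.sum_div]
  have h1 : ∑ p ∈ (blockPrimes q (2 ^ j)).filter (fun p => q * 2 ^ (j - 1) < p), Real.log p ≤
      3 * 2 ^ j * Real.log q := by
    have h2 := sum_log_blockPrimes_le hq (2 ^ j)
    push_cast at h2
    refine le_trans (Finset.sum_le_sum_of_subset_of_nonneg (Finset.filter_subset _ _) ?_) h2
    intro p _ _
    exact Real.log_natCast_nonneg p
  rw [div_le_iff₀ hc0]
  refine h1.trans (le_of_eq ?_)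
  obtain ⟨k, rfl⟩ : ∃ k, j = k + 1 := ⟨j - 1, by omega⟩
  rw [hc, Nat.add_sub_cancel, pow_succ]
  field_simp
  norm_num [mul_comm]

/-- A Brun–Titchmarsh type bound, losing only a factor `log q`. -/
theorem primeSum_indOne_le {q : ℕ} (hq : q.Prime) (hq3 : 3 ≤ q) {n : ℕ} (hn : 3 ≤ n) :
    primeSum (indOne q) n ≤ 9 * (Real.log q / q) * (LL n + 3) := by
  set S := ((Finset.Icc 1 n).filter Nat.Prime).filter fun p => p % q = 1 % q with hS
  have h1 : primeSum (indOne q) n = ∑ p ∈ S, (1 / p : ℝ) := by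
    rw [primeSum, hS, Finset.sum_filter (fun p => p % q = 1 % q) (fun p => (1 / p : ℝ))]
    refine Finset.sum_congr rfl fun p _ => ?_
    rw [indOne]; split_ifs <;> simp
  set J := Nat.clog 2 n with hJ
  have hmaps : ∀ p ∈ S, Nat.clog 2 ((p - 1) / q) ∈ Finset.Icc 1 J ∧
      p ∈ (blockPrimes q (2 ^ Nat.clog 2 ((p - 1) / q))).filter
        (fun r => q * 2 ^ (Nat.clog 2 ((p - 1) / q) - 1) < r) := by
    intro p hp
    simp only [hS, Finset.mem_filter, Finset.mem_Icc] at hp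
    obtain ⟨⟨⟨_, hpn⟩, hpp⟩, hpq⟩ := hp
    have h1q : 1 % q = 1 := Nat.mod_eq_of_lt hq.one_lt
    have hpq' := hpq
    rw [h1q] at hpq
    have hdm := Nat.div_add_mod p q
    rw [hpq] at hdm
    set k := p / q with hk
    have hkk : (p - 1) / q = k := by
      have : p - 1 = q * k := Nat.sub_eq_of_eq_add hdm.symm
      rw [this, Nat.mul_div_cancel_left _ hq.pos]
    rw [hkk]
    have hk2 : 2 ≤ k := by
      by_contra hlt
      have hk01 : k = 0 ∨ k = 1 := Nat.le_one_iff_eq_zero_or_eq_one.1 (Nat.lt_succ_iff.1 (not_le.1 hlt))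
      rcases hk01 with h0 | h0
      · rw [h0] at hdm; have := hpp.one_lt; omega
      · rw [h0, mul_one] at hdm
        rcases hq.eq_two_or_odd with h2 | h2
        · omega
        · rcases hpp.eq_two_or_odd with h3 | h3 <;> omega
    set j := Nat.clog 2 k with hj
    have hj1 : 1 ≤ j := Nat.clog_pos one_lt_two hk2
    have hle : k ≤ 2 ^ j := Nat.le_pow_clog one_lt_two k
    have hlt : 2 ^ (j - 1) < k := Nat.pow_pred_clog_lt_self one_lt_two hk2
    have hkn : k ≤ n := (Nat.div_le_self p q).trans hpn
    refine ⟨Finset.mem_Icc.2 ⟨hj1, Nat.clog_mono_right 2 hkn⟩, ?_⟩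
    have hlt2 : q * 2 ^ (j - 1) < p := by
      have := Nat.mul_lt_mul_of_pos_left hlt hq.pos
      omega
    refine Finset.mem_filter.2 ⟨Finset.mem_filter.2 ⟨Finset.mem_Icc.2 ⟨?_, ?_⟩, hpp, hpq'⟩, hlt2⟩
    · have : 2 ^ j ≤ q * 2 ^ (j - 1) := by
        obtain ⟨i, hi⟩ : ∃ i, j = i + 1 := ⟨j - 1, by omega⟩
        rw [hi, Nat.add_sub_cancel, pow_succ, mul_comm]
        gcongr
        omega
      omega
    · have := Nat.mul_le_mul_left q hle
      rw [mul_comm (2 ^ j)]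
      omega
  rw [h1, ← Finset.sum_fiberwise_of_maps_to (g := fun p => Nat.clog 2 ((p - 1) / q))
    (t := Finset.Icc 1 J) (fun p hp => (hmaps p hp).1)]
  have hq0 : (0 : ℝ) < q := mod_cast hq.pos
  have hlq : 0 ≤ Real.log q := Real.log_nonneg (mod_cast hq.one_le)
  calc _ ≤ ∑ j ∈ Finset.Icc 1 J, 9 * (Real.log q / q) * (1 / j) := by
        refine Finset.sum_le_sum fun j hj => ?_
        refine le_trans (Finset.sum_le_sum_of_subset_of_nonneg ?_ ?_)
          (sum_inv_dyadic_le hq (Finset.mem_Icc.1 hj).1)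
        · intro p hp
          obtain ⟨hpS, hpj⟩ := Finset.mem_filter.1 hp
          have := (hmaps p hpS).2
          rwa [hpj] at this
        · intro p _ _; positivity
    _ = 9 * (Real.log q / q) * ∑ j ∈ Finset.Icc 1 J, (1 / j : ℝ) := by rw [Finset.mul_sum]
    _ ≤ _ := by
        gcongr
        have hh := harmonic_le_one_add_log J
        rw [harmonic_eq_sum_Icc] at hh
        push_cast at hh
        simp_rw [one_div]
        refine hh.trans ?_
        have hL := one_lt_log_natCast hn
        have hJle : (J : ℝ) ≤ 3 * Real.log n := by
          have hJ1 : 1 ≤ J := Nat.clog_pos one_lt_two (by omega)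
          have h2 : 2 ^ (J - 1) < n := Nat.pow_pred_clog_lt_self one_lt_two (by omega)
          have h3 : ((2 : ℝ) ^ (J - 1)) ≤ n := by exact_mod_cast h2.le
          have h4 := Real.log_le_log (by positivity) h3
          rw [Real.log_pow, Nat.cast_sub hJ1, Nat.cast_one] at h4
          have hl2 : 2 / 3 < Real.log 2 := by have := Real.log_two_gt_d9; linarith
          have hJ1' : (0 : ℝ) ≤ (J : ℝ) - 1 := by
            have : (1 : ℝ) ≤ J := mod_cast hJ1
            linarith
          nlinarith
        have hJ0 : (0 : ℝ) < J := mod_cast Nat.clog_pos one_lt_two (by omega)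
        have h5 := Real.log_le_log hJ0 hJle
        rw [Real.log_mul (by norm_num) (by positivity)] at h5
        have h6 : Real.log 3 ≤ 2 := by
          have := Real.log_le_sub_one_of_pos (show (0 : ℝ) < 3 by norm_num); linarith
        rw [LL]; linarith

/-- The proportion of the `m ∈ {1, …, n}` satisfying `P`. -/
def dens (P : ℕ → Prop) (n : ℕ) : ℝ := (cnt P n : ℝ) / n

lemma cnt_eq_card (P : ℕ → Prop) [DecidablePred P] (n : ℕ) : cnt P n = ((Finset.Icc 1 n).filter P).card := by
  rw [cnt, ← Set.ncard_coe_finset]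
  congr 1
  ext m
  simp [and_assoc]

lemma dens_nonneg (P : ℕ → Prop) (n : ℕ) : 0 ≤ dens P n := by
  rw [dens]; positivity

lemma dens_mono {P Q : ℕ → Prop} {n : ℕ} (h : ∀ m, 1 ≤ m → m ≤ n → P m → Q m) :
    dens P n ≤ dens Q n := by
  classical
  rw [dens, dens, cnt_eq_card, cnt_eq_card]
  gcongr 1
  refine Nat.cast_le.2 (Finset.card_le_card fun m hm => ?_)
  simp only [Finset.mem_filter, Finset.mem_Icc] at hm ⊢
  exact ⟨hm.1, h m hm.1.1 hm.1.2 hm.2⟩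

lemma dens_or_le (P Q : ℕ → Prop) (n : ℕ) :
    dens (fun m => P m ∨ Q m) n ≤ dens P n + dens Q n := by
  classical
  rw [dens, dens, dens, cnt_eq_card, cnt_eq_card, cnt_eq_card, ← add_div]
  gcongr 1
  have h : (Finset.Icc 1 n).filter (fun m => P m ∨ Q m) =
      (Finset.Icc 1 n).filter P ∪ (Finset.Icc 1 n).filter Q := by
    ext m; simp [and_or_left]
  have h' := Finset.card_union_le ((Finset.Icc 1 n).filter P) ((Finset.Icc 1 n).filter Q)
  rw [← h] at h'
  exact_mod_cast h'

lemma dens_exists_mem_le {ι : Type*} (s : Finset ι) (P : ι → ℕ → Prop) (n : ℕ) :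
    dens (fun m => ∃ i ∈ s, P i m) n ≤ ∑ i ∈ s, dens (P i) n := by
  classical
  induction s using Finset.induction_on with
  | empty => simp [dens, cnt]
  | insert a s ha ih =>
    rw [Finset.sum_insert ha]
    refine le_trans (dens_mono fun m _ _ hm => ?_)
      ((dens_or_le (P a) (fun m => ∃ i ∈ s, P i m) n).trans (add_le_add_right ih _))
    obtain ⟨i, hi, hP⟩ := hm
    rcases Finset.mem_insert.1 hi with rfl | hi
    · exact Or.inl hP
    · exact Or.inr ⟨i, hi, hP⟩

lemma dens_le_of_le_mul {P : ℕ → Prop} {f : ℕ → ℝ} {n : ℕ} {t B : ℝ} (ht : 0 < t)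
    (hf : ∀ m ∈ Finset.Icc 1 n, 0 ≤ f m) (hP : ∀ m ∈ Finset.Icc 1 n, P m → t ≤ f m)
    (hB : ∑ m ∈ Finset.Icc 1 n, f m ≤ n * B) (hB0 : 0 ≤ B) : dens P n ≤ B / t := by
  classical
  rcases Nat.eq_zero_or_pos n with rfl | hn
  · simp only [dens, Nat.cast_zero, div_zero]; positivity
  have hn0 : (0 : ℝ) < n := mod_cast hn
  rw [dens, cnt_eq_card, div_le_div_iff₀ hn0 ht, mul_comm B]
  refine le_trans ?_ hB
  rw [← nsmul_eq_mul]
  refine (Finset.card_nsmul_le_sum _ f t fun m hm => ?_).trans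
    (Finset.sum_le_sum_of_subset_of_nonneg (Finset.filter_subset P _) fun m hm _ => hf m hm)
  exact hP m (Finset.mem_filter.1 hm).1 (Finset.mem_filter.1 hm).2

/-- The property `P n` of `m ≤ n` fails for almost all `m`, asymptotically. -/
def Negligible (P : ℕ → ℕ → Prop) : Prop :=
  Tendsto (fun n => dens (P n) n) atTop (nhds 0)

lemma Negligible.mono {P Q : ℕ → ℕ → Prop} (hQ : Negligible Q)
    (h : ∀ᶠ n in atTop, ∀ m, 1 ≤ m → m ≤ n → P n m → Q n m) : Negligible P :=
  tendsto_of_tendsto_of_tendsto_of_le_of_le' tendsto_const_nhds hQ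
    (Eventually.of_forall fun _ => dens_nonneg _ _) (h.mono fun _ hn => dens_mono hn)

lemma Negligible.exists_mem {ι : Type*} (s : Finset ι) {P : ι → ℕ → ℕ → Prop}
    (h : ∀ i ∈ s, Negligible (P i)) : Negligible fun n m => ∃ i ∈ s, P i n m := by
  have h' := tendsto_finsetSum s h
  rw [Finset.sum_const_zero] at h'
  exact tendsto_of_tendsto_of_tendsto_of_le_of_le tendsto_const_nhds h'
    (fun _ => dens_nonneg _ _) (fun _ => dens_exists_mem_le _ _ _)

/-- The primes up to `n` congruent to `1` modulo `q`. -/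
def primesOne (q n : ℕ) : Finset ℕ :=
  ((Finset.Icc 1 n).filter Nat.Prime).filter fun p => p % q = 1 % q

lemma primeSum_indOne_eq (q n : ℕ) :
    primeSum (indOne q) n = ∑ p ∈ primesOne q n, (1 / p : ℝ) := by
  rw [primeSum, primesOne, Finset.sum_filter (fun p => p % q = 1 % q) (fun p => (1 / p : ℝ))]
  refine Finset.sum_congr rfl fun p _ => ?_
  rw [indOne]; split_ifs <;> simp

lemma prime_of_mem_primesOne {q n p : ℕ} (hp : p ∈ primesOne q n) : p.Prime :=
  (Finset.mem_filter.1 (Finset.mem_filter.1 hp).1).2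

lemma omegaQ_eq_card {q n m : ℕ} (hm : m ∈ Finset.Icc 1 n) :
    omegaQ m q = ((primesOne q n).filter (· ∣ m)).card := by
  rw [omegaQ]
  congr 1
  ext p
  rw [Finset.mem_Icc] at hm
  simp only [primesOne, Finset.mem_filter, Nat.mem_primeFactors, Finset.mem_Icc]
  constructor
  · rintro ⟨⟨hp, hd, _⟩, h⟩
    exact ⟨⟨⟨⟨hp.one_le, (Nat.le_of_dvd hm.1 hd).trans hm.2⟩, hp⟩, h⟩, hd⟩
  · rintro ⟨⟨⟨_, hp⟩, h⟩, hd⟩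
    exact ⟨⟨hp, hd, by omega⟩, h⟩

lemma card_filter_dvd (n d : ℕ) : ((Finset.Icc 1 n).filter (d ∣ ·)).card = n / d :=
  Nat.Ioc_filter_dvd_card_eq_div n d

lemma sum_omegaQ_eq (q n : ℕ) :
    ∑ m ∈ Finset.Icc 1 n, omegaQ m q = ∑ p ∈ primesOne q n, n / p := by
  rw [Finset.sum_congr rfl fun m hm => omegaQ_eq_card hm]
  simp_rw [← card_filter_dvd, Finset.card_filter]
  exact Finset.sum_comm

lemma sum_omegaQ_le (q n : ℕ) :
    ∑ m ∈ Finset.Icc 1 n, (omegaQ m q : ℝ) ≤ n * primeSum (indOne q) n := by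
  have h := sum_omegaQ_eq q n
  rw [primeSum_indOne_eq, Finset.mul_sum, ← Nat.cast_sum, h, Nat.cast_sum]
  refine Finset.sum_le_sum fun p _ => ?_
  rw [mul_one_div]
  exact Nat.cast_div_le

lemma le_sum_omegaQ (q n : ℕ) :
    n * primeSum (indOne q) n - n ≤ ∑ m ∈ Finset.Icc 1 n, (omegaQ m q : ℝ) := by
  have h := sum_omegaQ_eq q n
  rw [primeSum_indOne_eq, Finset.mul_sum, ← Nat.cast_sum, h, Nat.cast_sum]
  have hc : ((primesOne q n).card : ℝ) ≤ n := by
    have : (primesOne q n).card ≤ (Finset.Icc 1 n).card :=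
      Finset.card_le_card ((Finset.filter_subset _ _).trans (Finset.filter_subset _ _))
    rw [Nat.card_Icc, Nat.add_sub_cancel] at this
    exact_mod_cast this
  have h1 : ∑ p ∈ primesOne q n, ((n : ℝ) * (1 / p) - 1) ≤ ∑ p ∈ primesOne q n, ((n / p : ℕ) : ℝ) := by
    refine Finset.sum_le_sum fun p hp => ?_
    rw [mul_one_div]
    have hp0 : (0 : ℝ) < p := mod_cast (prime_of_mem_primesOne hp).pos
    have := Nat.lt_floor_add_one ((n : ℝ) / p)
    rw [Nat.floor_div_eq_div] at this
    linarith
  rw [Finset.sum_sub_distrib, Finset.sum_const, nsmul_eq_mul, mul_one] at h1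
  linarith

lemma sum_omegaQ_mul_le (q n : ℕ) :
    ∑ m ∈ Finset.Icc 1 n, (omegaQ m q : ℝ) * (omegaQ m q - 1) ≤
      n * primeSum (indOne q) n ^ 2 := by
  have h1 : ∀ m ∈ Finset.Icc 1 n, (omegaQ m q : ℝ) * (omegaQ m q - 1) =
      ∑ x ∈ (primesOne q n).offDiag, if x.1 * x.2 ∣ m then (1 : ℝ) else 0 := by
    intro m hm
    rw [← Finset.sum_filter, Finset.sum_const, nsmul_eq_mul, mul_one, omegaQ_eq_card hm]
    have h2 : (primesOne q n).offDiag.filter (fun x => x.1 * x.2 ∣ m) =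
        ((primesOne q n).filter (· ∣ m)).offDiag := by
      ext ⟨a, b⟩
      simp only [Finset.mem_filter, Finset.mem_offDiag]
      constructor
      · rintro ⟨⟨ha, hb, hab⟩, h⟩
        exact ⟨⟨ha, (dvd_mul_right _ _).trans h⟩, ⟨hb, (dvd_mul_left _ _).trans h⟩, hab⟩
      · rintro ⟨⟨ha, ha'⟩, ⟨hb, hb'⟩, hab⟩
        exact ⟨⟨ha, hb, hab⟩, Nat.Coprime.mul_dvd_of_dvd_of_dvd
          ((Nat.coprime_primes (prime_of_mem_primesOne ha) (prime_of_mem_primesOne hb)).2 hab)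
          ha' hb'⟩
    rw [h2, Finset.offDiag_card, Nat.cast_sub (Nat.le_mul_self _)]
    push_cast
    ring
  rw [Finset.sum_congr rfl h1, Finset.sum_comm, primeSum_indOne_eq, sq, Finset.sum_mul_sum]
  have h3 : ∑ i ∈ primesOne q n, ∑ j ∈ primesOne q n, (1 / i * (1 / j) : ℝ) =
      ∑ x ∈ primesOne q n ×ˢ primesOne q n, (1 / x.1 * (1 / x.2) : ℝ) :=
    (Finset.sum_product' _ _ _).symm
  rw [h3, Finset.mul_sum]
  refine le_trans (Finset.sum_le_sum fun x _ => ?_)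
    (Finset.sum_le_sum_of_subset_of_nonneg (f := fun x : ℕ × ℕ => (n : ℝ) * (1 / x.1 * (1 / x.2)))
      (fun x hx => Finset.mem_product.2 ⟨(Finset.mem_offDiag.1 hx).1, (Finset.mem_offDiag.1 hx).2.1⟩)
      fun x _ _ => by positivity)
  rw [← Finset.sum_filter, Finset.sum_const, nsmul_eq_mul, mul_one, card_filter_dvd]
  refine Nat.cast_div_le.trans (le_of_eq ?_)
  push_cast
  rw [one_div_mul_one_div, mul_one_div]

lemma primeSum_indOne_nonneg (q n : ℕ) : 0 ≤ primeSum (indOne q) n := by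
  rw [primeSum_indOne_eq]
  exact Finset.sum_nonneg fun p _ => by positivity

/-- The Turán–Kubilius inequality for `ω(·; q, 1)`. -/
lemma sum_omegaQ_sub_sq_le (q n : ℕ) :
    ∑ m ∈ Finset.Icc 1 n, ((omegaQ m q : ℝ) - primeSum (indOne q) n) ^ 2 ≤
      n * (3 * primeSum (indOne q) n) := by
  set s := primeSum (indOne q) n with hs
  have hs0 : 0 ≤ s := primeSum_indOne_nonneg q n
  have h : ∀ m ∈ Finset.Icc 1 n, ((omegaQ m q : ℝ) - s) ^ 2 =
      (omegaQ m q : ℝ) * (omegaQ m q - 1) + (1 - 2 * s) * omegaQ m q + s ^ 2 := by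
    intro m _; ring
  rw [Finset.sum_congr rfl h, Finset.sum_add_distrib, Finset.sum_add_distrib, ← Finset.mul_sum,
    Finset.sum_const, Nat.card_Icc, Nat.add_sub_cancel, nsmul_eq_mul]
  have h1 := sum_omegaQ_mul_le q n
  have h2 := sum_omegaQ_le q n
  have h3 := le_sum_omegaQ q n
  rw [← hs] at h1 h2 h3
  nlinarith

lemma tendsto_LL : Tendsto LL atTop atTop :=
  Real.tendsto_log_atTop.comp (Real.tendsto_log_atTop.comp tendsto_natCast_atTop_atTop)

theorem negligible_omegaQ_sub (q : ℕ) [NeZero q] {ε : ℝ} (hε : 0 < ε) :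
    Negligible fun n m => ε * LL n ≤ |(omegaQ m q : ℝ) - LL n / q.totient| := by
  obtain ⟨C, hC⟩ := exists_abs_primeSum_indOne_sub_le q
  have hlim : Tendsto (fun n => 3 * (LL n / q.totient + C) / (ε / 2 * LL n) ^ 2) atTop
      (nhds 0) := by
    have h1 := (tendsto_LL.inv_tendsto_atTop)
    have h2 : Tendsto (fun n => 12 / ε ^ 2 * (1 / q.totient * (LL n)⁻¹ + C * ((LL n)⁻¹ * (LL n)⁻¹)))
        atTop (nhds (12 / ε ^ 2 * (1 / q.totient * 0 + C * (0 * 0)))) :=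
      (((h1.const_mul _).add ((h1.mul h1).const_mul _)).const_mul _)
    simp only [mul_zero, add_zero] at h2
    refine h2.congr' ?_
    filter_upwards [tendsto_LL.eventually_gt_atTop 0] with n hn
    field_simp
    ring
  refine tendsto_of_tendsto_of_tendsto_of_le_of_le' tendsto_const_nhds hlim
    (Eventually.of_forall fun _ => dens_nonneg _ _) ?_
  filter_upwards [eventually_ge_atTop 3, tendsto_LL.eventually_ge_atTop (2 * C / ε),
    tendsto_LL.eventually_gt_atTop 0] with n hn hn2 hn3
  have hs := abs_le.1 (hC n hn)
  have hs0 := primeSum_indOne_nonneg q n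
  have hCL : C ≤ ε / 2 * LL n := by
    rw [div_le_iff₀ hε] at hn2; linarith
  refine dens_le_of_le_mul (f := fun m => ((omegaQ m q : ℝ) - primeSum (indOne q) n) ^ 2)
    (by positivity) (fun m _ => sq_nonneg _) (fun m _ hm => ?_)
    ((sum_omegaQ_sub_sq_le q n).trans ?_) (by linarith)
  · rw [← sq_abs ((omegaQ m q : ℝ) - primeSum (indOne q) n)]
    gcongr
    have := abs_sub_le (omegaQ m q : ℝ) (primeSum (indOne q) n) (LL n / q.totient)
    have := hC n hn
    linarith
  · gcongr; linarith

lemma summable_log_div_sq : Summable fun q : ℕ => (Real.log q / q) ^ 2 := by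
  have h : Summable fun q : ℕ => 16 * (q : ℝ) ^ (-(3 / 2) : ℝ) :=
    (Real.summable_nat_rpow.2 (by norm_num)).mul_left _
  refine Summable.of_nonneg_of_le (fun q => sq_nonneg _) (fun q => ?_) h
  rcases Nat.eq_zero_or_pos q with rfl | hq
  · simp
  have hq0 : (0 : ℝ) < q := mod_cast hq
  have h1 := Real.log_le_rpow_div hq0.le (show (0 : ℝ) < 1 / 4 by norm_num)
  have h2 : Real.log q / q ≤ 4 * (q : ℝ) ^ (-(3 / 4) : ℝ) := by
    rw [div_le_iff₀ hq0]
    refine h1.trans (le_of_eq ?_)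
    have : (q : ℝ) ^ (-(3 / 4) : ℝ) * q = (q : ℝ) ^ (1 / 4 : ℝ) := by
      nth_rewrite 2 [← Real.rpow_one (q : ℝ)]
      rw [← Real.rpow_add hq0]; norm_num
    rw [mul_assoc, this]; ring
  have h3 : 0 ≤ Real.log q / q := div_nonneg (Real.log_natCast_nonneg q) hq0.le
  calc (Real.log q / q) ^ 2 ≤ (4 * (q : ℝ) ^ (-(3 / 4) : ℝ)) ^ 2 := by gcongr
    _ = _ := by
      rw [mul_pow, ← Real.rpow_natCast ((q : ℝ) ^ _), ← Real.rpow_mul hq0.le]; norm_num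

lemma dens_omegaQ_ge_le {q : ℕ} (hq : q.Prime) (hq3 : 3 ≤ q) {c : ℝ} {n : ℕ} (hc : 0 < c)
    (hn : 3 ≤ n) (hn2 : 2 ≤ c * LL n) (hn3 : 3 ≤ LL n) :
    dens (fun m => c * LL n ≤ omegaQ m q) n ≤ 648 / c ^ 2 * (Real.log q / q) ^ 2 := by
  have hL0 : 0 < LL n := by linarith
  have h1 := primeSum_indOne_le hq hq3 hn
  have h0 := primeSum_indOne_nonneg q n
  have hlq : 0 ≤ Real.log q / q := div_nonneg (Real.log_natCast_nonneg q) (Nat.cast_nonneg _)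
  have key := dens_le_of_le_mul (P := fun m => c * LL n ≤ omegaQ m q)
    (f := fun m => (omegaQ m q : ℝ) * (omegaQ m q - 1)) (n := n)
    (t := (c * LL n) ^ 2 / 2) (B := primeSum (indOne q) n ^ 2) (by positivity)
    (fun m _ => ?_) (fun m _ hm => ?_) (sum_omegaQ_mul_le q n) (sq_nonneg _)
  · refine key.trans ?_
    rw [div_le_iff₀ (by positivity)]
    have h2 : primeSum (indOne q) n ≤ 18 * (Real.log q / q) * LL n := by
      refine h1.trans ?_
      have : 9 * (Real.log q / q) * (LL n + 3) ≤ 9 * (Real.log q / q) * (2 * LL n) := by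
        gcongr; linarith
      linarith
    calc primeSum (indOne q) n ^ 2 ≤ (18 * (Real.log q / q) * LL n) ^ 2 := by gcongr
      _ = _ := by field_simp; ring
  · rcases Nat.eq_zero_or_pos (omegaQ m q) with h | h
    · simp [h]
    · have : (1 : ℝ) ≤ omegaQ m q := mod_cast h
      exact mul_nonneg (by linarith) (by linarith)
  · nlinarith

lemma lt_of_omegaQ_pos {q m : ℕ} (hq : 2 ≤ q) (h : 0 < omegaQ m q) : q < m := by
  obtain ⟨p, hp⟩ := Finset.card_pos.1 h
  obtain ⟨hp1, hp2⟩ := Finset.mem_filter.1 hp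
  obtain ⟨hpp, hpm, hm0⟩ := Nat.mem_primeFactors.1 hp1
  refine lt_of_lt_of_le ?_ (Nat.le_of_dvd (Nat.pos_of_ne_zero hm0) hpm)
  by_contra hle
  rw [Nat.mod_eq_of_lt (by omega : 1 < q)] at hp2
  rcases (not_lt.1 hle).lt_or_eq with h1 | h1
  · rw [Nat.mod_eq_of_lt h1] at hp2
    exact hpp.one_lt.ne' hp2
  · rw [h1, Nat.mod_self] at hp2
    omega

theorem exists_dens_omegaQ_ge_le {c ε : ℝ} (hc : 0 < c) (hε : 0 < ε) :
    ∃ Q : ℕ, ∀ᶠ n in atTop,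
      dens (fun m => ∃ q, q.Prime ∧ Q < q ∧ c * LL n ≤ omegaQ m q) n ≤ ε := by
  have hsum := summable_log_div_sq
  obtain ⟨s, hs⟩ := summable_iff_vanishing_norm.1 hsum (ε * c ^ 2 / 648) (by positivity)
  refine ⟨max 2 (s.sup id), ?_⟩
  filter_upwards [eventually_ge_atTop 3, tendsto_LL.eventually_ge_atTop (2 / c),
    tendsto_LL.eventually_ge_atTop 3] with n hn hn2 hn3
  rw [div_le_iff₀ hc, mul_comm] at hn2
  set T := (Finset.Icc 1 n).filter fun q => q.Prime ∧ max 2 (s.sup id) < q with hT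
  have hdisj : Disjoint T s := by
    rw [Finset.disjoint_left]
    intro q hq hqs
    have h1 := (Finset.mem_filter.1 hq).2.2
    have h2 : q ≤ s.sup id := Finset.le_sup (f := id) hqs
    have := le_max_right 2 (s.sup id)
    omega
  have h1 := hs T hdisj
  have h2 : dens (fun m => ∃ q, q.Prime ∧ max 2 (s.sup id) < q ∧ c * LL n ≤ omegaQ m q) n ≤
      dens (fun m => ∃ q ∈ T, c * LL n ≤ omegaQ m q) n := by
    refine dens_mono fun m _ hmn => ?_
    rintro ⟨q, hq, hqQ, hqc⟩
    refine ⟨q, Finset.mem_filter.2 ⟨Finset.mem_Icc.2 ⟨hq.one_le, ?_⟩, hq, hqQ⟩, hqc⟩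
    have : 0 < omegaQ m q := by
      have : (0 : ℝ) < omegaQ m q := by linarith
      exact_mod_cast this
    exact (lt_of_omegaQ_pos hq.two_le this).le.trans hmn
  refine (h2.trans (dens_exists_mem_le _ _ _)).trans ?_
  have h3 : ∀ q ∈ T, dens (fun m => c * LL n ≤ omegaQ m q) n ≤
      648 / c ^ 2 * (Real.log q / q) ^ 2 := by
    intro q hq
    obtain ⟨_, hqp, hqQ⟩ := Finset.mem_filter.1 hq
    have := le_max_left 2 (s.sup id)
    exact dens_omegaQ_ge_le hqp (by omega) hc hn hn2 hn3
  refine (Finset.sum_le_sum h3).trans ?_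
  rw [← Finset.mul_sum]
  have h4 := (le_abs_self _).trans h1.le
  calc _ ≤ 648 / c ^ 2 * (ε * c ^ 2 / 648) := by gcongr
    _ = ε := by field_simp

lemma abs_floor_div_sub_inv_le {n d : ℕ} (hn : 1 ≤ n) (hd : 1 ≤ d) {ε : ℝ} (hε0 : 0 ≤ ε)
    (hε1 : ε ≤ 1) :
    |((n / d : ℕ) : ℝ) / n - 1 / d| ≤ (n : ℝ) ^ (-ε) * (d : ℝ) ^ (ε - 1) := by
  have hn0 : (0 : ℝ) < n := mod_cast hn
  have hd0 : (0 : ℝ) < d := mod_cast hd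
  have h1 : ((n / d : ℕ) : ℝ) ≤ n / d := Nat.cast_div_le
  have h2 := Nat.lt_floor_add_one ((n : ℝ) / d)
  rw [Nat.floor_div_eq_div] at h2
  have h3 : ((n / d : ℕ) : ℝ) / n - 1 / d ≤ 0 := by
    rw [sub_nonpos, div_le_div_iff₀ hn0 hd0]
    rw [le_div_iff₀ hd0] at h1
    linarith
  rw [abs_of_nonpos h3, neg_sub]
  rcases le_or_gt d n with h | h
  · have h4 : 1 / (d : ℝ) - ((n / d : ℕ) : ℝ) / n ≤ 1 / n := by
      have : (1 : ℝ) / d = n / d / n := by field_simp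
      rw [this, ← sub_div]
      gcongr
      linarith
    refine h4.trans ?_
    have : (1 : ℝ) / n = (n : ℝ) ^ (-ε) * (n : ℝ) ^ (ε - 1) := by
      rw [← Real.rpow_add hn0, one_div, ← Real.rpow_neg_one]; congr 1; ring
    rw [this]
    have h5 : (d : ℝ) ≤ n := mod_cast h
    exact mul_le_mul_of_nonneg_left (Real.rpow_le_rpow_of_nonpos hd0 h5 (by linarith))
      (by positivity)
  · rw [Nat.div_eq_of_lt h]
    simp only [Nat.cast_zero, zero_div, sub_zero]
    have : (1 : ℝ) / d = (d : ℝ) ^ (-ε) * (d : ℝ) ^ (ε - 1) := by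
      rw [← Real.rpow_add hd0, one_div, ← Real.rpow_neg_one]; congr 1; ring
    rw [this]
    have h5 : (n : ℝ) ≤ d := mod_cast h.le
    exact mul_le_mul_of_nonneg_right (Real.rpow_le_rpow_of_nonpos hn0 h5 (by linarith))
      (by positivity)

/-- The mean value of a strongly multiplicative function supported on the primes in `S`. -/
lemma norm_mean_prod_sub_le {n : ℕ} (hn : 1 ≤ n) {S : Finset ℕ} (hS : ∀ p ∈ S, p.Prime)
    (z : ℕ → ℂ) {ε : ℝ} (hε0 : 0 ≤ ε) (hε1 : ε ≤ 1) :
    ‖(∑ m ∈ Finset.Icc 1 n, ∏ p ∈ S.filter (· ∣ m), (1 + z p)) / (n : ℂ) -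
        ∏ p ∈ S, (1 + z p / p)‖ ≤
      (n : ℝ) ^ (-ε) * ∏ p ∈ S, (1 + ‖z p‖ * (p : ℝ) ^ (ε - 1)) := by
  have hn0 : (n : ℂ) ≠ 0 := Nat.cast_ne_zero.2 (by omega)
  have hdvd : ∀ m, ∀ T ∈ S.powerset, T ⊆ S.filter (· ∣ m) ↔ ∏ p ∈ T, p ∣ m := by
    intro m T hT
    have hTS := Finset.mem_powerset.1 hT
    constructor
    · intro h
      exact Finset.prod_primes_dvd m (fun p hp => (hS p (hTS hp)).prime)
        fun p hp => (Finset.mem_filter.1 (h hp)).2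
    · intro h p hp
      exact Finset.mem_filter.2 ⟨hTS hp, (Finset.dvd_prod_of_mem _ hp).trans h⟩
  have h1 : ∀ m, ∏ p ∈ S.filter (· ∣ m), (1 + z p) =
      ∑ T ∈ S.powerset, if ∏ p ∈ T, p ∣ m then ∏ p ∈ T, z p else 0 := by
    intro m
    rw [Finset.prod_one_add, ← Finset.sum_filter]
    refine Finset.sum_congr ?_ fun _ _ => rfl
    ext T
    rw [Finset.mem_powerset, Finset.mem_filter]
    constructor
    · intro h
      have hT := Finset.mem_powerset.2 (h.trans (Finset.filter_subset _ _))
      exact ⟨hT, (hdvd m T hT).1 h⟩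
    · rintro ⟨hT, h⟩
      exact (hdvd m T hT).2 h
  have h2 : ∑ m ∈ Finset.Icc 1 n, ∏ p ∈ S.filter (· ∣ m), (1 + z p) =
      ∑ T ∈ S.powerset, ((n / ∏ p ∈ T, p : ℕ) : ℂ) * ∏ p ∈ T, z p := by
    simp_rw [h1]
    rw [Finset.sum_comm]
    refine Finset.sum_congr rfl fun T _ => ?_
    rw [← Finset.sum_filter, Finset.sum_const, card_filter_dvd, nsmul_eq_mul]
  have h3 : ∏ p ∈ S, (1 + z p / p) =
      ∑ T ∈ S.powerset, (1 / ((∏ p ∈ T, p : ℕ) : ℂ)) * ∏ p ∈ T, z p := by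
    rw [Finset.prod_one_add]
    refine Finset.sum_congr rfl fun T _ => ?_
    rw [Finset.prod_div_distrib]
    push_cast
    ring
  rw [h2, h3, Finset.sum_div, ← Finset.sum_sub_distrib, Finset.prod_one_add, Finset.mul_sum]
  refine (norm_sum_le _ _).trans (Finset.sum_le_sum fun T hT => ?_)
  set D := ∏ p ∈ T, p with hD
  have hD1 : 1 ≤ D := Finset.prod_pos fun p hp => (hS p (Finset.mem_powerset.1 hT hp)).pos
  have h4 : ((n / D : ℕ) : ℂ) * (∏ p ∈ T, z p) / (n : ℂ) - 1 / (D : ℂ) * ∏ p ∈ T, z p =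
      ((((n / D : ℕ) : ℝ) / n - 1 / D : ℝ) : ℂ) * ∏ p ∈ T, z p := by
    push_cast; ring
  rw [h4, norm_mul, Complex.norm_real, Finset.prod_mul_distrib, norm_prod, mul_comm (∏ p ∈ T, ‖z p‖),
    ← mul_assoc, Real.norm_eq_abs]
  have h5 : ∏ p ∈ T, (p : ℝ) ^ (ε - 1) = (D : ℝ) ^ (ε - 1) := by
    rw [hD, Nat.cast_prod, Real.finsetProd_rpow _ _ fun p _ => Nat.cast_nonneg p]
  rw [h5]
  gcongr
  exact abs_floor_div_sub_inv_le hn hD1 hε0 hε1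

lemma norm_prod_sub_prod_le_sum {ι : Type*} (S : Finset ι) (f g : ι → ℂ)
    (hf : ∀ i ∈ S, ‖f i‖ ≤ 1) (hg : ∀ i ∈ S, ‖g i‖ ≤ 1) :
    ‖∏ i ∈ S, f i - ∏ i ∈ S, g i‖ ≤ ∑ i ∈ S, ‖f i - g i‖ := by
  classical
  induction S using Finset.induction_on with
  | empty => simp
  | insert a S ha ih =>
    rw [Finset.prod_insert ha, Finset.prod_insert ha, Finset.sum_insert ha]
    have h1 := ih (fun i hi => hf i (Finset.mem_insert_of_mem hi))
      fun i hi => hg i (Finset.mem_insert_of_mem hi)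
    have h2 : ‖∏ i ∈ S, f i‖ ≤ 1 := by
      rw [norm_prod]
      exact Finset.prod_le_one (fun _ _ => norm_nonneg _)
        fun i hi => hf i (Finset.mem_insert_of_mem hi)
    have h3 := hg a (Finset.mem_insert_self a S)
    have h4 : f a * ∏ i ∈ S, f i - g a * ∏ i ∈ S, g i =
        (f a - g a) * ∏ i ∈ S, f i + g a * (∏ i ∈ S, f i - ∏ i ∈ S, g i) := by ring
    rw [h4]
    refine (norm_add_le _ _).trans ?_
    rw [norm_mul, norm_mul]
    have h5 := mul_le_of_le_one_right (norm_nonneg (f a - g a)) h2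
    have h6 := mul_le_of_le_one_left (norm_nonneg (∏ i ∈ S, f i - ∏ i ∈ S, g i)) h3
    linarith

lemma norm_prod_sub_exp_sum_le {S : Finset ℕ} (hS : ∀ p ∈ S, p.Prime) {s : ℕ → ℝ} {δ : ℝ}
    (hδ : δ ≤ 1) (hs : ∀ p ∈ S, |s p| ≤ δ) :
    ‖∏ p ∈ S, (1 + (Complex.exp (Complex.I * s p) - 1) / p) -
        Complex.exp (∑ p ∈ S, (Complex.exp (Complex.I * s p) - 1) / p)‖ ≤
      δ ^ 2 * ∑' k : ℕ, 1 / (k : ℝ) ^ 2 := by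
  have hz : ∀ p ∈ S, ‖Complex.exp (Complex.I * s p) - 1‖ ≤ δ := fun p hp =>
    Real.norm_exp_I_mul_ofReal_sub_one_le.trans (hs p hp)
  have he : ∀ x : ℝ, ‖Complex.exp (Complex.I * x)‖ = 1 := fun x => by
    rw [mul_comm]; exact Complex.norm_exp_ofReal_mul_I x
  have hp0 : ∀ p ∈ S, (1 : ℝ) ≤ p := fun p hp => mod_cast (hS p hp).one_le
  rw [Complex.exp_sum]
  refine (norm_prod_sub_prod_le_sum S _ _ (fun p hp => ?_) fun p hp => ?_).trans ?_
  · have h1 := hp0 p hp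
    have hpc : (p : ℂ) ≠ 0 := Nat.cast_ne_zero.2 (hS p hp).ne_zero
    have h2 : (1 : ℂ) + (Complex.exp (Complex.I * s p) - 1) / p =
        ((1 - 1 / p : ℝ) : ℂ) + ((1 / p : ℝ) : ℂ) * Complex.exp (Complex.I * s p) := by
      push_cast; field_simp; ring
    rw [h2]
    refine (norm_add_le _ _).trans ?_
    rw [norm_mul, he, Complex.norm_real, Complex.norm_real,
      Real.norm_of_nonneg (sub_nonneg.2 ((div_le_one (by linarith)).2 h1)),
      Real.norm_of_nonneg (by positivity)]
    linarith
  · rw [Complex.norm_exp, Real.exp_le_one_iff]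
    have h2 : (Complex.exp (Complex.I * s p)).re ≤ 1 := (Complex.re_le_norm _).trans (he _).le
    rw [← Complex.ofReal_natCast, Complex.div_ofReal_re, Complex.sub_re, Complex.one_re]
    exact div_nonpos_of_nonpos_of_nonneg (by linarith) (Nat.cast_nonneg _)
  · have hsum : Summable fun k : ℕ => 1 / (k : ℝ) ^ 2 :=
      Real.summable_one_div_nat_pow.2 one_lt_two
    refine le_trans ?_ (mul_le_mul_of_nonneg_left
      (hsum.sum_le_tsum S fun _ _ => by positivity) (sq_nonneg δ))
    rw [Finset.mul_sum]
    refine Finset.sum_le_sum fun p hp => ?_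
    have h1 := hp0 p hp
    have h3 : ‖(Complex.exp (Complex.I * s p) - 1) / (p : ℂ)‖ ≤ δ / p := by
      rw [norm_div, Complex.norm_natCast]
      gcongr
      exact hz p hp
    have hδ0 : 0 ≤ δ := (abs_nonneg _).trans (hs p hp)
    have h4 : δ / p ≤ 1 := (div_le_one (by linarith)).2 (hδ.trans h1)
    have h5 := Complex.norm_exp_sub_one_sub_id_le (h3.trans h4)
    rw [norm_sub_rev, show δ ^ 2 * (1 / (p : ℝ) ^ 2) = (δ / p) ^ 2 by rw [div_pow]; ring]
    rw [← sub_sub]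
    exact h5.trans (by gcongr)

lemma norm_sum_exp_sub_one_div_sub_le {S : Finset ℕ} {s : ℕ → ℝ} {δ : ℝ}
    (hδ : δ ≤ 1) (hs : ∀ p ∈ S, |s p| ≤ δ) :
    ‖∑ p ∈ S, (Complex.exp (Complex.I * s p) - 1) / p -
        (Complex.I * (∑ p ∈ S, s p / p : ℝ) - (∑ p ∈ S, s p ^ 2 / p : ℝ) / 2)‖ ≤
      δ ^ 3 * ∑ p ∈ S, 1 / (p : ℝ) := by
  have h1 : ∑ p ∈ S, (Complex.exp (Complex.I * s p) - 1) / p -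
        (Complex.I * (∑ p ∈ S, s p / p : ℝ) - (∑ p ∈ S, s p ^ 2 / p : ℝ) / 2) =
      ∑ p ∈ S, (Complex.exp (Complex.I * s p) - 1 - Complex.I * s p + (s p : ℂ) ^ 2 / 2) / p := by
    push_cast
    rw [Finset.mul_sum, Finset.sum_div, ← Finset.sum_sub_distrib, ← Finset.sum_sub_distrib]
    refine Finset.sum_congr rfl fun p _ => ?_
    ring
  rw [h1, Finset.mul_sum]
  refine (norm_sum_le _ _).trans (Finset.sum_le_sum fun p hp => ?_)
  rw [norm_div, Complex.norm_natCast, mul_one_div]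
  gcongr
  have h2 : ‖Complex.I * (s p : ℂ)‖ = |s p| := by simp
  have h3 := Complex.exp_bound (x := Complex.I * s p) (by rw [h2]; exact (hs p hp).trans hδ)
    (show 0 < 3 by norm_num)
  rw [h2] at h3
  have h4 : Complex.exp (Complex.I * s p) - 1 - Complex.I * s p + (s p : ℂ) ^ 2 / 2 =
      Complex.exp (Complex.I * s p) - ∑ m ∈ Finset.range 3, (Complex.I * (s p : ℂ)) ^ m / m.factorial := by
    simp only [Finset.sum_range_succ, Finset.sum_range_zero]
    simp [mul_pow, Nat.factorial]
    ring
  rw [h4]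
  refine h3.trans ?_
  have h5 : |s p| ^ 3 ≤ δ ^ 3 := by gcongr; exact hs p hp
  have h6 : 0 ≤ |s p| ^ 3 := by positivity
  norm_num [Nat.factorial]
  linarith

lemma primeFactors_eq_filter {n m : ℕ} (hm : m ∈ Finset.Icc 1 n) :
    m.primeFactors = ((Finset.Icc 1 n).filter Nat.Prime).filter (· ∣ m) := by
  rw [Finset.mem_Icc] at hm
  ext p
  simp only [Finset.mem_filter, Nat.mem_primeFactors, Finset.mem_Icc]
  constructor
  · rintro ⟨hp, hd, _⟩
    exact ⟨⟨⟨hp.one_le, (Nat.le_of_dvd hm.1 hd).trans hm.2⟩, hp⟩, hd⟩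
  · rintro ⟨⟨_, hp⟩, hd⟩
    exact ⟨hp, hd, by omega⟩

lemma filter_prime_subset {N n : ℕ} (h : N ≤ n) :
    (Finset.Icc 1 N).filter Nat.Prime ⊆ (Finset.Icc 1 n).filter Nat.Prime :=
  Finset.filter_subset_filter _ (Finset.Icc_subset_Icc_right h)

lemma primeSum_sub_eq {N n : ℕ} (h : N ≤ n) (w : ℕ → ℝ) :
    primeSum w n - primeSum w N = ∑ p ∈ (Finset.Icc 1 n).filter Nat.Prime \
      (Finset.Icc 1 N).filter Nat.Prime, w p / p := by
  rw [primeSum, primeSum, ← Finset.sum_sdiff (filter_prime_subset h)]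
  ring

lemma abs_primeSum_sub_le {N n : ℕ} (h : N ≤ n) {w : ℕ → ℝ} {W : ℝ} (hw : ∀ p, |w p| ≤ W) :
    |primeSum w n - primeSum w N| ≤
      W * (primeSum (fun _ => 1) n - primeSum (fun _ => 1) N) := by
  rw [primeSum_sub_eq h, primeSum_sub_eq h, Finset.mul_sum]
  refine (Finset.abs_sum_le_sum_abs _ _).trans (Finset.sum_le_sum fun p _ => ?_)
  rw [abs_div, Nat.abs_cast, mul_one_div]
  gcongr
  exact hw p

lemma norm_exp_I_mul_sub_le (u v : ℝ) :
    ‖Complex.exp (Complex.I * u) - Complex.exp (Complex.I * v)‖ ≤ |u - v| := by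
  have h : Complex.exp (Complex.I * u) - Complex.exp (Complex.I * v) =
      Complex.exp (Complex.I * v) * (Complex.exp (Complex.I * (u - v : ℝ)) - 1) := by
    rw [mul_sub, ← Complex.exp_add, mul_one]
    push_cast
    congr 2
    ring
  rw [h, norm_mul, mul_comm Complex.I, Complex.norm_exp_ofReal_mul_I, one_mul]
  exact Real.norm_exp_I_mul_ofReal_sub_one_le

lemma norm_mean_exp_sub_le {n N : ℕ} (hn : 1 ≤ n) (hNn : N ≤ n) {s : ℕ → ℝ} {δ : ℝ} (hδ : δ ≤ 1)
    (hs : ∀ p, |s p| ≤ δ) (c : ℝ) {ε : ℝ} (hε0 : 0 ≤ ε) (hε1 : ε ≤ 1)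
    (hN : ε * Real.log N ≤ 1) :
    ‖(∑ m ∈ Finset.Icc 1 n, Complex.exp (Complex.I * (∑ p ∈ m.primeFactors, s p - c : ℝ))) / (n : ℂ) -
        Complex.exp (∑ p ∈ (Finset.Icc 1 N).filter Nat.Prime,
          (Complex.exp (Complex.I * s p) - 1) / p - Complex.I * c)‖ ≤
      δ * (primeSum (fun _ => 1) n - primeSum (fun _ => 1) N) +
        ((n : ℝ) ^ (-ε) * Real.exp (Real.exp 1 * δ * primeSum (fun _ => 1) n) +
        δ ^ 2 * ∑' k : ℕ, 1 / (k : ℝ) ^ 2) := by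
  have hn0 : (0 : ℝ) < n := mod_cast hn
  have hδ0 : 0 ≤ δ := (abs_nonneg _).trans (hs 0)
  set P := (Finset.Icc 1 n).filter Nat.Prime with hP
  set S := (Finset.Icc 1 N).filter Nat.Prime with hSdef
  have hS : ∀ p ∈ S, p.Prime := fun p hp => (Finset.mem_filter.1 hp).2
  have hSP : S ⊆ P := filter_prime_subset hNn
  have htrunc : ‖(∑ m ∈ Finset.Icc 1 n,
        Complex.exp (Complex.I * (∑ p ∈ m.primeFactors, s p - c : ℝ))) / (n : ℂ) -
      (∑ m ∈ Finset.Icc 1 n,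
        Complex.exp (Complex.I * (∑ p ∈ S.filter (· ∣ m), s p - c : ℝ))) / (n : ℂ)‖ ≤
      δ * (primeSum (fun _ => 1) n - primeSum (fun _ => 1) N) := by
    rw [← sub_div, ← Finset.sum_sub_distrib, norm_div, Complex.norm_natCast, div_le_iff₀ hn0]
    have h1 : ∀ m ∈ Finset.Icc 1 n,
        ‖Complex.exp (Complex.I * (∑ p ∈ m.primeFactors, s p - c : ℝ)) -
          Complex.exp (Complex.I * (∑ p ∈ S.filter (· ∣ m), s p - c : ℝ))‖ ≤
        ∑ p ∈ P \ S, if p ∣ m then δ else 0 := by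
      intro m hm
      refine (norm_exp_I_mul_sub_le _ _).trans ?_
      rw [primeFactors_eq_filter hm, ← hP, Finset.sum_filter (s := P), Finset.sum_filter (s := S),
        ← Finset.sum_sdiff hSP]
      rw [sub_sub_sub_cancel_right, add_sub_cancel_right]
      refine (Finset.abs_sum_le_sum_abs _ _).trans (Finset.sum_le_sum fun p _ => ?_)
      split_ifs
      · exact hs p
      · simp
    refine (norm_sum_le _ _).trans ((Finset.sum_le_sum h1).trans ?_)
    rw [Finset.sum_comm, primeSum_sub_eq hNn, Finset.mul_sum, Finset.sum_mul]
    refine Finset.sum_le_sum fun p _ => ?_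
    rw [← Finset.sum_filter, Finset.sum_const, card_filter_dvd, nsmul_eq_mul]
    have : ((n / p : ℕ) : ℝ) ≤ n / p := Nat.cast_div_le
    calc ((n / p : ℕ) : ℝ) * δ ≤ n / p * δ := by gcongr
      _ = _ := by ring
  have hprod : ∀ m, Complex.exp (Complex.I * (∑ p ∈ S.filter (· ∣ m), s p - c : ℝ)) =
      Complex.exp (-(Complex.I * c)) *
        ∏ p ∈ S.filter (· ∣ m), (1 + (Complex.exp (Complex.I * s p) - 1)) := by
    intro m
    simp only [add_sub_cancel]
    rw [← Complex.exp_sum, ← Complex.exp_add, ← Finset.mul_sum]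
    push_cast
    congr 1
    ring
  have hmain : ‖(∑ m ∈ Finset.Icc 1 n,
        Complex.exp (Complex.I * (∑ p ∈ S.filter (· ∣ m), s p - c : ℝ))) / (n : ℂ) -
      Complex.exp (-(Complex.I * c)) * ∏ p ∈ S, (1 + (Complex.exp (Complex.I * s p) - 1) / p)‖ ≤
      (n : ℝ) ^ (-ε) * Real.exp (Real.exp 1 * δ * primeSum (fun _ => 1) n) := by
    simp_rw [hprod]
    rw [← Finset.mul_sum, mul_div_assoc, ← mul_sub, norm_mul]
    have he : ‖Complex.exp (-(Complex.I * c))‖ = 1 := by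
      rw [← mul_neg, ← Complex.ofReal_neg, mul_comm]; exact Complex.norm_exp_ofReal_mul_I _
    rw [he, one_mul]
    refine (norm_mean_prod_sub_le hn hS _ hε0 hε1).trans ?_
    gcongr
    refine (Real.prod_one_add_le_exp_sum S fun p => by positivity).trans ?_
    rw [Real.exp_le_exp, primeSum, Finset.mul_sum]
    refine le_trans (Finset.sum_le_sum fun p hp => ?_)
      (Finset.sum_le_sum_of_subset_of_nonneg hSP fun p _ _ => by positivity)
    have hp0 : (0 : ℝ) < p := mod_cast (hS p hp).pos
    have hpN : p ≤ N := (Finset.mem_Icc.1 (Finset.mem_filter.1 hp).1).2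
    have h2 : (p : ℝ) ^ (ε - 1) ≤ Real.exp 1 / p := by
      rw [Real.rpow_sub_one hp0.ne']
      gcongr
      rw [Real.rpow_def_of_pos hp0, Real.exp_le_exp]
      refine le_trans ?_ hN
      rw [mul_comm]
      have hpN' : (p : ℝ) ≤ N := mod_cast hpN
      gcongr
    have h3 : ‖Complex.exp (Complex.I * s p) - 1‖ ≤ δ :=
      Real.norm_exp_I_mul_ofReal_sub_one_le.trans (hs p)
    calc _ ≤ δ * (Real.exp 1 / p) := by gcongr
      _ = _ := by ring
  have hexp := norm_prod_sub_exp_sum_le hS hδ (fun p _ => hs p)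
  have hexp' : ‖Complex.exp (-(Complex.I * c)) *
        ∏ p ∈ S, (1 + (Complex.exp (Complex.I * s p) - 1) / p) -
      Complex.exp (∑ p ∈ S, (Complex.exp (Complex.I * s p) - 1) / p - Complex.I * c)‖ ≤
      δ ^ 2 * ∑' k : ℕ, 1 / (k : ℝ) ^ 2 := by
    rw [sub_eq_add_neg (∑ p ∈ S, _), add_comm, Complex.exp_add, ← mul_sub, norm_mul,
      ← mul_neg, ← Complex.ofReal_neg, mul_comm Complex.I, Complex.norm_exp_ofReal_mul_I, one_mul]
    exact hexp
  refine (norm_sub_le_norm_sub_add_norm_sub _ _ _).trans (add_le_add htrunc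
    ((norm_sub_le_norm_sub_add_norm_sub _ _ _).trans (add_le_add hmain hexp')))

/-- A truncation level that is `n ^ o(1)`, but whose iterated logarithm is close to that of `n`. -/
def truncLevel (n : ℕ) : ℕ := ⌊Real.exp (Real.log n / LL n)⌋₊

lemma tendsto_log_natCast : Tendsto (fun n : ℕ => Real.log n) atTop atTop :=
  Real.tendsto_log_atTop.comp tendsto_natCast_atTop_atTop

lemma eventually_truncLevel : ∀ᶠ n : ℕ in atTop, 3 ≤ truncLevel n ∧ truncLevel n ≤ n ∧
    LL n - Real.log (LL n) - Real.log 2 ≤ LL (truncLevel n) ∧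
    LL n / Real.log n * Real.log (truncLevel n) ≤ 1 ∧ LL n ≤ Real.log n := by
  have h1 : Tendsto (fun n : ℕ => Real.log n / LL n) atTop atTop := by
    have h2 : Tendsto (fun x : ℝ => x / Real.log x) atTop atTop := by
      have h3 : Tendsto (fun x : ℝ => Real.log x / x) atTop (nhdsWithin 0 (Set.Ioi 0)) := by
        refine tendsto_nhdsWithin_iff.2 ⟨Real.isLittleO_log_id_atTop.tendsto_div_nhds_zero, ?_⟩
        filter_upwards [eventually_gt_atTop 1] with x hx
        exact div_pos (Real.log_pos hx) (by linarith)
      refine h3.inv_tendsto_nhdsGT_zero.congr fun x => ?_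
      simp
    exact h2.comp tendsto_log_natCast
  filter_upwards [h1.eventually_ge_atTop 4, tendsto_LL.eventually_ge_atTop 1,
    tendsto_log_natCast.eventually_ge_atTop 1, eventually_ge_atTop 1] with n hn hL hlog hn1
  have hn0 : (0 : ℝ) < n := mod_cast hn1
  set t := Real.log n / LL n with ht
  have hy : 5 ≤ Real.exp t := by have := Real.add_one_le_exp t; linarith
  have hN1 : Real.exp t < truncLevel n + 1 := Nat.lt_floor_add_one _
  have hN2 : (truncLevel n : ℝ) ≤ Real.exp t := Nat.floor_le (Real.exp_nonneg _)
  have hN3 : 3 ≤ truncLevel n := Nat.le_floor (by push_cast; linarith)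
  have hN0 : (0 : ℝ) < truncLevel n := by
    have : (3 : ℝ) ≤ truncLevel n := mod_cast hN3
    linarith
  have hl2 : Real.log 2 ≤ 1 := by have := Real.log_two_lt_d9; linarith
  have hlogN : Real.log (truncLevel n) ≤ t := by
    have := Real.log_le_log hN0 hN2
    rwa [Real.log_exp] at this
  have hlogN' : t / 2 ≤ Real.log (truncLevel n) := by
    have h4 : Real.exp t / 2 ≤ truncLevel n := by linarith
    have := Real.log_le_log (by positivity) h4
    rw [Real.log_div (Real.exp_ne_zero _) two_ne_zero, Real.log_exp] at this
    linarith
  refine ⟨hN3, ?_, ?_, ?_, ?_⟩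
  · have h5 : Real.exp t ≤ n := by
      rw [← Real.exp_log hn0, Real.exp_le_exp, ht]
      exact div_le_self (by linarith) hL
    exact_mod_cast hN2.trans h5
  · have := Real.log_le_log (by linarith) hlogN'
    rw [Real.log_div (by linarith) two_ne_zero, ht, Real.log_div (by linarith) (by linarith)] at this
    exact this
  · rw [div_mul_eq_mul_div, div_le_one (by linarith)]
    calc LL n * Real.log (truncLevel n) ≤ LL n * t := by gcongr
      _ = Real.log n := by rw [ht]; field_simp
  · have := Real.log_le_sub_one_of_pos (show 0 < Real.log n by linarith)
    rw [LL]; linarith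

lemma exists_abs_primeSum_one_sub_le :
    ∃ C : ℝ, 0 ≤ C ∧ ∀ n, 3 ≤ n → |primeSum (fun _ => 1) n - LL n| ≤ C := by
  obtain ⟨C, hC⟩ := exists_abs_primeSum_indOne_sub_le 1
  refine ⟨C, (abs_nonneg _).trans (hC 3 le_rfl), fun n hn => ?_⟩
  have h := hC n hn
  have h1 : indOne 1 = fun _ => 1 := by
    funext p; simp [indOne, Nat.mod_one]
  rwa [h1, Nat.totient_one, Nat.cast_one, div_one] at h

lemma tendsto_log_div_sqrt : Tendsto (fun x : ℝ => Real.log x / √x) atTop (nhds 0) := by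
  have := (isLittleO_log_rpow_atTop (show (0 : ℝ) < 1 / 2 by norm_num)).tendsto_div_nhds_zero
  simpa [Real.sqrt_eq_rpow] using this

lemma tendsto_inv_sqrt : Tendsto (fun x : ℝ => 1 / √x) atTop (nhds 0) := by
  simp_rw [one_div]
  exact Real.tendsto_sqrt_atTop.inv_tendsto_atTop

lemma tendsto_charFun_error {W C D K : ℝ} :
    Tendsto (fun x : ℝ => W / √x * (Real.log x + D) +
      (Real.exp (-x) * Real.exp (Real.exp 1 * (W / √x) * (x + C)) + (W / √x) ^ 2 * K))
      atTop (nhds 0) := by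
  have hi := tendsto_inv_sqrt
  have h1 : Tendsto (fun x : ℝ => W / √x * (Real.log x + D)) atTop (nhds 0) := by
    have := (tendsto_log_div_sqrt.const_mul W).add (hi.const_mul (W * D))
    simp only [mul_zero, add_zero] at this
    refine this.congr fun x => ?_
    ring
  have h3 : Tendsto (fun x : ℝ => (W / √x) ^ 2 * K) atTop (nhds 0) := by
    have := (hi.mul hi).const_mul (W ^ 2 * K)
    simp only [mul_zero] at this
    refine this.congr fun x => ?_
    ring
  have h2 : Tendsto (fun x : ℝ => Real.exp (-x) * Real.exp (Real.exp 1 * (W / √x) * (x + C)))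
      atTop (nhds 0) := by
    have hlim : Tendsto (fun x : ℝ => Real.exp (-√x)) atTop (nhds 0) :=
      Real.tendsto_exp_neg_atTop_nhds_zero.comp Real.tendsto_sqrt_atTop
    refine tendsto_of_tendsto_of_tendsto_of_le_of_le' tendsto_const_nhds hlim
      (Eventually.of_forall fun _ => by positivity) ?_
    set e := Real.exp 1
    filter_upwards [Real.tendsto_sqrt_atTop.eventually_ge_atTop (1 + |e * W| + |e * W * C|),
      eventually_ge_atTop 1] with x hx hx1
    rw [← Real.exp_add, Real.exp_le_exp]
    set r := √x with hr
    have hr1 : 1 ≤ r := by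
      have := abs_nonneg (e * W); have := abs_nonneg (e * W * C); linarith
    have hxr : x = r ^ 2 := (Real.sq_sqrt (by linarith)).symm
    have h4 : e * (W / r) * (x + C) = e * W * r + e * W * C / r := by
      rw [hxr]; field_simp
    have h5 : e * W * C / r ≤ |e * W * C| := by
      refine (div_le_div_of_nonneg_right (le_abs_self _) (by linarith)).trans ?_
      exact div_le_self (abs_nonneg _) hr1
    have h6 : e * W * r ≤ |e * W| * r := by gcongr; exact le_abs_self _
    rw [h4, hxr]
    have h7 := abs_nonneg (e * W * C)
    nlinarith
  have := h1.add (h2.add h3)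
  simpa using this

lemma tendsto_exponent_error {W C D A B : ℝ} :
    Tendsto (fun x : ℝ => (W / √x) ^ 3 * (x + C) + ((W * (Real.log x + D) + A) / √x +
      (W ^ 2 * (Real.log x + D) + B) / (2 * x))) atTop (nhds 0) := by
  have hi := tendsto_inv_sqrt
  have hl := tendsto_log_div_sqrt
  have h1 := (((hi.const_mul (W ^ 3)).add (((hi.mul hi).mul hi).const_mul (W ^ 3 * C))).add
    ((hl.const_mul W).add (hi.const_mul (W * D + A)))).add
    (((hl.mul hi).const_mul (W ^ 2 / 2)).add ((hi.mul hi).const_mul ((W ^ 2 * D + B) / 2)))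
  simp only [mul_zero, add_zero] at h1
  refine h1.congr' ?_
  filter_upwards [eventually_gt_atTop 0] with x hx
  have hr : 0 < √x := Real.sqrt_pos.2 hx
  have hxr : x = √x ^ 2 := (Real.sq_sqrt hx.le).symm
  generalize Real.log x = l
  set r := √x
  rw [hxr]
  field_simp
  ring

/-- The characteristic function of a strongly additive function with bounded values on primes
converges, after normalisation, to that of a centred Gaussian. -/
theorem tendsto_mean_exp {w : ℕ → ℝ} {W a b A B : ℝ} (hw : ∀ p, |w p| ≤ W)
    (ha : ∀ n, 3 ≤ n → |primeSum w n - a * LL n| ≤ A)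
    (hb : ∀ n, 3 ≤ n → |primeSum (fun p => w p ^ 2) n - b * LL n| ≤ B) :
    Tendsto (fun n : ℕ => (∑ m ∈ Finset.Icc 1 n,
      Complex.exp (Complex.I * ((∑ p ∈ m.primeFactors, w p - a * LL n) / √(LL n) : ℝ))) / (n : ℂ))
      atTop (nhds (Complex.exp (-(b : ℂ) / 2))) := by
  obtain ⟨C, hC0, hC⟩ := exists_abs_primeSum_one_sub_le
  have hW0 : 0 ≤ W := (abs_nonneg _).trans (hw 0)
  set K := ∑' k : ℕ, 1 / (k : ℝ) ^ 2
  set D := Real.log 2 + 2 * C with hD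
  set E : ℕ → ℂ := fun n => ∑ p ∈ (Finset.Icc 1 (truncLevel n)).filter Nat.Prime,
    (Complex.exp (Complex.I * (w p / √(LL n) : ℝ)) - 1) / p -
      Complex.I * (a * LL n / √(LL n) : ℝ) with hE
  have hev : ∀ᶠ n : ℕ in atTop, W / √(LL n) ≤ 1 := by
    have h1 : Tendsto (fun n => W * (1 / √(LL n))) atTop (nhds (W * 0)) :=
      (tendsto_inv_sqrt.comp tendsto_LL).const_mul W
    rw [mul_zero] at h1
    filter_upwards [h1.eventually_le_const zero_lt_one] with n hn
    rwa [mul_one_div] at hn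
  have hR : ∀ᶠ n : ℕ in atTop, primeSum (fun _ => 1) n - primeSum (fun _ => 1) (truncLevel n) ≤
      Real.log (LL n) + D := by
    filter_upwards [eventually_truncLevel, eventually_ge_atTop 3] with n hn hn3
    have h1 := abs_le.1 (hC n hn3)
    have h2 := abs_le.1 (hC _ hn.1)
    have := hn.2.2.1
    rw [hD]; linarith [h1.2, h2.1]
  have hEq : Tendsto (fun n => E n) atTop (nhds (-(b : ℂ) / 2)) := by
    rw [tendsto_iff_norm_sub_tendsto_zero]
    refine tendsto_of_tendsto_of_tendsto_of_le_of_le' tendsto_const_nhds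
      ((tendsto_exponent_error (W := W) (C := C) (D := D) (A := A) (B := B)).comp tendsto_LL)
      (Eventually.of_forall fun _ => norm_nonneg _) ?_
    filter_upwards [eventually_truncLevel, eventually_ge_atTop 3, hev, hR,
      tendsto_LL.eventually_gt_atTop 0] with n hn hn3 hδ hRn hL
    have hr : 0 < √(LL n) := Real.sqrt_pos.2 hL
    have hr2 : √(LL n) ^ 2 = LL n := Real.sq_sqrt hL.le
    set N := truncLevel n
    set S := (Finset.Icc 1 N).filter Nat.Prime with hS
    have hs : ∀ p ∈ S, |w p / √(LL n)| ≤ W / √(LL n) := fun p _ => by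
      rw [abs_div, abs_of_pos hr]; gcongr; exact hw p
    have h1 := norm_sum_exp_sub_one_div_sub_le hδ hs
    have hH : ∑ p ∈ S, 1 / (p : ℝ) ≤ LL n + C := by
      have h2 : ∑ p ∈ S, 1 / (p : ℝ) ≤ primeSum (fun _ => 1) n :=
        Finset.sum_le_sum_of_subset_of_nonneg (filter_prime_subset hn.2.1)
          fun p _ _ => by positivity
      have := (abs_le.1 (hC n hn3)).2
      linarith
    have hs1 : ∑ p ∈ S, w p / √(LL n) / p = primeSum w N / √(LL n) := by
      rw [primeSum, Finset.sum_div]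
      exact Finset.sum_congr rfl fun p _ => by ring
    have hs2 : ∑ p ∈ S, (w p / √(LL n)) ^ 2 / p = primeSum (fun p => w p ^ 2) N / LL n := by
      rw [primeSum, Finset.sum_div]
      refine Finset.sum_congr rfl fun p _ => ?_
      rw [div_pow, hr2]; ring
    rw [hs1, hs2] at h1
    have h3 : |primeSum w N - a * LL n| ≤ W * (Real.log (LL n) + D) + A := by
      have h4 := abs_primeSum_sub_le hn.2.1 hw
      have h5 := ha n hn3
      have h6 := abs_sub_le (primeSum w N) (primeSum w n) (a * LL n)
      rw [abs_sub_comm] at h4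
      have := mul_le_mul_of_nonneg_left hRn hW0
      linarith
    have h3' : |primeSum (fun p => w p ^ 2) N - b * LL n| ≤
        W ^ 2 * (Real.log (LL n) + D) + B := by
      have h4 := abs_primeSum_sub_le hn.2.1 (w := fun p => w p ^ 2) (W := W ^ 2) fun p => by
        rw [abs_pow]; gcongr; exact hw p
      have h5 := hb n hn3
      have h6 := abs_sub_le (primeSum (fun p => w p ^ 2) N) (primeSum (fun p => w p ^ 2) n)
        (b * LL n)
      rw [abs_sub_comm] at h4
      have := mul_le_mul_of_nonneg_left hRn (sq_nonneg W)
      linarith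
    have h7 : E n - -(b : ℂ) / 2 =
        (∑ p ∈ S, (Complex.exp (Complex.I * (w p / √(LL n) : ℝ)) - 1) / p -
        (Complex.I * (primeSum w N / √(LL n) : ℝ) -
          (primeSum (fun p => w p ^ 2) N / LL n : ℝ) / 2)) +
        (Complex.I * ((primeSum w N - a * LL n) / √(LL n) : ℝ) -
          ((primeSum (fun p => w p ^ 2) N - b * LL n) / (2 * LL n) : ℝ)) := by
      have h8 : (b : ℂ) = b * LL n / LL n := by
        rw [mul_div_assoc, div_self (by exact_mod_cast hL.ne'), mul_one]
      simp only [hE]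
      rw [h8]
      push_cast
      ring
    rw [h7]
    refine (norm_add_le _ _).trans (add_le_add (h1.trans (by gcongr)) ?_)
    refine (norm_sub_le _ _).trans (add_le_add ?_ ?_)
    · rw [norm_mul, Complex.norm_I, one_mul, Complex.norm_real, Real.norm_eq_abs, abs_div,
        abs_of_pos hr]
      gcongr
    · rw [Complex.norm_real, Real.norm_eq_abs, abs_div, abs_of_pos (by positivity : 0 < 2 * LL n)]
      gcongr
  have hexpE : Tendsto (fun n => Complex.exp (E n)) atTop (nhds (Complex.exp (-(b : ℂ) / 2))) :=
    hEq.cexp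
  refine (tendsto_iff_of_dist ?_).2 hexpE
  refine tendsto_of_tendsto_of_tendsto_of_le_of_le' tendsto_const_nhds
    ((tendsto_charFun_error (W := W) (C := C) (D := D) (K := K)).comp tendsto_LL)
    (Eventually.of_forall fun _ => dist_nonneg) ?_
  filter_upwards [eventually_truncLevel, eventually_ge_atTop 3, hev, hR,
    tendsto_LL.eventually_gt_atTop 0] with n hn hn3 hδ hRn hL
  have hr : 0 < √(LL n) := Real.sqrt_pos.2 hL
  have hlog : 0 < Real.log n := by have := one_lt_log_natCast hn3; linarith
  have hn0 : (0 : ℝ) < n := by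
    have : (3 : ℝ) ≤ n := mod_cast hn3
    linarith
  have hs : ∀ p, |w p / √(LL n)| ≤ W / √(LL n) := fun p => by
    rw [abs_div, abs_of_pos hr]; gcongr; exact hw p
  have key := norm_mean_exp_sub_le (by omega : 1 ≤ n) hn.2.1 hδ hs (a * LL n / √(LL n))
    (ε := LL n / Real.log n) (by positivity) ((div_le_one hlog).2 hn.2.2.2.2) hn.2.2.2.1
  have hrw : ∀ m : ℕ, (∑ p ∈ m.primeFactors, w p - a * LL n) / √(LL n) =
      ∑ p ∈ m.primeFactors, w p / √(LL n) - a * LL n / √(LL n) := fun m => by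
    rw [sub_div, Finset.sum_div]
  rw [dist_eq_norm]
  simp_rw [hrw]
  refine key.trans ?_
  have hpow : (n : ℝ) ^ (-(LL n / Real.log n)) = Real.exp (-LL n) := by
    rw [Real.rpow_def_of_pos hn0]
    congr 1
    field_simp
  rw [hpow]
  have hδ0 : 0 ≤ W / √(LL n) := by positivity
  have hHn := (abs_le.1 (hC n hn3)).2
  simp only [Function.comp_apply]
  gcongr
  linarith

/-- The uniform distribution on the values `V m`, `1 ≤ m ≤ n`. -/
def empirical {E : Type*} [MeasurableSpace E] (V : ℕ → E) (n : ℕ) : Measure E :=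
  (n : ENNReal)⁻¹ • ∑ m ∈ Finset.Icc 1 n, Measure.dirac (V m)

lemma isProbabilityMeasure_empirical {E : Type*} [MeasurableSpace E] (V : ℕ → E) {n : ℕ} (hn : n ≠ 0) :
    IsProbabilityMeasure (empirical V n) := by
  refine ⟨?_⟩
  simp [empirical, Measure.finsetSum_apply]
  exact ENNReal.inv_mul_cancel (by exact_mod_cast hn) (by simp)

lemma empirical_real {E : Type*} [MeasurableSpace E] (V : ℕ → E) (n : ℕ)
    {s : Set E} (hs : MeasurableSet s) :
    (empirical V n).real s = dens (fun m => V m ∈ s) n := by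
  classical
  rw [dens, cnt_eq_card, Measure.real, empirical]
  simp only [Measure.smul_apply, Measure.finsetSum_apply, Measure.dirac_apply' _ hs,
    smul_eq_mul, ENNReal.toReal_mul, ENNReal.toReal_inv, ENNReal.toReal_natCast]
  rw [Finset.card_filter, ENNReal.toReal_sum (by intro a _; simp [Set.indicator_apply]; split_ifs <;> simp)]
  push_cast
  rw [div_eq_inv_mul]
  congr 1
  refine Finset.sum_congr rfl fun m _ => ?_
  by_cases h : V m ∈ s <;> simp [h]

lemma charFun_empirical {E : Type*} [NormedAddCommGroup E] [InnerProductSpace ℝ E]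
    [MeasurableSpace E] [BorelSpace E] (V : ℕ → E) (n : ℕ) (t : E) :
    charFun (empirical V n) t =
      (∑ m ∈ Finset.Icc 1 n, Complex.exp (Complex.I * (inner ℝ (V m) t : ℝ))) / (n : ℂ) := by
  rw [charFun_apply, empirical, integral_smul_measure, integral_finsetSum_measure]
  · simp [integral_dirac, ENNReal.toReal_inv, div_eq_inv_mul, mul_comm]
  · intro m _
    exact integrable_dirac (by simp)

theorem tendsto_dens_of_tendsto_charFun {E : Type*} [NormedAddCommGroup E] [InnerProductSpace ℝ E]
    [MeasurableSpace E] [FiniteDimensional ℝ E] [BorelSpace E] (V : ℕ → ℕ → E)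
    (μ : Measure E) [IsProbabilityMeasure μ]
    (h : ∀ t : E, Tendsto (fun n : ℕ => (∑ m ∈ Finset.Icc 1 n,
      Complex.exp (Complex.I * (inner ℝ (V n m) t : ℝ))) / (n : ℂ)) atTop (nhds (charFun μ t)))
    {s : Set E} (hs : MeasurableSet s) (hfr : μ (frontier s) = 0) :
    Tendsto (fun n => dens (fun m => V n m ∈ s) n) atTop (nhds (μ.real s)) := by
  rw [← tendsto_add_atTop_iff_nat 1]
  let μs : ℕ → ProbabilityMeasure E := fun n =>
    ⟨empirical (V (n + 1)) (n + 1), isProbabilityMeasure_empirical _ n.succ_ne_zero⟩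
  have hlim : Tendsto μs atTop (nhds ⟨μ, inferInstance⟩) := by
    refine ProbabilityMeasure.tendsto_of_tendsto_charFun fun t => ?_
    have := (tendsto_add_atTop_iff_nat 1).2 (h t)
    refine this.congr fun n => ?_
    exact (charFun_empirical _ _ _).symm
  have key := ProbabilityMeasure.tendsto_measure_of_null_frontier_of_tendsto' hlim hfr
  have key2 := (ENNReal.tendsto_toReal (measure_ne_top μ s)).comp key
  refine key2.congr fun n => ?_
  exact empirical_real _ _ hs

/-- The sum of `w p / p` over primes `p ≤ n` is `a * log log n + O(1)`. -/
def HasMertens (w : ℕ → ℝ) (a : ℝ) : Prop :=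
  ∃ A : ℝ, ∀ n, 3 ≤ n → |primeSum w n - a * LL n| ≤ A

lemma HasMertens.add {w v : ℕ → ℝ} {a b : ℝ} (hw : HasMertens w a) (hv : HasMertens v b) :
    HasMertens (fun p => w p + v p) (a + b) := by
  obtain ⟨A, hA⟩ := hw
  obtain ⟨B, hB⟩ := hv
  refine ⟨A + B, fun n hn => ?_⟩
  have h : primeSum (fun p => w p + v p) n - (a + b) * LL n =
      (primeSum w n - a * LL n) + (primeSum v n - b * LL n) := by
    simp only [primeSum, add_div, Finset.sum_add_distrib]
    ring
  rw [h]
  exact (abs_add_le _ _).trans (add_le_add (hA n hn) (hB n hn))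

lemma HasMertens.const_mul {w : ℕ → ℝ} {a : ℝ} (hw : HasMertens w a) (c : ℝ) :
    HasMertens (fun p => c * w p) (c * a) := by
  obtain ⟨A, hA⟩ := hw
  refine ⟨|c| * A, fun n hn => ?_⟩
  have h : primeSum (fun p => c * w p) n - c * a * LL n = c * (primeSum w n - a * LL n) := by
    simp only [primeSum, mul_div_assoc, ← Finset.mul_sum]
    ring
  rw [h, abs_mul]
  exact mul_le_mul_of_nonneg_left (hA n hn) (abs_nonneg c)

lemma hasMertens_indOne (q : ℕ) [NeZero q] : HasMertens (indOne q) (q.totient : ℝ)⁻¹ := by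
  obtain ⟨C, hC⟩ := exists_abs_primeSum_indOne_sub_le q
  refine ⟨C, fun n hn => ?_⟩
  rw [inv_mul_eq_div]
  exact hC n hn

lemma indOne_mul_indOne (q r p : ℕ) : indOne q p * indOne r p = indOne (q.lcm r) p := by
  have h : p % q.lcm r = 1 % q.lcm r ↔ p % q = 1 % q ∧ p % r = 1 % r := by
    change p ≡ 1 [MOD q.lcm r] ↔ p ≡ 1 [MOD q] ∧ p ≡ 1 [MOD r]
    simp only [Nat.modEq_iff_dvd]
    constructor
    · intro h
      exact ⟨(Int.natCast_dvd_natCast.2 (Nat.dvd_lcm_left q r)).trans h,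
        (Int.natCast_dvd_natCast.2 (Nat.dvd_lcm_right q r)).trans h⟩
    · rintro ⟨h₁, h₂⟩
      have h₃ := Int.coe_lcm_dvd h₁ h₂
      simpa [Int.lcm] using h₃
  unfold indOne
  by_cases h₁ : p % q = 1 % q <;> by_cases h₂ : p % r = 1 % r <;> simp [h₁, h₂, h]

lemma indOne_mul_self (q p : ℕ) : indOne q p * indOne q p = indOne q p := by
  rw [indOne_mul_indOne, Nat.lcm_self]

lemma abs_indOne_le (q p : ℕ) : |indOne q p| ≤ 1 := by
  unfold indOne; split_ifs <;> simp

lemma sum_primeFactors_indOne (q m : ℕ) : ∑ p ∈ m.primeFactors, indOne q p = omegaQ m q := by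
  simp [indOne, omegaQ]

/-- The centred and normalised value of `omegaQ m q`, for `m` up to `n`. -/
def normOmega (q n m : ℕ) : ℝ := (omegaQ m q - LL n / q.totient) / √(LL n)

/-- The limiting variance of `x * ω(m; a) + y * ω(m; b) + z * ω(m; c)`. -/
def limVar (a b c : ℕ) (x y z : ℝ) : ℝ :=
  x ^ 2 / a.totient + y ^ 2 / b.totient + z ^ 2 / c.totient +
    2 * x * y / (a.lcm b).totient + 2 * x * z / (a.lcm c).totient +
    2 * y * z / (b.lcm c).totient

theorem tendsto_mean_exp_normOmega (a b c : ℕ) [NeZero a] [NeZero b] [NeZero c] (x y z : ℝ) :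
    Tendsto (fun n : ℕ => (∑ m ∈ Finset.Icc 1 n, Complex.exp (Complex.I *
      (x * normOmega a n m + y * normOmega b n m + z * normOmega c n m : ℝ))) / (n : ℂ))
      atTop (nhds (Complex.exp (-(limVar a b c x y z : ℂ) / 2))) := by
  have hab : NeZero (a.lcm b) := ⟨Nat.lcm_ne_zero (NeZero.ne a) (NeZero.ne b)⟩
  have hac : NeZero (a.lcm c) := ⟨Nat.lcm_ne_zero (NeZero.ne a) (NeZero.ne c)⟩
  have hbc : NeZero (b.lcm c) := ⟨Nat.lcm_ne_zero (NeZero.ne b) (NeZero.ne c)⟩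
  set w : ℕ → ℝ := fun p => x * indOne a p + y * indOne b p + z * indOne c p with hw
  have hW : ∀ p, |w p| ≤ |x| + |y| + |z| := by
    intro p
    refine (abs_add_three _ _ _).trans ?_
    simp only [abs_mul]
    gcongr <;> exact mul_le_of_le_one_right (abs_nonneg _) (abs_indOne_le _ _)
  obtain ⟨A, hA⟩ := (((hasMertens_indOne a).const_mul x).add
    ((hasMertens_indOne b).const_mul y)).add ((hasMertens_indOne c).const_mul z)
  have hsq : HasMertens (fun p => w p ^ 2) (limVar a b c x y z) := by
    have h := ((((((hasMertens_indOne a).const_mul (x ^ 2)).add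
      ((hasMertens_indOne b).const_mul (y ^ 2))).add
      ((hasMertens_indOne c).const_mul (z ^ 2))).add
      ((hasMertens_indOne (a.lcm b)).const_mul (2 * x * y))).add
      ((hasMertens_indOne (a.lcm c)).const_mul (2 * x * z))).add
      ((hasMertens_indOne (b.lcm c)).const_mul (2 * y * z))
    have e : (fun p => w p ^ 2) = fun p => x ^ 2 * indOne a p + y ^ 2 * indOne b p +
        z ^ 2 * indOne c p + 2 * x * y * indOne (a.lcm b) p + 2 * x * z * indOne (a.lcm c) p +
        2 * y * z * indOne (b.lcm c) p := by
      funext p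
      simp only [hw, ← indOne_mul_indOne]
      linear_combination x ^ 2 * indOne_mul_self a p + y ^ 2 * indOne_mul_self b p +
        z ^ 2 * indOne_mul_self c p
    rw [e]
    simpa only [limVar, div_eq_mul_inv] using h
  obtain ⟨B, hB⟩ := hsq
  refine (tendsto_mean_exp hW hA hB).congr fun n => ?_
  congr 1
  refine Finset.sum_congr rfl fun m _ => ?_
  congr 3
  simp only [hw, Finset.sum_add_distrib, ← Finset.mul_sum, sum_primeFactors_indOne, normOmega]
  ring

/-- Weak convergence of two linear forms in the `normOmega` to a standard planar Gaussian. -/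
theorem tendsto_dens_normOmega (a b c : ℕ) [NeZero a] [NeZero b] [NeZero c]
    {x₁ y₁ z₁ x₂ y₂ z₂ : ℝ} (hV : ∀ s t : ℝ, limVar a b c (s * x₁ + t * x₂) (s * y₁ + t * y₂)
      (s * z₁ + t * z₂) = s ^ 2 + t ^ 2)
    {S : Set (EuclideanSpace ℝ (Fin 2))} (hS : MeasurableSet S)
    (hfr : ProbabilityTheory.stdGaussian (EuclideanSpace ℝ (Fin 2)) (frontier S) = 0) :
    Tendsto (fun n => dens (fun m =>
      (!₂[x₁ * normOmega a n m + y₁ * normOmega b n m + z₁ * normOmega c n m,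
        x₂ * normOmega a n m + y₂ * normOmega b n m + z₂ * normOmega c n m] :
          EuclideanSpace ℝ (Fin 2)) ∈ S) n) atTop
      (nhds ((ProbabilityTheory.stdGaussian (EuclideanSpace ℝ (Fin 2))).real S)) := by
  refine tendsto_dens_of_tendsto_charFun (fun n m =>
      (!₂[x₁ * normOmega a n m + y₁ * normOmega b n m + z₁ * normOmega c n m,
        x₂ * normOmega a n m + y₂ * normOmega b n m + z₂ * normOmega c n m] :
          EuclideanSpace ℝ (Fin 2))) _ (fun t => ?_) hS hfr
  rw [charFun_stdGaussian]
  have h := tendsto_mean_exp_normOmega a b c (t 0 * x₁ + t 1 * x₂) (t 0 * y₁ + t 1 * y₂)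
    (t 0 * z₁ + t 1 * z₂)
  rw [hV] at h
  have e : (((t 0 ^ 2 + t 1 ^ 2 : ℝ)) : ℂ) = (‖t‖ : ℂ) ^ 2 := by
    rw [← Complex.ofReal_pow, EuclideanSpace.norm_sq_eq]
    simp [Fin.sum_univ_two]
  rw [e] at h
  refine h.congr fun n => ?_
  congr 1
  refine Finset.sum_congr rfl fun m _ => ?_
  congr 3
  simp [PiLp.inner_apply, Fin.sum_univ_two]
  ring

/-- The standard normal density. -/
def stdDensity (t : ℝ) : ℝ := (√(2 * Real.pi))⁻¹ * Real.exp (-t ^ 2 / 2)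

lemma gaussianPDFReal_zero_one : gaussianPDFReal 0 1 = stdDensity := by
  funext t
  simp [gaussianPDFReal_def, stdDensity]

lemma integrable_stdDensity : Integrable stdDensity :=
  gaussianPDFReal_zero_one ▸ integrable_gaussianPDFReal 0 1

lemma continuous_stdDensity : Continuous stdDensity := by
  unfold stdDensity; fun_prop

lemma stdDensity_nonneg (t : ℝ) : 0 ≤ stdDensity t := by
  unfold stdDensity; positivity

lemma stdDensity_le_one (t : ℝ) : stdDensity t ≤ 1 := by
  unfold stdDensity
  refine mul_le_one₀ (inv_le_one_of_one_le₀ ?_) (Real.exp_nonneg _) ?_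
  · rw [Real.one_le_sqrt]
    nlinarith [Real.pi_gt_three]
  · rw [Real.exp_le_one_iff]
    nlinarith [sq_nonneg t]

lemma stdDensity_mul (s t : ℝ) :
    stdDensity s * stdDensity t = (2 * Real.pi)⁻¹ * Real.exp (-(s ^ 2 + t ^ 2) / 2) := by
  unfold stdDensity
  have h : √(2 * Real.pi) * √(2 * Real.pi) = 2 * Real.pi := Real.mul_self_sqrt (by positivity)
  rw [mul_mul_mul_comm, ← mul_inv, h, ← Real.exp_add]
  congr 2
  ring

lemma gaussianReal_real (s : Set ℝ) : (gaussianReal 0 1).real s = ∫ t in s, stdDensity t := by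
  rw [Measure.real, gaussianReal_apply_eq_integral _ one_ne_zero, gaussianPDFReal_zero_one,
    ENNReal.toReal_ofReal]
  exact integral_nonneg fun t => stdDensity_nonneg t

lemma Phi_eq_integral (x : ℝ) : Phi x = ∫ t in Set.Iic x, stdDensity t := by
  simp only [Phi, stdDensity, integral_const_mul]

lemma continuous_Phi : Continuous Phi := by
  have h : Phi = fun x => (∫ t in Set.Iic 0, stdDensity t) + ∫ t in (0 : ℝ)..x, stdDensity t := by
    funext x
    rw [Phi_eq_integral, ← intervalIntegral.integral_Iic_sub_Iic integrable_stdDensity.integrableOn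
      integrable_stdDensity.integrableOn]
    ring
  rw [h]
  exact continuous_const.add (intervalIntegral.continuous_primitive
    (fun a b => integrable_stdDensity.intervalIntegrable) 0)

lemma continuous_OwenT (a : ℝ) : Continuous fun x => OwenT x a := by
  unfold OwenT
  refine continuous_const.mul
    (intervalIntegral.continuous_parametric_intervalIntegral_of_continuous' ?_ 0 a)
  refine Continuous.div (by fun_prop) (by fun_prop) ?_
  rintro ⟨x, t⟩
  positivity

lemma continuous_PhiSkew (α : ℝ) : Continuous fun x => PhiSkew x α :=
  continuous_Phi.sub ((continuous_OwenT α).const_mul 2)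

lemma OwenT_neg (x a : ℝ) : OwenT x (-a) = -OwenT x a := by
  have h := intervalIntegral.integral_comp_neg (a := 0) (b := a)
    (fun t : ℝ => Real.exp (-(1 + t ^ 2) * x ^ 2 / 2) / (1 + t ^ 2))
  simp only [neg_zero, neg_sq] at h
  rw [OwenT, OwenT, intervalIntegral.integral_symm, ← h]
  ring

lemma gaussianReal_real_Ici (c : ℝ) :
    (gaussianReal 0 1).real (Set.Ici c) = 1 / 2 - ∫ t in (0 : ℝ)..c, stdDensity t := by
  have h0 : ∫ t in Set.Ioi 0, stdDensity t = 1 / 2 := by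
    have h := integral_gaussian_Ioi (1 / 2)
    have e : stdDensity = fun t => (√(2 * Real.pi))⁻¹ * Real.exp (-(1 / 2) * t ^ 2) := by
      funext t
      unfold stdDensity
      congr 2
      ring
    rw [e, integral_const_mul, h, show Real.pi / (1 / 2) = 2 * Real.pi by ring]
    have : √(2 * Real.pi) ≠ 0 := by positivity
    field_simp
  rw [gaussianReal_real, integral_Ici_eq_integral_Ioi, ← h0,
    ← intervalIntegral.integral_interval_add_Ioi (a := 0) (b := c)
      integrable_stdDensity.integrableOn integrable_stdDensity.integrableOn]
  ring

lemma integral_Iic_mul_stdDensity (x u : ℝ) :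
    ∫ t in Set.Iic x, t * (stdDensity t * stdDensity (t * u)) =
      -((2 * Real.pi)⁻¹ * (Real.exp (-(1 + u ^ 2) * x ^ 2 / 2) / (1 + u ^ 2))) := by
  have hu : 0 < 1 + u ^ 2 := by positivity
  set F : ℝ → ℝ := fun t =>
    -((2 * Real.pi)⁻¹ * (Real.exp (-((1 + u ^ 2) / 2) * t ^ 2) / (1 + u ^ 2))) with hF
  have e : ∀ t, t * (stdDensity t * stdDensity (t * u)) =
      (2 * Real.pi)⁻¹ * (t * Real.exp (-((1 + u ^ 2) / 2) * t ^ 2)) := by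
    intro t
    rw [stdDensity_mul, show -(t ^ 2 + (t * u) ^ 2) / 2 = -((1 + u ^ 2) / 2) * t ^ 2 by ring]
    ring
  have hd : ∀ t, HasDerivAt F ((2 * Real.pi)⁻¹ * (t * Real.exp (-((1 + u ^ 2) / 2) * t ^ 2))) t := by
    intro t
    have h1 : HasDerivAt (fun t : ℝ => -((1 + u ^ 2) / 2) * t ^ 2)
        (-((1 + u ^ 2) / 2) * (2 * t)) t := by
      simpa using (hasDerivAt_pow 2 t).const_mul (-((1 + u ^ 2) / 2))
    refine (((h1.exp.div_const (1 + u ^ 2)).const_mul (2 * Real.pi)⁻¹).neg).congr_deriv ?_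
    field_simp
  have hlim : Tendsto F atBot (nhds 0) := by
    have h2 : Tendsto (fun t : ℝ => -((1 + u ^ 2) / 2) * t ^ 2) atBot atBot := by
      have h3 : Tendsto (fun t : ℝ => t ^ 2) atBot atTop := by
        have := (tendsto_pow_atTop (α := ℝ) two_ne_zero).comp tendsto_neg_atBot_atTop
        simpa [Function.comp_def] using this
      refine h3.const_mul_atTop_of_neg ?_
      linarith
    have := (((Real.tendsto_exp_atBot.comp h2).div_const (1 + u ^ 2)).const_mul
      (2 * Real.pi)⁻¹).neg
    simpa [hF] using this
  simp only [e]
  rw [integral_Iic_of_hasDerivAt_of_tendsto (hd x).continuousAt.continuousWithinAt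
    (fun t _ => hd t) ((integrable_mul_exp_neg_mul_sq (by positivity)).const_mul _).integrableOn hlim]
  simp only [hF, sub_zero]
  congr 4
  ring

lemma integral_Iic_mul_tail (x : ℝ) {a : ℝ} (ha : 0 ≤ a) :
    ∫ t in Set.Iic x, stdDensity t * (gaussianReal 0 1).real (Set.Ici (a * t)) =
      1 / 2 * Phi x + OwenT x a := by
  have e : ∀ t, stdDensity t * (gaussianReal 0 1).real (Set.Ici (a * t)) =
      1 / 2 * stdDensity t -
        ∫ u in Set.Ioc 0 a, t * (stdDensity t * stdDensity (t * u)) := by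
    intro t
    have h := intervalIntegral.mul_integral_comp_mul_left (a := 0) (b := a) (f := stdDensity) t
    rw [mul_zero, mul_comm t a] at h
    rw [gaussianReal_real_Ici, ← h, integral_const_mul, integral_const_mul,
      intervalIntegral.integral_of_le ha]
    ring
  have hprod_int : Integrable (Function.uncurry fun t u => t * (stdDensity t * stdDensity (t * u)))
      ((volume.restrict (Set.Iic x)).prod (volume.restrict (Set.Ioc 0 a))) := by
    have h1 : Integrable (fun t => t * stdDensity t) := by
      have h := (integrable_mul_exp_neg_mul_sq (b := 1 / 2) (by norm_num)).const_mul
        (√(2 * Real.pi))⁻¹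
      refine h.congr (ae_of_all _ fun t => ?_)
      simp only [stdDensity]
      rw [show -(1 / 2) * t ^ 2 = -t ^ 2 / 2 by ring]
      ring
    have h2 : Integrable (fun _ : ℝ => (1 : ℝ)) (volume.restrict (Set.Ioc 0 a)) := by
      simp
    refine (h1.integrableOn.integrable.mul_prod h2).mono ?_ (ae_of_all _ ?_)
    · refine Continuous.aestronglyMeasurable ?_
      have := continuous_stdDensity
      simp only [Function.uncurry_def]
      fun_prop
    · rintro ⟨t, u⟩
      simp only [Function.uncurry_apply_pair, norm_mul, mul_one]
      rw [← mul_assoc]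
      refine mul_le_of_le_one_right (by positivity) ?_
      rw [Real.norm_of_nonneg (stdDensity_nonneg _)]
      exact stdDensity_le_one _
  simp only [e]
  rw [integral_sub (integrable_stdDensity.integrableOn.integrable.const_mul _)
    (by simpa only [Function.uncurry_apply_pair] using hprod_int.integral_prod_left),
    integral_const_mul, ← Phi_eq_integral, integral_integral_swap hprod_int]
  simp only [integral_Iic_mul_stdDensity, integral_neg, integral_const_mul, OwenT]
  rw [intervalIntegral.integral_of_le ha]
  ring

/-- The planar region `{v | v₀ ≤ x, a v₀ ≤ v₁}`. -/
def wedge (x a : ℝ) : Set (EuclideanSpace ℝ (Fin 2)) := {v | v 0 ≤ x ∧ a * v 0 ≤ v 1}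

/-- The planar region `{v | v₀ ≤ x, a v₀ < v₁}`. -/
def openWedge (x a : ℝ) : Set (EuclideanSpace ℝ (Fin 2)) := {v | v 0 ≤ x ∧ a * v 0 < v 1}

lemma stdGaussian_apply {s : Set (EuclideanSpace ℝ (Fin 2))} (hs : MeasurableSet s) :
    ProbabilityTheory.stdGaussian (EuclideanSpace ℝ (Fin 2)) s =
      ((gaussianReal 0 1).prod (gaussianReal 0 1))
        {p | (!₂[p.1, p.2] : EuclideanSpace ℝ (Fin 2)) ∈ s} := by
  rw [← map_pi_eq_stdGaussian, Measure.map_apply (by fun_prop) hs]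
  have h := (measurePreserving_finTwoArrow (gaussianReal 0 1)).symm
  rw [← h.measure_preimage_equiv]
  congr 1

lemma measurable_coord (i : Fin 2) : Measurable fun v : EuclideanSpace ℝ (Fin 2) => v i := by
  fun_prop

lemma measurableSet_wedge (x a : ℝ) : MeasurableSet (wedge x a) :=
  (measurableSet_le (measurable_coord 0) measurable_const).inter
    (measurableSet_le ((measurable_coord 0).const_mul a) (measurable_coord 1))

lemma measurableSet_openWedge (x a : ℝ) : MeasurableSet (openWedge x a) :=
  (measurableSet_le (measurable_coord 0) measurable_const).inter
    (measurableSet_lt ((measurable_coord 0).const_mul a) (measurable_coord 1))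

lemma stdGaussian_boundary (x a : ℝ) :
    ProbabilityTheory.stdGaussian (EuclideanSpace ℝ (Fin 2)) {v | v 0 = x ∨ v 1 = a * v 0} = 0 := by
  have hna : NullSingletonClass (gaussianReal 0 1) := nullSingletonClass_gaussianReal one_ne_zero
  have hm : MeasurableSet {v : EuclideanSpace ℝ (Fin 2) | v 0 = x ∨ v 1 = a * v 0} :=
    (measurableSet_eq_fun (measurable_coord 0) measurable_const).union
      (measurableSet_eq_fun (measurable_coord 1) ((measurable_coord 0).const_mul a))
  rw [stdGaussian_apply hm]
  have hsub : {p : ℝ × ℝ | (!₂[p.1, p.2] : EuclideanSpace ℝ (Fin 2)) ∈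
      {v : EuclideanSpace ℝ (Fin 2) | v 0 = x ∨ v 1 = a * v 0}} ⊆
      ({x} ×ˢ Set.univ) ∪ {p : ℝ × ℝ | p.2 = a * p.1} := by
    rintro ⟨s, t⟩ h
    simpa using h
  refine measure_mono_null hsub (measure_union_null (by simp) ?_)
  rw [Measure.measure_prod_null (measurableSet_eq_fun measurable_snd (measurable_fst.const_mul a))]
  refine ae_of_all _ fun s => ?_
  have : Prod.mk s ⁻¹' {p : ℝ × ℝ | p.2 = a * p.1} = {a * s} := by
    ext t; simp
  simp [this]

lemma frontier_subset_of_strict {x a : ℝ} {s : Set (EuclideanSpace ℝ (Fin 2))}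
    (h₁ : {v | v 0 < x ∧ a * v 0 < v 1} ⊆ s) (h₂ : s ⊆ wedge x a) :
    frontier s ⊆ {v | v 0 = x ∨ v 1 = a * v 0} := by
  have c0 : Continuous fun v : EuclideanSpace ℝ (Fin 2) => v 0 := by fun_prop
  have c1 : Continuous fun v : EuclideanSpace ℝ (Fin 2) => v 1 := by fun_prop
  have hcl : IsClosed (wedge x a) :=
    (isClosed_le c0 continuous_const).inter (isClosed_le (continuous_const.mul c0) c1)
  have hop : IsOpen {v : EuclideanSpace ℝ (Fin 2) | v 0 < x ∧ a * v 0 < v 1} :=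
    (isOpen_lt c0 continuous_const).inter (isOpen_lt (continuous_const.mul c0) c1)
  rintro v ⟨hv₁, hv₂⟩
  obtain ⟨h3, h4⟩ := closure_minimal h₂ hcl hv₁
  by_contra hne
  simp only [Set.mem_ofPred_eq, not_or] at hne
  exact hv₂ (interior_maximal h₁ hop ⟨lt_of_le_of_ne h3 hne.1, lt_of_le_of_ne h4 (Ne.symm hne.2)⟩)

lemma stdGaussian_frontier_wedge (x a : ℝ) :
    ProbabilityTheory.stdGaussian (EuclideanSpace ℝ (Fin 2)) (frontier (wedge x a)) = 0 :=
  measure_mono_null (frontier_subset_of_strict (fun _ h => ⟨h.1.le, h.2.le⟩) le_rfl)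
    (stdGaussian_boundary x a)

lemma stdGaussian_frontier_openWedge (x a : ℝ) :
    ProbabilityTheory.stdGaussian (EuclideanSpace ℝ (Fin 2)) (frontier (openWedge x a)) = 0 :=
  measure_mono_null (frontier_subset_of_strict (fun _ h => ⟨h.1.le, h.2⟩)
    (fun _ h => ⟨h.1, h.2.le⟩)) (stdGaussian_boundary x a)

lemma stdGaussian_real_openWedge (x a : ℝ) :
    (ProbabilityTheory.stdGaussian (EuclideanSpace ℝ (Fin 2))).real (openWedge x a) =
      (ProbabilityTheory.stdGaussian (EuclideanSpace ℝ (Fin 2))).real (wedge x a) := by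
  refine measureReal_congr (ae_eq_set.2 ⟨?_, ?_⟩)
  · have h : openWedge x a ⊆ wedge x a := fun v h => ⟨h.1, h.2.le⟩
    rw [Set.sdiff_eq_empty.2 h, measure_empty]
  · refine measure_mono_null ?_ (stdGaussian_boundary x a)
    rintro v ⟨h₁, h₂⟩
    refine Or.inr (le_antisymm ?_ h₁.2)
    by_contra h
    exact h₂ ⟨h₁.1, not_le.1 h⟩

theorem two_mul_stdGaussian_wedge (x : ℝ) {a : ℝ} (ha : 0 ≤ a) :
    2 * (ProbabilityTheory.stdGaussian (EuclideanSpace ℝ (Fin 2))).real (wedge x a) =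
      PhiSkew x (-a) := by
  have hm : MeasurableSet {p : ℝ × ℝ | p.1 ≤ x ∧ a * p.1 ≤ p.2} :=
    (measurableSet_le measurable_fst measurable_const).inter
      (measurableSet_le (measurable_fst.const_mul a) measurable_snd)
  have h1 : (ProbabilityTheory.stdGaussian (EuclideanSpace ℝ (Fin 2))).real (wedge x a) =
      ∫ t in Set.Iic x, stdDensity t * (gaussianReal 0 1).real (Set.Ici (a * t)) := by
    have h2 : {p : ℝ × ℝ | (!₂[p.1, p.2] : EuclideanSpace ℝ (Fin 2)) ∈ wedge x a} =
        {p : ℝ × ℝ | p.1 ≤ x ∧ a * p.1 ≤ p.2} := by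
      ext p; simp [wedge]
    rw [Measure.real, stdGaussian_apply (measurableSet_wedge x a), h2, Measure.prod_apply hm,
      ← integral_toReal (measurable_measure_prodMk_left hm).aemeasurable
        (ae_of_all _ fun _ => measure_lt_top _ _),
      integral_gaussianReal_eq_integral_smul one_ne_zero, gaussianPDFReal_zero_one,
      ← integral_indicator measurableSet_Iic]
    refine integral_congr_ae (ae_of_all _ fun t => ?_)
    by_cases ht : t ≤ x
    · have : Prod.mk t ⁻¹' {p : ℝ × ℝ | p.1 ≤ x ∧ a * p.1 ≤ p.2} = Set.Ici (a * t) := by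
        ext u; simp [ht]
      simp [ht, this, Measure.real]
    · have : Prod.mk t ⁻¹' {p : ℝ × ℝ | p.1 ≤ x ∧ a * p.1 ≤ p.2} = ∅ := by
        ext u; simp [ht]
      simp [ht, this]
  rw [h1, integral_Iic_mul_tail x ha, PhiSkew, OwenT_neg]
  ring

lemma dens_or_of_disjoint {P Q : ℕ → Prop} (h : ∀ m, P m → ¬ Q m) (n : ℕ) :
    dens (fun m => P m ∨ Q m) n = dens P n + dens Q n := by
  classical
  rw [dens, dens, dens, cnt_eq_card, cnt_eq_card, cnt_eq_card, Finset.filter_or,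
    Finset.card_union_of_disjoint, Nat.cast_add, add_div]
  exact Finset.disjoint_filter.2 fun m _ hp => h m hp

lemma dens_congr {P Q : ℕ → Prop} {n : ℕ} (h : ∀ m, P m ↔ Q m) : dens P n = dens Q n := by
  rw [funext fun m => propext (h m)]

/-- Slutsky's theorem for values of arithmetic functions. -/
theorem tendsto_dens_of_close {Z Y : ℕ → ℕ → ℝ} {F : ℝ → ℝ} (hF : Continuous F)
    (hZ : ∀ x, Tendsto (fun n => dens (fun m => Z n m ≤ x) n) atTop (nhds (F x)))
    (h : ∀ η : ℝ, 0 < η → Negligible fun n m => η < |Y n m - Z n m|) (x : ℝ) :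
    Tendsto (fun n => dens (fun m => Y n m ≤ x) n) atTop (nhds (F x)) := by
  rw [Metric.tendsto_nhds]
  intro ε hε
  obtain ⟨δ, hδ, hFδ⟩ := Metric.continuous_iff.1 hF x (ε / 3) (by positivity)
  set η := δ / 2
  have hη : 0 < η := by positivity
  have hu := abs_lt.1 (hFδ (x + η) (by rw [Real.dist_eq]; simp [abs_of_pos hη, η, hδ]))
  have hl := abs_lt.1 (hFδ (x - η) (by rw [Real.dist_eq]; simp [abs_of_pos hη, η, hδ]))
  filter_upwards [Metric.tendsto_nhds.1 (hZ (x + η)) (ε / 3) (by positivity),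
    Metric.tendsto_nhds.1 (hZ (x - η)) (ε / 3) (by positivity),
    Metric.tendsto_nhds.1 (h η hη) (ε / 3) (by positivity)] with n hn₁ hn₂ hn₃
  rw [Real.dist_eq] at *
  have e₁ := abs_lt.1 hn₁
  have e₂ := abs_lt.1 hn₂
  have e₃ := abs_lt.1 hn₃
  have k₁ : dens (fun m => Y n m ≤ x) n ≤
      dens (fun m => Z n m ≤ x + η) n + dens (fun m => η < |Y n m - Z n m|) n := by
    refine le_trans (dens_mono fun m _ _ hm => ?_) (dens_or_le _ _ n)
    by_contra! hc
    linarith [abs_le.1 hc.2]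
  have k₂ : dens (fun m => Z n m ≤ x - η) n ≤
      dens (fun m => Y n m ≤ x) n + dens (fun m => η < |Y n m - Z n m|) n := by
    refine le_trans (dens_mono fun m _ _ hm => ?_) (dens_or_le _ _ n)
    by_contra! hc
    linarith [abs_le.1 hc.2]
  rw [abs_lt]
  constructor <;> linarith

section Extremal

variable {a b c : ℕ} {α β σ ν κ : ℝ}

lemma limVar_eq (hα : α ≠ 0) (hβ : β ≠ 0) (hσ : 0 < σ) (hν : 0 < ν) (hκ : 0 < κ)
    (ha : (a.totient : ℝ) = α) (hb : (b.totient : ℝ) = β) (hc : (c.totient : ℝ) = β)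
    (hab : ((a.lcm b).totient : ℝ) = α * β) (hac : ((a.lcm c).totient : ℝ) = α * β)
    (hbc : ((b.lcm c).totient : ℝ) = β ^ 2) (hσ2 : σ ^ 2 = 1 / α + 1 / β - 2 / (α * β))
    (hν2 : ν ^ 2 = 1 / β * (1 - 1 / β)) (hκ2 : κ ^ 2 = 2 * σ ^ 2 - ν ^ 2) (s t : ℝ) :
    limVar a b c (s * (1 / σ) + t * (ν / (κ * σ))) (s * 0 + t * (-(σ / (κ * ν))))
      (s * (-(1 / σ)) + t * (σ / (κ * ν) - ν / (κ * σ))) = s ^ 2 + t ^ 2 := by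
  set u := (s + t * ν / κ) / σ with hu
  set v := t * σ / (κ * ν) with hv
  have e₁ : s * (1 / σ) + t * (ν / (κ * σ)) = u := by rw [hu]; field_simp
  have e₂ : s * 0 + t * (-(σ / (κ * ν))) = -v := by rw [hv]; ring
  have e₃ : s * (-(1 / σ)) + t * (σ / (κ * ν) - ν / (κ * σ)) = v - u := by
    rw [hu, hv]; field_simp; ring
  rw [e₁, e₂, e₃, limVar, ha, hb, hc, hab, hac, hbc]
  have e₄ : u ^ 2 / α + (-v) ^ 2 / β + (v - u) ^ 2 / β + 2 * u * (-v) / (α * β) +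
      2 * u * (v - u) / (α * β) + 2 * (-v) * (v - u) / β ^ 2 =
      u ^ 2 * σ ^ 2 + 2 * v ^ 2 * ν ^ 2 - 2 * ν ^ 2 * u * v := by
    rw [hσ2, hν2]; field_simp; ring
  rw [e₄]
  have e₅ : u * σ = s + t * ν / κ := by rw [hu]; field_simp
  have e₆ : v * ν = t * σ / κ := by rw [hv]; field_simp
  have e₇ : u * v * ν ^ 2 = (s + t * ν / κ) * (t * ν / κ) := by rw [hu, hv]; field_simp
  calc u ^ 2 * σ ^ 2 + 2 * v ^ 2 * ν ^ 2 - 2 * ν ^ 2 * u * v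
      = (u * σ) ^ 2 + 2 * (v * ν) ^ 2 - 2 * (u * v * ν ^ 2) := by ring
    _ = s ^ 2 + t ^ 2 * (2 * σ ^ 2 - ν ^ 2) / κ ^ 2 := by rw [e₅, e₆, e₇]; field_simp; ring
    _ = s ^ 2 + t ^ 2 := by rw [← hκ2]; field_simp

theorem tendsto_dens_sub_max [NeZero a] [NeZero b] [NeZero c] (hα : α ≠ 0) (hβ : β ≠ 0) (hσ : 0 < σ) (hν : 0 < ν) (hκ : 0 < κ)
    (ha : (a.totient : ℝ) = α) (hb : (b.totient : ℝ) = β) (hc : (c.totient : ℝ) = β)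
    (hab : ((a.lcm b).totient : ℝ) = α * β) (hac : ((a.lcm c).totient : ℝ) = α * β)
    (hbc : ((b.lcm c).totient : ℝ) = β ^ 2) (hσ2 : σ ^ 2 = 1 / α + 1 / β - 2 / (α * β))
    (hν2 : ν ^ 2 = 1 / β * (1 - 1 / β)) (hκ2 : κ ^ 2 = 2 * σ ^ 2 - ν ^ 2) (x : ℝ) :
    Tendsto (fun n => dens (fun m =>
      (normOmega a n m - max (normOmega b n m) (normOmega c n m)) / σ ≤ x) n) atTop
      (nhds (PhiSkew x (-(ν / κ)))) := by
  have hcb : ((c.lcm b).totient : ℝ) = β ^ 2 := by rw [Nat.lcm_comm, hbc]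
  have h₁ := tendsto_dens_normOmega a b c
    (limVar_eq hα hβ hσ hν hκ ha hb hc hab hac hbc hσ2 hν2 hκ2)
    (measurableSet_wedge x (ν / κ)) (stdGaussian_frontier_wedge x (ν / κ))
  have h₂ := tendsto_dens_normOmega a c b
    (limVar_eq hα hβ hσ hν hκ ha hc hb hac hab hcb hσ2 hν2 hκ2)
    (measurableSet_openWedge x (ν / κ)) (stdGaussian_frontier_openWedge x (ν / κ))
  rw [← two_mul_stdGaussian_wedge x (by positivity : 0 ≤ ν / κ), two_mul]
  nth_rewrite 2 [← stdGaussian_real_openWedge]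
  have key : ∀ A B C : ℝ, (ν / κ * (1 / σ * A + 0 * B + -(1 / σ) * C) ≤
      ν / (κ * σ) * A + -(σ / (κ * ν)) * B + (σ / (κ * ν) - ν / (κ * σ)) * C ↔ B ≤ C) := by
    intro A B C
    have : ν / (κ * σ) * A + -(σ / (κ * ν)) * B + (σ / (κ * ν) - ν / (κ * σ)) * C -
      ν / κ * (1 / σ * A + 0 * B + -(1 / σ) * C) = σ / (κ * ν) * (C - B) := by
      field_simp; ring
    rw [← sub_nonneg, this, mul_nonneg_iff_of_pos_left (by positivity), sub_nonneg]
  have key' : ∀ A B C : ℝ, (ν / κ * (1 / σ * A + 0 * B + -(1 / σ) * C) <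
      ν / (κ * σ) * A + -(σ / (κ * ν)) * B + (σ / (κ * ν) - ν / (κ * σ)) * C ↔ B < C) := by
    intro A B C
    have : ν / (κ * σ) * A + -(σ / (κ * ν)) * B + (σ / (κ * ν) - ν / (κ * σ)) * C -
      ν / κ * (1 / σ * A + 0 * B + -(1 / σ) * C) = σ / (κ * ν) * (C - B) := by
      field_simp; ring
    rw [← sub_pos, this, mul_pos_iff_of_pos_left (by positivity), sub_pos]
  have key₀ : ∀ A B C : ℝ, 1 / σ * A + 0 * B + -(1 / σ) * C = (A - C) / σ := by
    intro A B C; field_simp; ring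
  refine (h₁.add h₂).congr fun n => ?_
  rw [← dens_or_of_disjoint]
  · refine dens_congr fun m => ?_
    simp only [wedge, openWedge, Set.mem_ofPred_eq, Matrix.cons_val_zero,
      Matrix.cons_val_one, key, key']
    simp only [key₀]
    rcases le_or_gt (normOmega b n m) (normOmega c n m) with h | h
    · simp [h, not_lt.2 h]
    · simp [h, not_le.2 h, max_eq_left h.le]
  · intro m
    simp only [wedge, openWedge, Set.mem_ofPred_eq, Matrix.cons_val_zero,
      Matrix.cons_val_one, key, key']
    rintro ⟨_, h⟩ ⟨_, h'⟩
    exact absurd h (not_le.2 h')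

end Extremal

section InvariantFactors

/-- Splitting off the first factor of a product over `Fin (n + 1)`. -/
def piFinSuccAddEquiv {n : ℕ} (G : Fin (n + 1) → Type*) [∀ j, AddCommGroup (G j)] :
    (∀ j, G j) ≃+ G 0 × ∀ j : Fin n, G j.succ where
  toFun x := (x 0, fun j => x j.succ)
  invFun y := Fin.cons y.1 y.2
  left_inv x := Fin.cons_self_tail x
  right_inv y := by simp
  map_add' _ _ := rfl

lemma exists_zmod_swap {p : ℕ} (hp : p.Prime) (e : ℕ) {l : ℕ} (hl : 0 < l) :
    ∃ b, b ∣ p ^ e ∧ b ∣ l ∧ (∃ h, b = p ^ h) ∧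
      Nonempty (ZMod (p ^ e) × ZMod l ≃+ ZMod (Nat.lcm (p ^ e) l) × ZMod b) := by
  by_cases hle : p ^ e ∣ l
  · exact ⟨p ^ e, dvd_rfl, hle, ⟨e, rfl⟩, by
      rw [Nat.lcm_eq_right hle]; exact ⟨AddEquiv.prodComm⟩⟩
  obtain ⟨f, u, hu, rfl⟩ := Nat.exists_eq_pow_mul_and_not_dvd hl.ne' p hp.ne_one
  have hfe : f ≤ e := by
    by_contra! h
    exact hle ((pow_dvd_pow p h.le).mul_right u)
  have hcop : Nat.Coprime p u := (Nat.Prime.coprime_iff_not_dvd hp).2 hu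
  have hlcm : Nat.lcm (p ^ e) (p ^ f * u) = p ^ e * u := by
    refine Nat.dvd_antisymm (Nat.lcm_dvd (dvd_mul_right _ _)
      (mul_dvd_mul_right (pow_dvd_pow p hfe) u)) ?_
    exact (hcop.pow_left e).mul_dvd_of_dvd_of_dvd (Nat.dvd_lcm_left _ _)
      ((dvd_mul_left u _).trans (Nat.dvd_lcm_right _ _))
  refine ⟨p ^ f, pow_dvd_pow p hfe, dvd_mul_right _ _, ⟨f, rfl⟩, ?_⟩
  rw [hlcm]
  have e₁ := (ZMod.chineseRemainder (hcop.pow_left f)).toAddEquiv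
  have e₂ := (ZMod.chineseRemainder (hcop.pow_left e)).toAddEquiv
  exact ⟨((AddEquiv.refl _).prodCongr (e₁.trans AddEquiv.prodComm)).trans
    (AddEquiv.prodAssoc.symm.trans (e₂.symm.prodCongr (AddEquiv.refl _)))⟩

lemma exists_chain_insert (K : ℕ) (l : Fin K → ℕ) (hl : ∀ j, 0 < l j)
    (hdvd : ∀ j k, j ≤ k → l k ∣ l j) {p : ℕ} (hp : p.Prime) (e : ℕ) :
    ∃ l' : Fin (K + 1) → ℕ, (∀ j, 0 < l' j) ∧ (∀ j k, j ≤ k → l' k ∣ l' j) ∧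
      (∀ N, p ^ e ∣ N → (∀ j, l j ∣ N) → ∀ j, l' j ∣ N) ∧
      Nonempty ((ZMod (p ^ e) × ∀ j, ZMod (l j)) ≃+ ∀ j, ZMod (l' j)) := by
  induction K generalizing e with
  | zero =>
    refine ⟨fun _ => p ^ e, fun _ => pow_pos hp.pos e, fun _ _ _ => dvd_rfl, fun N h _ _ => h, ?_⟩
    have e₀ : (∀ j, ZMod (l j)) ≃+ ∀ _ : Fin 0, ZMod (p ^ e) :=
      { Equiv.ofUnique _ _ with map_add' := fun _ _ => Subsingleton.elim _ _ }
    exact ⟨((AddEquiv.refl _).prodCongr e₀).trans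
      (piFinSuccAddEquiv (fun _ : Fin 1 => ZMod (p ^ e))).symm⟩
  | succ K ih =>
    obtain ⟨b, hb₁, hb₂, ⟨h, rfl⟩, ⟨e₁⟩⟩ := exists_zmod_swap hp e (hl 0)
    obtain ⟨m, hm₁, hm₂, hm₃, ⟨e₂⟩⟩ := ih (fun j => l j.succ) (fun j => hl _)
      (fun j k hjk => hdvd _ _ (Fin.succ_le_succ_iff.2 hjk)) h
    have hm₄ : ∀ j, m j ∣ Nat.lcm (p ^ e) (l 0) :=
      hm₃ _ (hb₂.trans (Nat.dvd_lcm_right _ _))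
        fun j => (hdvd _ _ (Fin.zero_le _)).trans (Nat.dvd_lcm_right _ _)
    refine ⟨Fin.cons (Nat.lcm (p ^ e) (l 0)) m, ?_, ?_, ?_, ?_⟩
    · intro j
      refine Fin.cases ?_ (fun j => ?_) j
      · exact Nat.lcm_pos (pow_pos hp.pos e) (hl 0)
      · exact hm₁ j
    · intro j k
      refine Fin.cases ?_ (fun j => ?_) j <;> refine Fin.cases ?_ (fun k => ?_) k
      · exact fun _ => dvd_rfl
      · exact fun _ => hm₄ k
      · intro hjk
        exact absurd hjk (not_le.2 (Fin.succ_pos j))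
      · intro hjk
        exact hm₂ j k (Fin.succ_le_succ_iff.1 hjk)
    · intro N hN hlN j
      have hlcm : Nat.lcm (p ^ e) (l 0) ∣ N := Nat.lcm_dvd hN (hlN 0)
      refine Fin.cases hlcm (fun j => (hm₄ j).trans hlcm) j
    · exact ⟨(((AddEquiv.refl _).prodCongr (piFinSuccAddEquiv (fun j => ZMod (l j)))).trans
        (AddEquiv.prodAssoc.symm.trans ((e₁.prodCongr (AddEquiv.refl _)).trans
        (AddEquiv.prodAssoc.trans ((AddEquiv.refl _).prodCongr e₂))))).trans
        (piFinSuccAddEquiv (fun j => ZMod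
          ((Fin.cons (Nat.lcm (p ^ e) (l 0)) m : Fin (K + 1 + 1) → ℕ) j))).symm⟩

lemma exists_chain_of_primePowers (K : ℕ) (p e : Fin K → ℕ) (hp : ∀ j, (p j).Prime) :
    ∃ l : Fin K → ℕ, (∀ j, 0 < l j) ∧ (∀ j k, j ≤ k → l k ∣ l j) ∧
      Nonempty ((∀ j, ZMod (p j ^ e j)) ≃+ ∀ j, ZMod (l j)) := by
  induction K with
  | zero => exact ⟨fun j => p j ^ e j, fun j => j.elim0, fun j => j.elim0, ⟨AddEquiv.refl _⟩⟩
  | succ K ih =>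
    obtain ⟨l, hl₁, hl₂, ⟨e₁⟩⟩ := ih (fun j => p j.succ) (fun j => e j.succ) fun j => hp _
    obtain ⟨l', hl'₁, hl'₂, -, ⟨e₂⟩⟩ := exists_chain_insert K l hl₁ hl₂ (hp 0) (e 0)
    exact ⟨l', hl'₁, hl'₂, ⟨((piFinSuccAddEquiv fun j => ZMod (p j ^ e j)).trans
      ((AddEquiv.refl _).prodCongr e₁)).trans e₂⟩⟩

/-- The invariant factor decomposition of a finite abelian group. -/
theorem exists_invariantFactors (G : Type*) [CommGroup G] [Finite G] :
    ∃ (K : ℕ) (lam : Fin K → ℕ), (∀ j, 1 < lam j) ∧ (∀ j k, j ≤ k → lam j ∣ lam k) ∧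
      Nonempty (G ≃* Multiplicative (∀ j, ZMod (lam j))) := by
  classical
  obtain ⟨ι, _, p, hp, e, ⟨f⟩⟩ := AddCommGroup.equiv_directSum_zmod_of_finite (Additive G)
  set N := Fintype.card ι
  let s : Fin N ≃ ι := (Fintype.equivFin ι).symm
  obtain ⟨l, hl₁, hl₂, ⟨f₁⟩⟩ :=
    exists_chain_of_primePowers N (fun j => p (s j)) (fun j => e (s j)) fun j => hp _
  let f₂ : (∀ i, ZMod (p i ^ e i)) ≃+ ∀ j, ZMod (p (s j) ^ e (s j)) :=
    { (Equiv.piCongrLeft (fun i => ZMod (p i ^ e i)) s).symm with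
      map_add' := fun _ _ => rfl }
  set S : Finset (Fin N) := Finset.univ.filter fun j => 1 < l j with hS
  let t : Fin S.card ≃o S := S.orderIsoOfFin rfl
  let r : Fin S.card ≃ S := Fin.revPerm.trans t.toEquiv
  let f₃ : (∀ j, ZMod (l j)) ≃+ ∀ j : Fin S.card, ZMod (l (t j.rev)) :=
    AddEquiv.ofBijective
      (⟨⟨fun x j => x (t j.rev), rfl⟩, fun _ _ => rfl⟩ :
        (∀ j, ZMod (l j)) →+ ∀ j : Fin S.card, ZMod (l (t j.rev))) <| by
    constructor
    · intro x y hxy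
      funext j
      by_cases h : j ∈ S
      · obtain ⟨k, hk⟩ := r.surjective ⟨j, h⟩
        have hk' : (t k.rev : Fin N) = j := congrArg Subtype.val hk
        subst hk'
        exact congrFun hxy k
      · have h1 : l j = 1 := by
          have : ¬ 1 < l j := by simpa [hS] using h
          have := hl₁ j
          omega
        have : Subsingleton (ZMod (l j)) := by rw [h1]; infer_instance
        exact Subsingleton.elim _ _
    · intro y
      obtain ⟨z, hz⟩ := (Equiv.piCongrLeft (fun k : S => ZMod (l k)) r).symm.surjective y
      obtain ⟨x, hx⟩ := Subtype.surjective_restrict (β := fun j => ZMod (l j)) (· ∈ S) z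
      refine ⟨x, ?_⟩
      rw [← hz, ← hx]
      rfl
  refine ⟨S.card, fun j => l (t j.rev), fun j => ?_, fun j k hjk => hl₂ _ _ ?_, ⟨?_⟩⟩
  · exact (Finset.mem_filter.1 (t j.rev).2).2
  · exact t.monotone (Fin.rev_le_rev.2 hjk)
  · exact (AddEquiv.toMultiplicativeRight
      ((((f.trans (DirectSum.addEquivProd _)).trans f₂).trans f₁).trans f₃))

end InvariantFactors

section Torsion

/-- The number of solutions of `x ^ k = 1`. -/
def torsionCard (G : Type*) [Monoid G] (k : ℕ) : ℕ := Nat.card {x : G // x ^ k = 1}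

lemma torsionCard_congr {G H : Type*} [Monoid G] [Monoid H] (e : G ≃* H) (k : ℕ) :
    torsionCard G k = torsionCard H k :=
  Nat.card_congr (e.toEquiv.subtypeEquiv fun x => by simp [← map_pow])

lemma torsionCard_prod (G H : Type*) [Monoid G] [Monoid H] (k : ℕ) :
    torsionCard (G × H) k = torsionCard G k * torsionCard H k := by
  unfold torsionCard
  rw [← Nat.card_prod]
  refine Nat.card_congr ((Equiv.subtypeEquivRight fun x => ?_).trans
    (Equiv.subtypeProdEquivProd (p := fun x : G => x ^ k = 1) (q := fun x : H => x ^ k = 1)))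
  simp [Prod.ext_iff]

lemma torsionCard_of_isCyclic (G : Type*) [CommGroup G] [IsCyclic G] [Finite G] (k : ℕ) :
    torsionCard G k = (Nat.card G).gcd k := by
  rw [← IsCyclic.card_powMonoidHom_ker]
  rfl

lemma torsionCard_pi_zmod {K : ℕ} (l : Fin K → ℕ) (hl : ∀ j, 0 < l j) (k : ℕ) :
    torsionCard (Multiplicative (∀ j, ZMod (l j))) k = ∏ j, (l j).gcd k := by
  have h : ∀ j, (l j).gcd k = Nat.card {x : ZMod (l j) // k • x = 0} := by
    intro j
    have : NeZero (l j) := ⟨(hl j).ne'⟩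
    rw [← Nat.card_zmod (l j), ← IsAddCyclic.card_nsmulAddMonoidHom_ker, Nat.card_zmod]
    rfl
  simp_rw [h]
  rw [← Nat.card_pi]
  refine Nat.card_congr (Equiv.trans (Equiv.subtypeEquiv Multiplicative.toAdd
    (q := fun x : ∀ j, ZMod (l j) => ∀ j, k • x j = 0) fun x => ?_)
    (Equiv.subtypePiEquivPi (p := fun j (x : ZMod (l j)) => k • x = 0)))
  rw [← toAdd_eq_zero, toAdd_pow]
  exact funext_iff

lemma gcd_pow_succ {p : ℕ} (hp : p.Prime) (a l : ℕ) :
    l.gcd (p ^ (a + 1)) = p ^ (if p ^ (a + 1) ∣ l then 1 else 0) * l.gcd (p ^ a) := by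
  split_ifs with h
  · rw [Nat.gcd_eq_right h, Nat.gcd_eq_right ((pow_dvd_pow p a.le_succ).trans h), pow_one, pow_succ']
  · rw [pow_zero, one_mul]
    obtain ⟨b, hb, hb'⟩ := (Nat.dvd_prime_pow hp).1 (Nat.gcd_dvd_right l (p ^ (a + 1)))
    have hba : b ≤ a := by
      by_contra! hlt
      refine h ?_
      rw [← show b = a + 1 by omega, ← hb']
      exact Nat.gcd_dvd_left _ _
    refine Nat.dvd_antisymm (Nat.dvd_gcd (Nat.gcd_dvd_left _ _) ?_)
      (Nat.gcd_dvd_gcd_of_dvd_right _ (pow_dvd_pow p a.le_succ))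
    rw [hb']
    exact pow_dvd_pow p hba

/-- The number of entries of `l` divisible by `q`. -/
def dvdCount {K : ℕ} (l : Fin K → ℕ) (q : ℕ) : ℕ := (Finset.univ.filter fun j => q ∣ l j).card

lemma dvdCount_anti {K : ℕ} (l : Fin K → ℕ) {q r : ℕ} (h : q ∣ r) :
    dvdCount l r ≤ dvdCount l q :=
  Finset.card_le_card fun j hj => by
    simp only [Finset.mem_filter, Finset.mem_univ, true_and] at hj ⊢
    exact h.trans hj

lemma torsionCard_pi_zmod_pow_succ {K : ℕ} (l : Fin K → ℕ) (hl : ∀ j, 0 < l j) {p : ℕ}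
    (hp : p.Prime) (a : ℕ) :
    torsionCard (Multiplicative (∀ j, ZMod (l j))) (p ^ (a + 1)) =
      p ^ dvdCount l (p ^ (a + 1)) * torsionCard (Multiplicative (∀ j, ZMod (l j))) (p ^ a) := by
  rw [torsionCard_pi_zmod l hl, torsionCard_pi_zmod l hl]
  simp_rw [gcd_pow_succ hp a]
  rw [Finset.prod_mul_distrib, Finset.prod_pow_eq_pow_sum, dvdCount, Finset.card_filter]

lemma torsionCard_pos (G : Type*) [Monoid G] [Finite G] (k : ℕ) : 0 < torsionCard G k := by
  have : Nonempty {x : G // x ^ k = 1} := ⟨⟨1, one_pow k⟩⟩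
  exact Nat.card_pos

lemma torsionCard_one (G : Type*) [Monoid G] : torsionCard G 1 = 1 := by
  simp [torsionCard]

lemma torsionCard_of_coprime (G : Type*) [Group G] [Finite G] {k : ℕ}
    (h : (Nat.card G).Coprime k) : torsionCard G k = 1 := by
  unfold torsionCard
  rw [Nat.card_eq_one_iff_unique]
  refine ⟨⟨fun x y => Subtype.ext ?_⟩, ⟨⟨1, one_pow k⟩⟩⟩
  have key : ∀ x : G, x ^ k = 1 → x = 1 := fun x hx => by
    have h₁ := orderOf_dvd_of_pow_eq_one hx
    have h₂ := orderOf_dvd_natCard x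
    exact orderOf_eq_one_iff.1 (Nat.eq_one_of_dvd_coprimes h h₂ h₁)
  rw [key _ x.2, key _ y.2]

lemma torsionCard_units_two_pow_le (v : ℕ) : torsionCard (ZMod (2 ^ v))ˣ 2 ≤ 4 := by
  rcases Nat.lt_or_ge v 2 with hv | hv
  · calc torsionCard (ZMod (2 ^ v))ˣ 2 ≤ Nat.card (ZMod (2 ^ v)) :=
          Nat.card_le_card_of_injective (fun x => ((x : (ZMod (2 ^ v))ˣ) : ZMod (2 ^ v)))
            (Units.val_injective.comp Subtype.val_injective)
      _ = 2 ^ v := Nat.card_zmod _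
      _ ≤ 2 ^ 2 := Nat.pow_le_pow_right two_pos hv.le
  obtain ⟨w, rfl⟩ := Nat.exists_eq_add_of_le' hv
  set N := 2 ^ w with hN
  have hN0 : 0 < N := pow_pos two_pos w
  have hNv : 2 ^ (w + 2) = 4 * N := by rw [hN, pow_add]; ring
  have hodd : ∀ x : (ZMod (2 ^ (w + 2)))ˣ, (x : ZMod (2 ^ (w + 2))).val % 2 = 1 := by
    intro x
    have h := ZMod.val_coe_unit_coprime x
    exact Nat.odd_iff.1 ((Nat.coprime_two_right).1
      (h.coprime_dvd_right (dvd_pow_self 2 (by omega))))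
  have hmem : ∀ x : (ZMod (2 ^ (w + 2)))ˣ, x ^ 2 = 1 →
      (x : ZMod (2 ^ (w + 2))).val / 2 ∈ ({0, N, N - 1, 2 * N - 1} : Finset ℕ) := by
    intro x hx
    have hlt := ZMod.val_lt (x : ZMod (2 ^ (w + 2)))
    have ho := hodd x
    set y := (x : ZMod (2 ^ (w + 2))).val with hy
    obtain ⟨a, ha⟩ : ∃ a, y = 2 * a + 1 := ⟨y / 2, by omega⟩
    have hd : 4 * N ∣ 4 * (a * (a + 1)) := by
      rw [← hNv, ← CharP.cast_eq_zero_iff (ZMod (2 ^ (w + 2)))]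
      have h1 : ((x : ZMod (2 ^ (w + 2)))) ^ 2 = 1 := by
        rw [← Units.val_pow_eq_pow_val, hx, Units.val_one]
      have h2 : ((2 * a + 1 : ℕ) : ZMod (2 ^ (w + 2))) = x := by
        rw [← ha, hy, ZMod.natCast_zmod_val]
      rw [← h2] at h1
      push_cast at h1 ⊢
      linear_combination h1
    have hd' : 2 ^ w ∣ a * (a + 1) := Nat.dvd_of_mul_dvd_mul_left (by norm_num) hd
    have ha2 : y / 2 = a := by omega
    rw [ha2]
    have hor : N ∣ a ∨ N ∣ a + 1 := by
      by_cases h2 : 2 ∣ a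
      · exact Or.inl (Nat.prime_two.prime.pow_dvd_of_dvd_mul_right w (by omega) hd')
      · exact Or.inr (Nat.prime_two.prime.pow_dvd_of_dvd_mul_left w h2 hd')
    have haN : a < 2 * N := by omega
    simp only [Finset.mem_insert, Finset.mem_singleton]
    rcases hor with ⟨c, hc⟩ | ⟨c, hc⟩
    · have : c < 2 := by nlinarith
      interval_cases c <;> omega
    · have : c < 3 := by nlinarith
      interval_cases c <;> omega
  calc torsionCard (ZMod (2 ^ (w + 2)))ˣ 2
      ≤ Nat.card ({0, N, N - 1, 2 * N - 1} : Finset ℕ) :=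
        Nat.card_le_card_of_injective
          (fun x => ⟨((x : (ZMod (2 ^ (w + 2)))ˣ) : ZMod (2 ^ (w + 2))).val / 2, hmem x x.2⟩) <| by
        intro x y hxy
        have h := congrArg Subtype.val hxy
        simp only at h
        have h₁ := hodd x
        have h₂ := hodd y
        refine Subtype.ext (Units.ext (ZMod.val_injective _ ?_))
        omega
    _ ≤ 4 := by
        rw [Nat.card_eq_fintype_card, Fintype.card_coe]
        exact Finset.card_le_four

lemma omegaQ_mul {a b : ℕ} (h : a.Coprime b) (q : ℕ) :
    omegaQ (a * b) q = omegaQ a q + omegaQ b q := by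
  unfold omegaQ
  rw [h.primeFactors_mul, Finset.filter_union, Finset.card_union_of_disjoint]
  exact Finset.disjoint_filter_filter h.disjoint_primeFactors

lemma omegaQ_prime_pow {l v q : ℕ} (hl : l.Prime) (hv : v ≠ 0) :
    omegaQ (l ^ v) q = if l % q = 1 % q then 1 else 0 := by
  unfold omegaQ
  rw [Nat.primeFactors_prime_pow hv hl, Finset.filter_singleton]
  split_ifs <;> simp

/-- The step from `p ^ a`-torsion to `p ^ (a + 1)`-torsion in `(ZMod m)ˣ` is governed by
`omegaQ m (p ^ (a + 1))`, up to a bounded exponent. -/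
lemma exists_torsionCard_units {p : ℕ} (hp : p.Prime) (a m : ℕ) (hm : m ≠ 0) :
    ∃ c ≤ (if p ∣ m then 2 else 0), torsionCard (ZMod m)ˣ (p ^ (a + 1)) =
      p ^ (omegaQ m (p ^ (a + 1)) + c) * torsionCard (ZMod m)ˣ (p ^ a) := by
  have hq1 : 1 < p ^ (a + 1) := Nat.one_lt_pow (by omega) hp.one_lt
  induction m using Nat.recOnPosPrimePosCoprime with
  | zero => exact absurd rfl hm
  | one =>
    refine ⟨0, Nat.zero_le _, ?_⟩
    rw [torsionCard_of_coprime _ (by simp), torsionCard_of_coprime _ (by simp)]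
    simp [omegaQ]
  | coprime x y hx hy hxy ihx ihy =>
    obtain ⟨c, hc, ihx⟩ := ihx (by omega)
    obtain ⟨d, hd, ihy⟩ := ihy (by omega)
    refine ⟨c + d, ?_, ?_⟩
    · have hnot : ¬ (p ∣ x ∧ p ∣ y) := fun h => Nat.not_coprime_of_dvd_of_dvd hp.one_lt h.1 h.2 hxy
      simp only [hp.dvd_mul]
      split_ifs at hc hd ⊢ <;> omega
    · have e : (ZMod (x * y))ˣ ≃* (ZMod x)ˣ × (ZMod y)ˣ :=
        (Units.mapEquiv (ZMod.chineseRemainder hxy).toMulEquiv).trans MulEquiv.prodUnits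
      rw [torsionCard_congr e, torsionCard_congr e, torsionCard_prod, torsionCard_prod, ihx, ihy,
        omegaQ_mul hxy]
      ring
  | prime_pow l v hl hv =>
    have : NeZero (l ^ v) := ⟨hm⟩
    have hcard : Nat.card (ZMod (l ^ v))ˣ = l ^ (v - 1) * (l - 1) := by
      rw [Nat.card_eq_fintype_card, ZMod.card_units_eq_totient, Nat.totient_prime_pow hl hv]
    rw [omegaQ_prime_pow hl hv.ne', Nat.mod_eq_of_lt hq1]
    by_cases hl2 : l = 2
    · subst hl2
      by_cases hp2 : p = 2
      · subst hp2
        have hne : ¬ 2 % 2 ^ (a + 1) = 1 := by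
          rcases a with _ | a
          · norm_num
          · rw [Nat.mod_eq_of_lt]
            · norm_num
            · calc 2 < 2 ^ 2 := by norm_num
                _ ≤ 2 ^ (a + 1 + 1) := Nat.pow_le_pow_right two_pos (by omega)
        rw [if_neg hne, if_pos (dvd_pow_self 2 hv.ne')]
        obtain ⟨K, lam, hlam, -, ⟨e⟩⟩ := exists_invariantFactors (ZMod (2 ^ v))ˣ
        have hlam' : ∀ j, 0 < lam j := fun j => zero_lt_one.trans (hlam j)
        refine ⟨dvdCount lam (2 ^ (a + 1)), ?_, ?_⟩
        · refine (dvdCount_anti lam (dvd_pow_self 2 a.succ_ne_zero)).trans ?_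
          have h := torsionCard_pi_zmod_pow_succ lam hlam' Nat.prime_two 0
          rw [pow_zero, torsionCard_one, zero_add, pow_one, ← torsionCard_congr e, mul_one] at h
          have h4 := torsionCard_units_two_pow_le v
          rw [h] at h4
          exact (Nat.pow_le_pow_iff_right one_lt_two).1 (h4.trans_eq (by norm_num : 4 = 2 ^ 2))
        · rw [torsionCard_congr e, torsionCard_congr e, zero_add]
          exact torsionCard_pi_zmod_pow_succ lam hlam' Nat.prime_two a
      · have hcop : ∀ b, (Nat.card (ZMod (2 ^ v))ˣ).Coprime (p ^ b) := fun b => by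
          rw [hcard, Nat.add_one_sub_one, mul_one]
          exact Nat.Coprime.pow _ _ ((Nat.coprime_primes Nat.prime_two hp).2 (Ne.symm hp2))
        have h3 : 3 ≤ p ^ (a + 1) := by
          have := hp.two_le
          calc 3 ≤ p := by omega
            _ ≤ p ^ (a + 1) := Nat.le_self_pow (by omega) p
        refine ⟨0, Nat.zero_le _, ?_⟩
        rw [torsionCard_of_coprime _ (hcop _), torsionCard_of_coprime _ (hcop _),
          Nat.mod_eq_of_lt h3]
        simp
    · have := ZMod.isCyclic_units_of_prime_pow l hl hl2 v
      rw [torsionCard_of_isCyclic, torsionCard_of_isCyclic, gcd_pow_succ hp, hcard]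
      have hmod : l % p ^ (a + 1) = 1 ↔ p ^ (a + 1) ∣ l - 1 := by
        rw [← Nat.modEq_iff_dvd' hl.one_le, Nat.ModEq, Nat.mod_eq_of_lt hq1, eq_comm]
      by_cases hpl : p = l
      · subst hpl
        refine ⟨if p ^ (a + 1) ∣ p ^ (v - 1) * (p - 1) then 1 else 0, ?_, ?_⟩
        · rw [if_pos (dvd_pow_self p hv.ne')]
          split_ifs <;> omega
        · rw [if_neg (c := p % p ^ (a + 1) = 1), zero_add]
          rw [hmod]
          intro h
          have h1 := Nat.le_of_dvd (by have := hp.two_le; omega)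
            ((dvd_pow_self p a.succ_ne_zero).trans h)
          have := hp.two_le
          omega
      · refine ⟨0, Nat.zero_le _, ?_⟩
        have hcop : (p ^ (a + 1)).Coprime (l ^ (v - 1)) :=
          Nat.Coprime.pow _ _ ((Nat.coprime_primes hp hl).2 hpl)
        simp only [hcop.dvd_mul_left, hmod, add_zero]

/-- The number of invariant factors divisible by a prime power `q` is `omegaQ m q`, up to a
bounded error. -/
lemma omegaQ_le_dvdCount_le {m : ℕ} (hm : m ≠ 0) {K : ℕ} (lam : Fin K → ℕ) (hlam : ∀ j, 0 < lam j)
    (e : (ZMod m)ˣ ≃* Multiplicative (∀ j, ZMod (lam j))) {q : ℕ} (hq : IsPrimePow q) :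
    omegaQ m q ≤ dvdCount lam q ∧ dvdCount lam q ≤ omegaQ m q + 2 := by
  obtain ⟨p, k, hp, hk, rfl⟩ := (isPrimePow_nat_iff _).1 hq
  obtain ⟨a, rfl⟩ : ∃ a, k = a + 1 := ⟨k - 1, by omega⟩
  have : NeZero m := ⟨hm⟩
  obtain ⟨c, hc, h⟩ := exists_torsionCard_units hp a m hm
  have h' := torsionCard_pi_zmod_pow_succ lam hlam hp a
  rw [← torsionCard_congr e, ← torsionCard_congr e, h] at h'
  have h'' := Nat.pow_right_injective hp.two_le
    (Nat.eq_of_mul_eq_mul_right (torsionCard_pos _ _) h')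
  split_ifs at hc <;> omega

end Torsion

section InvariantFactorCount

/-- `d` is the least common multiple of the prime powers of totient at most `φ(a)`; `a` is the
only prime power of its totient, and `b`, `c` are those of the next totient. -/
structure IsTotientGap (a b c d : ℕ) : Prop where
  isPrimePow_a : IsPrimePow a
  isPrimePow_b : IsPrimePow b
  isPrimePow_c : IsPrimePow c
  totient_lt : a.totient < b.totient
  totient_eq : c.totient = b.totient
  lt : b < c
  eq_or_lt : ∀ q, IsPrimePow q → q.totient ≤ a.totient → q = a ∨ q.totient < a.totient
  eq_or_eq_or_lt : ∀ q, IsPrimePow q → a.totient < q.totient →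
    q = b ∨ q = c ∨ b.totient < q.totient
  ne_zero : d ≠ 0
  dvd_iff : ∀ q, IsPrimePow q → (q ∣ d ↔ q.totient ≤ a.totient)

lemma dvd_of_dvdCount_le {K : ℕ} {l : Fin K → ℕ} (hl : ∀ j k, j ≤ k → l j ∣ l k) {q r : ℕ}
    (h : dvdCount l r ≤ dvdCount l q) {j : Fin K} (hj : r ∣ l j) : q ∣ l j := by
  by_contra hq
  refine h.not_gt (Finset.card_lt_card ⟨fun k hk => ?_, fun hsub => hq ?_⟩)
  · simp only [Finset.mem_filter, Finset.mem_univ, true_and] at hk ⊢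
    rcases le_total j k with hjk | hjk
    · exact hj.trans (hl j k hjk)
    · exact absurd (hk.trans (hl k j hjk)) hq
  · have := hsub (Finset.mem_filter.2 ⟨Finset.mem_univ j, hj⟩)
    exact (Finset.mem_filter.1 this).2

lemma card_eq_sub_max {a b c d : ℕ} (hg : IsTotientGap a b c d) {K : ℕ} {l : Fin K → ℕ}
    (hl : ∀ j k, j ≤ k → l j ∣ l k)
    (h₁ : ∀ q, IsPrimePow q → q.totient < a.totient → dvdCount l a ≤ dvdCount l q)
    (hb : dvdCount l b ≤ dvdCount l a) (hc : dvdCount l c ≤ dvdCount l a)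
    (h₃ : ∀ q, IsPrimePow q → b.totient < q.totient → dvdCount l q ≤ dvdCount l b) :
    ((Finset.univ.filter fun j => l j = d).card : ℝ) =
      dvdCount l a - max (dvdCount l b : ℝ) (dvdCount l c) := by
  have key : ∀ j, l j = d ↔ a ∣ l j ∧ ¬ b ∣ l j ∧ ¬ c ∣ l j := by
    intro j
    constructor
    · rintro h
      rw [h, hg.dvd_iff a hg.isPrimePow_a, hg.dvd_iff b hg.isPrimePow_b,
        hg.dvd_iff c hg.isPrimePow_c, hg.totient_eq]
      have := hg.totient_lt
      omega
    · rintro ⟨ha, hb', hc'⟩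
      have hiff : ∀ q, IsPrimePow q → (q ∣ l j ↔ q ∣ d) := by
        intro q hq
        rw [hg.dvd_iff q hq]
        constructor
        · intro hqj
          by_contra! hlt
          rcases hg.eq_or_eq_or_lt q hq hlt with rfl | rfl | hlt'
          · exact hb' hqj
          · exact hc' hqj
          · exact hb' (dvd_of_dvdCount_le hl (h₃ q hq hlt') hqj)
        · intro hle
          rcases hg.eq_or_lt q hq hle with rfl | hlt
          · exact ha
          · exact dvd_of_dvdCount_le hl (h₁ q hq hlt) ha
      refine Nat.dvd_antisymm ?_ ?_
      · refine (Nat.dvd_iff_prime_pow_dvd_dvd _ _).2 fun p k hp hk => ?_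
        rcases k.eq_zero_or_pos with rfl | hk0
        · simp
        · exact (hiff _ (hp.isPrimePow.pow hk0.ne')).1 hk
      · refine (Nat.dvd_iff_prime_pow_dvd_dvd _ _).2 fun p k hp hk => ?_
        rcases k.eq_zero_or_pos with rfl | hk0
        · simp
        · exact (hiff _ (hp.isPrimePow.pow hk0.ne')).2 hk
  have step : ∀ r, dvdCount l r ≤ dvdCount l a → (∀ j, b ∣ l j ∨ c ∣ l j ↔ r ∣ l j) →
      ((Finset.univ.filter fun j => l j = d).card : ℝ) = dvdCount l a - dvdCount l r := by
    intro r hr hj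
    have hsplit : (Finset.univ.filter fun j => l j = d) =
        (Finset.univ.filter fun j => a ∣ l j) \ (Finset.univ.filter fun j => r ∣ l j) := by
      ext j
      simp only [Finset.mem_sdiff, Finset.mem_filter, Finset.mem_univ, true_and, key, ← hj]
      tauto
    have hsub : (Finset.univ.filter fun j => r ∣ l j) ⊆ Finset.univ.filter fun j => a ∣ l j := by
      intro j
      simp only [Finset.mem_filter, Finset.mem_univ, true_and]
      exact dvd_of_dvdCount_le hl hr
    rw [hsplit, Finset.card_sdiff_of_subset hsub, Nat.cast_sub (Finset.card_le_card hsub)]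
    rfl
  rcases le_total (dvdCount l b) (dvdCount l c) with h | h
  · rw [max_eq_right (by exact_mod_cast h)]
    exact step c hc fun j => ⟨fun hj => hj.elim (dvd_of_dvdCount_le hl h) id, Or.inr⟩
  · rw [max_eq_left (by exact_mod_cast h)]
    exact step b hb fun j => ⟨fun hj => hj.elim id (dvd_of_dvdCount_le hl h), Or.inl⟩

lemma le_two_mul_totient {q : ℕ} (hq : IsPrimePow q) : q ≤ 2 * q.totient := by
  obtain ⟨p, k, hp, hk, rfl⟩ := (isPrimePow_nat_iff _).1 hq
  obtain ⟨a, rfl⟩ : ∃ a, k = a + 1 := ⟨k - 1, by omega⟩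
  rw [Nat.totient_prime_pow_succ hp, pow_succ]
  have := hp.two_le
  calc p ^ a * p ≤ p ^ a * (2 * (p - 1)) := Nat.mul_le_mul_left _ (by omega)
    _ = 2 * (p ^ a * (p - 1)) := by ring

/-- A prime power of totient exceeding `N` whose base is at most `Q` is divisible by such a prime
power of bounded size. -/
lemma exists_dvd_le_of_totient_lt {p k N Q : ℕ} (hp : p.Prime) (hpQ : p ≤ Q) (hN : 1 ≤ N)
    (h : N < (p ^ k).totient) :
    ∃ q, IsPrimePow q ∧ q ∣ p ^ k ∧ N < q.totient ∧ q ≤ 2 * Q * N := by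
  classical
  have hex : ∃ k, N < (p ^ k).totient := ⟨k, h⟩
  have hspec := Nat.find_spec hex
  have hmin : ∀ b < Nat.find hex, (p ^ b).totient ≤ N := fun b hb => not_lt.1 (Nat.find_min hex hb)
  have hle : Nat.find hex ≤ k := Nat.find_min' hex h
  set b := Nat.find hex
  have hb : b ≠ 0 := by
    intro hb
    rw [hb, pow_zero, Nat.totient_one] at hspec
    omega
  refine ⟨p ^ b, hp.isPrimePow.pow hb, pow_dvd_pow p hle, hspec, ?_⟩
  obtain ⟨e, he⟩ : ∃ e, b = e + 1 := ⟨b - 1, by omega⟩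
  have hpe : p ^ e ≤ 2 * N := by
    rcases e.eq_zero_or_pos with rfl | he0
    · rw [pow_zero]; omega
    · exact (le_two_mul_totient (hp.isPrimePow.pow he0.ne')).trans
        (Nat.mul_le_mul_left 2 (hmin e (by omega)))
  rw [he, pow_succ]
  calc p ^ e * p ≤ 2 * N * Q := Nat.mul_le_mul hpe hpQ
    _ = 2 * Q * N := by ring

lemma one_div_sub_one_div_ge {x y N : ℕ} (hx : 0 < x) (hxy : x < y) (hxN : x < N) :
    1 / (N : ℝ) ^ 2 ≤ 1 / x - 1 / y := by
  have hx' : (0 : ℝ) < x := by exact_mod_cast hx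
  have h1 : (x : ℝ) + 1 ≤ y := by exact_mod_cast hxy
  have h2 : (x : ℝ) + 1 ≤ N := by exact_mod_cast hxN
  calc 1 / (N : ℝ) ^ 2 ≤ 1 / (x * (x + 1)) := by
        apply one_div_le_one_div_of_le (by positivity)
        nlinarith
    _ = 1 / x - 1 / (x + 1) := by field_simp; ring
    _ ≤ 1 / x - 1 / y := by gcongr

lemma abs_invCount_sub_le {a b c d : ℕ} (hg : IsTotientGap a b c d) {J : ℕ → ℕ}
    (hJ : IsInvCount d J) {m Q : ℕ} (hm : 1 ≤ m) {L ε : ℝ}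
    (hε : ε = 1 / (4 * ((b.totient + 1 : ℕ) : ℝ) ^ 2)) (hL : 2 ≤ 2 * ε * L)
    (hsmall : ∀ q ∈ (Finset.Icc 1 (2 * (Q + 1) * b.totient)),
      |(omegaQ m q : ℝ) - L / q.totient| < ε * L)
    (hlarge : ∀ q, q.Prime → Q < q → (omegaQ m q : ℝ) < ε * L) :
    |(J m : ℝ) - (omegaQ m a - max (omegaQ m b : ℝ) (omegaQ m c))| ≤ 2 := by
  have : NeZero m := ⟨by omega⟩
  obtain ⟨K, l, hl₀, hl, ⟨e⟩⟩ := exists_invariantFactors (ZMod m)ˣ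
  rw [hJ m hm K l hl₀ hl ⟨e⟩]
  set N := b.totient + 1 with hN
  have hε0 : 0 < ε := by rw [hε]; positivity
  have h4 : 1 / (N : ℝ) ^ 2 = 4 * ε := by rw [hε]; field_simp
  have hL0 : 0 < L := by
    by_contra! h
    nlinarith
  have hcount : ∀ q, IsPrimePow q → omegaQ m q ≤ dvdCount l q ∧ dvdCount l q ≤ omegaQ m q + 2 :=
    fun q hq => omegaQ_le_dvdCount_le (by omega) l (fun j => zero_lt_one.trans (hl₀ j)) e hq
  have hpos : ∀ q, IsPrimePow q → 0 < Nat.totient q := fun q hq => Nat.totient_pos.2 hq.pos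
  have hbpos := hpos b hg.isPrimePow_b
  have hab := hg.totient_lt
  -- prime powers of small totient are controlled
  have hmem : ∀ q, IsPrimePow q → q.totient ≤ b.totient →
      |(omegaQ m q : ℝ) - L / q.totient| < ε * L := by
    intro q hq hqb
    refine hsmall q (Finset.mem_Icc.2 ⟨hq.pos, ?_⟩)
    have := le_two_mul_totient hq
    nlinarith
  have hcompare : ∀ q r, IsPrimePow q → IsPrimePow r → q.totient < r.totient →
      q.totient ≤ b.totient → |(omegaQ m q : ℝ) - L / q.totient| < ε * L →
      |(omegaQ m r : ℝ) - L / r.totient| < ε * L → dvdCount l r ≤ dvdCount l q := by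
    intro q r hq hr hqr hqb h1 h2
    have hgap := one_div_sub_one_div_ge (hpos q hq) hqr (show q.totient < N by omega)
    rw [h4] at hgap
    have h3 : 4 * ε * L ≤ L / q.totient - L / r.totient := by
      calc 4 * ε * L ≤ (1 / (q.totient : ℝ) - 1 / r.totient) * L := by gcongr
        _ = _ := by ring
    rw [abs_lt] at h1 h2
    have h5 : ((omegaQ m r + 2 : ℕ) : ℝ) ≤ omegaQ m q := by
      push_cast
      linarith [h1.1, h2.2]
    exact ((hcount r hr).2.trans (by exact_mod_cast h5)).trans (hcount q hq).1
  have hca : a.totient < c.totient := hg.totient_eq ▸ hab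
  have ha := hmem a hg.isPrimePow_a hab.le
  have hb := hmem b hg.isPrimePow_b le_rfl
  have hc := hmem c hg.isPrimePow_c hg.totient_eq.le
  rw [card_eq_sub_max hg hl
    (fun q hq hqa => hcompare q a hq hg.isPrimePow_a hqa (hqa.le.trans hab.le)
      (hmem q hq (hqa.le.trans hab.le)) ha)
    (hcompare a b hg.isPrimePow_a hg.isPrimePow_b hab hab.le ha hb)
    (hcompare a c hg.isPrimePow_a hg.isPrimePow_c hca hab.le ha hc)]
  · have h1 : ∀ q, IsPrimePow q → (omegaQ m q : ℝ) ≤ dvdCount l q ∧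
        (dvdCount l q : ℝ) ≤ omegaQ m q + 2 := fun q hq => by exact_mod_cast hcount q hq
    obtain ⟨ha1, ha2⟩ := h1 a hg.isPrimePow_a
    obtain ⟨hb1, hb2⟩ := h1 b hg.isPrimePow_b
    obtain ⟨hc1, hc2⟩ := h1 c hg.isPrimePow_c
    have hm1 : max (omegaQ m b : ℝ) (omegaQ m c) ≤ max (dvdCount l b : ℝ) (dvdCount l c) :=
      max_le_max hb1 hc1
    have hm2 : max (dvdCount l b : ℝ) (dvdCount l c) ≤ max (omegaQ m b : ℝ) (omegaQ m c) + 2 := by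
      rw [max_add]
      exact max_le_max hb2 hc2
    rw [abs_le]
    constructor <;> linarith
  · intro q hq hqb
    obtain ⟨p, k, hp, hk, rfl⟩ := (isPrimePow_nat_iff _).1 hq
    by_cases hpQ : p ≤ Q
    · obtain ⟨r, hr, hrq, hbr, hrle⟩ := exists_dvd_le_of_totient_lt hp hpQ hbpos hqb
      refine (dvdCount_anti l hrq).trans (hcompare b r hg.isPrimePow_b hr hbr le_rfl hb ?_)
      exact hsmall r (Finset.mem_Icc.2 ⟨hr.pos, hrle.trans (by gcongr; omega)⟩)
    · have h1 := hlarge p hp (not_le.1 hpQ)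
      have hgap : 4 * ε ≤ 1 / (b.totient : ℝ) := by
        rw [← h4]
        have : (1 : ℝ) ≤ b.totient := by exact_mod_cast hbpos
        have h5 : (N : ℝ) = b.totient + 1 := by rw [hN]; push_cast; ring
        apply one_div_le_one_div_of_le (by positivity)
        rw [h5]
        nlinarith
      have h3 : 4 * ε * L ≤ L / b.totient := by
        calc 4 * ε * L ≤ (1 / (b.totient : ℝ)) * L := by gcongr
          _ = _ := by ring
      rw [abs_lt] at hb
      have h5 : ((omegaQ m p + 2 : ℕ) : ℝ) ≤ omegaQ m b := by
        push_cast
        linarith [hb.1]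
      exact (dvdCount_anti l (dvd_pow_self p hk.ne')).trans (((hcount p hp.isPrimePow).2.trans
        (by exact_mod_cast h5)).trans (hcount b hg.isPrimePow_b).1)

/-- Outside a set of density zero, the invariant factor count is determined by three values of
`omegaQ`, up to a bounded error. -/
theorem negligible_invCount_sub {a b c d : ℕ} (hg : IsTotientGap a b c d) {J : ℕ → ℕ}
    (hJ : IsInvCount d J) : Negligible fun _ m =>
      2 < |(J m : ℝ) - (omegaQ m a - max (omegaQ m b : ℝ) (omegaQ m c))| := by
  set ε : ℝ := 1 / (4 * ((b.totient + 1 : ℕ) : ℝ) ^ 2) with hε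
  have hε0 : 0 < ε := by positivity
  rw [Negligible, Metric.tendsto_atTop']
  intro δ hδ
  obtain ⟨Q, hQ⟩ := exists_dens_omegaQ_ge_le hε0 (half_pos hδ)
  have hsmall : Negligible fun n m => ∃ q ∈ Finset.Icc 1 (2 * (Q + 1) * b.totient),
      ε * LL n ≤ |(omegaQ m q : ℝ) - LL n / q.totient| := by
    refine Negligible.exists_mem _ fun q hq => ?_
    have : NeZero q := ⟨by have := (Finset.mem_Icc.1 hq).1; omega⟩
    exact negligible_omegaQ_sub q hε0
  have hlt := (tendsto_order.1 hsmall).2 (δ / 2) (half_pos hδ)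
  have hLL := tendsto_LL.eventually_ge_atTop (1 / ε)
  obtain ⟨n₀, hn₀⟩ := eventually_atTop.1 (hQ.and (hlt.and hLL))
  refine ⟨n₀, fun n hn => ?_⟩
  obtain ⟨h1, h2, h3⟩ := hn₀ n hn.le
  rw [Real.dist_eq, sub_zero, abs_of_nonneg (dens_nonneg _ _)]
  refine (dens_mono (Q := fun m => (∃ q, q.Prime ∧ Q < q ∧ ε * LL n ≤ omegaQ m q) ∨
    ∃ q ∈ Finset.Icc 1 (2 * (Q + 1) * b.totient),
      ε * LL n ≤ |(omegaQ m q : ℝ) - LL n / q.totient|) fun m hm _ hbad => ?_).trans_lt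
    ((dens_or_le _ _ n).trans_lt ((add_lt_add_of_le_of_lt h1 h2).trans_eq (add_halves δ)))
  by_contra hcon
  push Not at hcon
  refine hbad.not_ge (abs_invCount_sub_le hg hJ hm hε ?_ hcon.2 hcon.1)
  rw [div_le_iff₀' hε0] at h3
  linarith

end InvariantFactorCount

section TotientGap

lemma prime_of_totient_eq_of_lt {q r : ℕ} (hq : IsPrimePow q) (hr : IsPrimePow r)
    (h : q.totient = r.totient) (hlt : q < r) : q.Prime := by
  obtain ⟨p, k, hp, hk, rfl⟩ := (isPrimePow_nat_iff _).1 hq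
  obtain ⟨a, rfl⟩ : ∃ a, k = a + 1 := ⟨k - 1, by omega⟩
  obtain ⟨s, l, hs, hl, rfl⟩ := (isPrimePow_nat_iff _).1 hr
  obtain ⟨b, rfl⟩ : ∃ b, l = b + 1 := ⟨l - 1, by omega⟩
  have htot := h
  rw [Nat.totient_prime_pow_succ hp, Nat.totient_prime_pow_succ hs] at h
  have hp2 := hp.two_le
  have hs2 := hs.two_le
  rcases a.eq_zero_or_pos with rfl | ha
  · simpa using hp
  exfalso
  have hps : p ≠ s := by
    rintro rfl
    have := Nat.eq_of_mul_eq_mul_right (by omega) h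
    rw [pow_succ, pow_succ, this] at hlt
    exact lt_irrefl _ hlt
  have h1 : p ∣ s - 1 := by
    have hd : p ∣ s ^ b * (s - 1) := h ▸ (dvd_pow_self p ha.ne').mul_right _
    refine (hp.dvd_mul.1 hd).resolve_left fun hd' => hps ?_
    exact (Nat.prime_dvd_prime_iff_eq hp hs).1 (hp.dvd_of_dvd_pow hd')
  have h1' := Nat.le_of_dvd (by omega) h1
  rcases b.eq_zero_or_pos with rfl | hb
  · have h2 := Nat.totient_lt (p ^ (a + 1)) hq.one_lt
    rw [htot, zero_add, pow_one, Nat.totient_prime hs] at h2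
    rw [zero_add, pow_one] at hlt
    omega
  · have hd : s ∣ p ^ a * (p - 1) := h ▸ (dvd_pow_self s hb.ne').mul_right _
    rcases hs.dvd_mul.1 hd with hd' | hd'
    · exact hps ((Nat.prime_dvd_prime_iff_eq hs hp).1 (hs.dvd_of_dvd_pow hd')).symm
    · have := Nat.le_of_dvd (by omega) hd'
      omega

namespace IsTotientGap

variable {a b c d : ℕ}

lemma prime_b (hg : IsTotientGap a b c d) : b.Prime :=
  prime_of_totient_eq_of_lt hg.isPrimePow_b hg.isPrimePow_c hg.totient_eq.symm hg.lt

lemma coprime_b_of_totient_le (hg : IsTotientGap a b c d) {q : ℕ}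
    (hq : IsPrimePow q) (hle : q.totient ≤ b.totient) (hne : q ≠ b) : q.Coprime b := by
  obtain ⟨p, k, hp, hk, rfl⟩ := (isPrimePow_nat_iff _).1 hq
  have hb := hg.prime_b
  refine Nat.Coprime.pow_left k ((Nat.coprime_primes hp hb).2 ?_)
  rintro rfl
  obtain ⟨e, rfl⟩ : ∃ e, k = e + 1 := ⟨k - 1, by omega⟩
  rw [Nat.totient_prime_pow_succ hp, Nat.totient_prime hp] at hle
  have hp2 := hp.two_le
  rcases e.eq_zero_or_pos with rfl | he
  · simp at hne
  · have h2 : 2 ≤ p ^ e := hp2.trans (Nat.le_self_pow he.ne' p)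
    have : 2 * (p - 1) ≤ p ^ e * (p - 1) := Nat.mul_le_mul_right _ h2
    omega

lemma coprime_ab (hg : IsTotientGap a b c d) : a.Coprime b :=
  hg.coprime_b_of_totient_le hg.isPrimePow_a hg.totient_lt.le fun h =>
    hg.totient_lt.ne (congrArg Nat.totient h)

lemma coprime_bc (hg : IsTotientGap a b c d) : b.Coprime c :=
  (hg.coprime_b_of_totient_le hg.isPrimePow_c hg.totient_eq.le hg.lt.ne').symm

lemma eq_two_or_coprime_ac (hg : IsTotientGap a b c d) : a = 2 ∧ a ∣ c ∨ a.Coprime c := by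
  obtain ⟨p, k, hp, hk, rfl⟩ := (isPrimePow_nat_iff _).1 hg.isPrimePow_a
  obtain ⟨s, l, hs, hl, rfl⟩ := (isPrimePow_nat_iff _).1 hg.isPrimePow_c
  by_cases hps : p = s
  swap
  · exact Or.inr (Nat.Coprime.pow _ _ ((Nat.coprime_primes hp hs).2 hps))
  subst hps
  left
  have hlt : (p ^ k).totient < (p ^ l).totient := hg.totient_eq ▸ hg.totient_lt
  have hkl : k < l := by
    by_contra! h
    exact hlt.not_ge (Nat.le_of_dvd (Nat.totient_pos.2 (pow_pos hp.pos k))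
      (Nat.totient_dvd_of_dvd (pow_dvd_pow p h)))
  have hp2 := hp.two_le
  obtain ⟨e, rfl⟩ : ∃ e, k = e + 1 := ⟨k - 1, by omega⟩
  have hl : l = e + 2 := by
    by_contra hne
    have h1 : (p ^ (e + 1)).totient < (p ^ (e + 2)).totient := by
      rw [Nat.totient_prime_pow_succ hp, Nat.totient_prime_pow_succ hp]
      exact Nat.mul_lt_mul_of_pos_right (Nat.pow_lt_pow_right hp.one_lt e.lt_succ_self) (by omega)
    have h2 : (p ^ (e + 2)).totient < (p ^ l).totient := by
      obtain ⟨f, rfl⟩ : ∃ f, l = f + 1 := ⟨l - 1, by omega⟩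
      rw [Nat.totient_prime_pow_succ hp, Nat.totient_prime_pow_succ hp]
      exact Nat.mul_lt_mul_of_pos_right (Nat.pow_lt_pow_right hp.one_lt (by omega)) (by omega)
    rcases hg.eq_or_eq_or_lt (p ^ (e + 2)) (hp.isPrimePow.pow (by omega)) h1 with h | h | h
    · rw [hg.totient_eq, ← h] at h2
      exact lt_irrefl _ h2
    · rw [h] at h2
      exact lt_irrefl _ h2
    · rw [← hg.totient_eq] at h
      exact lt_asymm h h2
  subst hl
  refine ⟨?_, pow_dvd_pow p (by omega)⟩
  have ha : (p ^ (e + 1)).totient = p ^ e * (p - 1) := Nat.totient_prime_pow_succ hp e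
  have hb : b.totient = p * (p ^ e * (p - 1)) := by
    rw [← hg.totient_eq, Nat.totient_prime_pow_succ hp, pow_succ]
    ring
  set N := p ^ e * (p - 1) with hN
  have hN0 : 0 < N := Nat.mul_pos (pow_pos hp.pos e) (by omega)
  rcases hp2.eq_or_lt with rfl | hp3
  · obtain ⟨r, hr, hr1, hr2⟩ := Nat.exists_prime_lt_and_le_two_mul N hN0.ne'
    have hrt := Nat.totient_prime hr
    rcases lt_or_ge (2 ^ (e + 1)).totient r.totient with h | h
    · rcases hg.eq_or_eq_or_lt r hr.isPrimePow h with h | h | h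
      · rw [← h, hrt] at hb
        omega
      · have := hg.totient_eq
        rw [← h, hrt] at this
        omega
      · omega
    · rcases hg.eq_or_lt r hr.isPrimePow h with h' | h'
      · rw [h'] at hr
        have := (Nat.Prime.eq_one_of_pow hr : e + 1 = 1)
        rw [this, pow_one]
      · omega
  · obtain ⟨r, hr, hr1, hr2⟩ := Nat.exists_prime_lt_and_le_two_mul (N + 1) N.succ_ne_zero
    have hrt := Nat.totient_prime hr
    have hN2 : 2 ≤ N := by
      calc 2 ≤ 1 * (p - 1) := by omega
        _ ≤ N := Nat.mul_le_mul_right _ (Nat.one_le_pow _ _ hp.pos)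
    have h3 : 3 * N ≤ p * N := Nat.mul_le_mul_right _ hp3
    exfalso
    rcases hg.eq_or_eq_or_lt r hr.isPrimePow (by omega) with h | h | h
    · rw [← h] at hb
      omega
    · have := hg.totient_eq
      rw [← h] at this
      omega
    · omega

lemma totient_lcm_ab (hg : IsTotientGap a b c d) : (a.lcm b).totient = a.totient * b.totient := by
  rw [hg.coprime_ab.lcm_eq_mul, Nat.totient_mul hg.coprime_ab]

lemma totient_lcm_bc (hg : IsTotientGap a b c d) : (b.lcm c).totient = b.totient ^ 2 := by
  rw [hg.coprime_bc.lcm_eq_mul, Nat.totient_mul hg.coprime_bc, hg.totient_eq, sq]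

lemma totient_lcm_ac (hg : IsTotientGap a b c d) : (a.lcm c).totient = a.totient * b.totient := by
  rcases hg.eq_two_or_coprime_ac with ⟨h, hac⟩ | h
  · rw [Nat.lcm_eq_right hac, h, Nat.totient_two, one_mul, hg.totient_eq]
  · rw [h.lcm_eq_mul, Nat.totient_mul h, hg.totient_eq]

end IsTotientGap

end TotientGap

section Enumeration

lemma ppKey_lt_of_totient_lt {q r : ℕ} (hq : IsPrimePow q) (h : q.totient < r.totient) :
    ppKey q < ppKey r := by
  have := le_two_mul_totient hq
  unfold ppKey
  nlinarith

lemma totient_le_of_ppKey_le {q r : ℕ} (hr : IsPrimePow r) (h : ppKey q ≤ ppKey r) :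
    q.totient ≤ r.totient := by
  by_contra! hlt
  exact h.not_gt (ppKey_lt_of_totient_lt hr hlt)

lemma ppKey_injOn {q r : ℕ} (hq : IsPrimePow q) (hr : IsPrimePow r) (h : ppKey q = ppKey r) :
    q = r := by
  have := (totient_le_of_ppKey_le hr h.le).antisymm (totient_le_of_ppKey_le hq h.ge)
  unfold ppKey at h
  rw [this] at h
  omega

lemma infinite_ppKey : {k | ∃ q : ℕ, IsPrimePow q ∧ ppKey q = k}.Infinite := by
  refine Set.infinite_of_not_bddAbove fun ⟨B, hB⟩ => ?_
  obtain ⟨p, hp, hp'⟩ := Nat.exists_infinite_primes (B + 1)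
  have h := hB ⟨p, hp'.isPrimePow, rfl⟩
  unfold ppKey at h
  omega

lemma qt_spec (i : ℕ) : IsPrimePow (qt i) ∧ ppKey (qt i) = ppNthKey (i - 1) :=
  Nat.sInf_mem (s := {q : ℕ | IsPrimePow q ∧ ppKey q = ppNthKey (i - 1)})
    (Nat.nth_mem_of_infinite infinite_ppKey (i - 1))

lemma isPrimePow_qt (i : ℕ) : IsPrimePow (qt i) := (qt_spec i).1

lemma ppKey_qt_lt {i j : ℕ} (hi : 1 ≤ i) (hij : i < j) : ppKey (qt i) < ppKey (qt j) := by
  rw [(qt_spec i).2, (qt_spec j).2]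
  exact Nat.nth_strictMono infinite_ppKey (by omega)

lemma ppKey_qt_le {i j : ℕ} (hi : 1 ≤ i) (hij : i ≤ j) : ppKey (qt i) ≤ ppKey (qt j) := by
  rcases hij.eq_or_lt with rfl | h
  · exact le_rfl
  · exact (ppKey_qt_lt hi h).le

lemma exists_qt_eq {q : ℕ} (hq : IsPrimePow q) : ∃ i, 1 ≤ i ∧ qt i = q := by
  obtain ⟨n, hn⟩ : ∃ n, ppNthKey n = ppKey q := by
    obtain ⟨n, -, hn⟩ := Nat.exists_lt_card_nth_eq
      (p := fun k => ∃ q : ℕ, IsPrimePow q ∧ ppKey q = k) ⟨q, hq, rfl⟩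
    exact ⟨n, hn⟩
  refine ⟨n + 1, by omega, ppKey_injOn (isPrimePow_qt _) hq ?_⟩
  rw [(qt_spec _).2, Nat.add_sub_cancel, hn]

lemma exists_qt_eq_of_ppKey_le {q i : ℕ} (hi : 1 ≤ i) (hq : IsPrimePow q)
    (h : ppKey q ≤ ppKey (qt i)) : ∃ j, 1 ≤ j ∧ j ≤ i ∧ qt j = q := by
  obtain ⟨j, hj, rfl⟩ := exists_qt_eq hq
  refine ⟨j, hj, ?_, rfl⟩
  by_contra! hlt
  exact h.not_gt (ppKey_qt_lt hi hlt)

lemma ppKey_qt_succ_le {q i : ℕ} (hi : 1 ≤ i) (hq : IsPrimePow q)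
    (h : ppKey (qt i) < ppKey q) : ppKey (qt (i + 1)) ≤ ppKey q := by
  obtain ⟨j, hj, rfl⟩ := exists_qt_eq hq
  refine ppKey_qt_le (by omega) ?_
  by_contra! hlt
  exact h.not_ge (ppKey_qt_le hj (by omega))

lemma IsPrimePow.dvd_lcm_iff {q x y : ℕ} (hq : IsPrimePow q) (hx : x ≠ 0) (hy : y ≠ 0) :
    q ∣ x.lcm y ↔ q ∣ x ∨ q ∣ y := by
  obtain ⟨p, k, hp, hk, rfl⟩ := (isPrimePow_nat_iff _).1 hq
  rw [hp.pow_dvd_iff_le_factorization (Nat.lcm_ne_zero hx hy),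
    hp.pow_dvd_iff_le_factorization hx, hp.pow_dvd_iff_le_factorization hy,
    Nat.factorization_lcm hx hy, Finsupp.sup_apply, le_sup_iff]

lemma IsPrimePow.dvd_finset_lcm {ι : Type*} {q : ℕ} (hq : IsPrimePow q) (s : Finset ι) (f : ι → ℕ)
    (hf : ∀ j ∈ s, f j ≠ 0) (h : q ∣ s.lcm f) : ∃ j ∈ s, q ∣ f j := by
  classical
  induction s using Finset.induction_on with
  | empty =>
    rw [Finset.lcm_empty] at h
    exact absurd (Nat.dvd_one.1 h) hq.ne_one
  | insert j s hj ih =>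
    rw [Finset.lcm_insert] at h
    have hs : s.lcm f ≠ 0 := by
      intro h0
      obtain ⟨k, hk, hk'⟩ := Finset.lcm_eq_zero_iff.1 h0
      exact hf k (Finset.mem_insert_of_mem hk) hk'
    rcases (hq.dvd_lcm_iff (hf j (Finset.mem_insert_self j s)) hs).1 h with h | h
    · exact ⟨j, Finset.mem_insert_self j s, h⟩
    · obtain ⟨k, hk, hk'⟩ := ih (fun k hk => hf k (Finset.mem_insert_of_mem hk)) h
      exact ⟨k, Finset.mem_insert_of_mem hk, hk'⟩

lemma Lseq_ne_zero (i : ℕ) : Lseq i ≠ 0 := by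
  intro h
  obtain ⟨k, -, hk⟩ := Finset.lcm_eq_zero_iff.1 h
  exact (isPrimePow_qt k).ne_zero hk

lemma dvd_Lseq_iff {q i : ℕ} (hi : 1 ≤ i) (hq : IsPrimePow q) :
    q ∣ Lseq i ↔ ppKey q ≤ ppKey (qt i) := by
  constructor
  · intro h
    obtain ⟨j, hj, hqj⟩ := hq.dvd_finset_lcm _ _ (fun j _ => (isPrimePow_qt j).ne_zero) h
    obtain ⟨hj1, hj2⟩ := Finset.mem_Icc.1 hj
    refine le_trans ?_ (ppKey_qt_le hj1 hj2)
    have h1 := Nat.le_of_dvd (isPrimePow_qt j).pos hqj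
    have h2 := Nat.le_of_dvd (Nat.totient_pos.2 (isPrimePow_qt j).pos)
      (Nat.totient_dvd_of_dvd hqj)
    unfold ppKey
    gcongr
  · intro h
    obtain ⟨j, hj1, hj2, rfl⟩ := exists_qt_eq_of_ppKey_le hi hq h
    exact Finset.dvd_lcm (Finset.mem_Icc.2 ⟨hj1, hj2⟩)

lemma totient_qt_lt_of_ncard_UFO {i : ℕ} (hi : 1 ≤ i) (h : (UFO i).ncard = 1) :
    (qt i).totient < (qt (i + 1)).totient := by
  by_contra hlt
  obtain ⟨x, hx⟩ := Set.ncard_eq_one.1 h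
  rw [UFO, if_neg hlt] at hx
  have h1 : Lseq i = x := by
    have : Lseq i ∈ ({x} : Set ℕ) := hx ▸ Set.mem_insert _ _
    exact this
  have h2 : Nat.lcm (Lseq (i - 1)) (qt (i + 1)) = x := by
    have : Nat.lcm (Lseq (i - 1)) (qt (i + 1)) ∈ ({x} : Set ℕ) :=
      hx ▸ Set.mem_insert_of_mem _ rfl
    exact this
  have h3 : qt (i + 1) ∣ Lseq i := by
    rw [h1, ← h2]
    exact Nat.dvd_lcm_right _ _
  exact ((dvd_Lseq_iff hi (isPrimePow_qt _)).1 h3).not_gt (ppKey_qt_lt hi (by omega))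

lemma totient_qt_eq_of_ncard_UFO {i : ℕ} (hi : 1 ≤ i) (h : (UFO i).ncard = 2) :
    (qt (i + 1)).totient = (qt i).totient := by
  refine (totient_le_of_ppKey_le (isPrimePow_qt _)
    (ppKey_qt_le hi i.le_succ)).antisymm' (not_lt.1 fun hlt => ?_)
  rw [UFO, if_pos hlt, Set.ncard_singleton] at h
  omega

theorem isTotientGap_qt {i d : ℕ} (hi : 1 ≤ i) (h2 : (UFO i).ncard = 1)
    (h3 : (UFO (i + 1)).ncard = 2) (h1 : i = 1 ∨ (UFO (i - 1)).ncard = 1) (hd : UFO i = {d}) :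
    IsTotientGap (qt i) (qt (i + 1)) (qt (i + 2)) d := by
  have hab := totient_qt_lt_of_ncard_UFO hi h2
  have hbc : (qt (i + 2)).totient = (qt (i + 1)).totient :=
    totient_qt_eq_of_ncard_UFO (by omega) h3
  have hlt : qt (i + 1) < qt (i + 2) := by
    have h := ppKey_qt_lt (show 1 ≤ i + 1 by omega) (show i + 1 < i + 2 by omega)
    unfold ppKey at h
    rw [hbc] at h
    omega
  have hdL : Lseq i = d := by
    rw [UFO, if_pos hab] at hd
    exact Set.singleton_eq_singleton_iff.1 hd
  have hkey : ∀ q, IsPrimePow q → q.totient ≤ (qt i).totient → ppKey q ≤ ppKey (qt i) := by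
    intro q hq hle
    by_contra! hgt
    exact (ppKey_qt_succ_le hi hq hgt).not_gt (ppKey_lt_of_totient_lt hq (hle.trans_lt hab))
  refine ⟨isPrimePow_qt _, isPrimePow_qt _, isPrimePow_qt _, hab, hbc, hlt, ?_, ?_,
    hdL ▸ Lseq_ne_zero i, ?_⟩
  · intro q hq hle
    obtain ⟨j, hj1, hj2, rfl⟩ := exists_qt_eq_of_ppKey_le hi hq (hkey q hq hle)
    rcases hj2.eq_or_lt with rfl | hji
    · exact Or.inl rfl
    · right
      have h := totient_qt_lt_of_ncard_UFO (show 1 ≤ i - 1 by omega)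
        (h1.resolve_left (by omega))
      rw [Nat.sub_add_cancel hi] at h
      exact (totient_le_of_ppKey_le (isPrimePow_qt _)
        (ppKey_qt_le hj1 (by omega))).trans_lt h
  · intro q hq hgt
    have hb := ppKey_qt_succ_le hi hq (ppKey_lt_of_totient_lt (isPrimePow_qt _) hgt)
    rcases hb.eq_or_lt with hb | hb
    · exact Or.inl (ppKey_injOn hq (isPrimePow_qt _) hb.symm)
    have hc := ppKey_qt_succ_le (by omega) hq hb
    rcases hc.eq_or_lt with hc | hc
    · exact Or.inr (Or.inl (ppKey_injOn hq (isPrimePow_qt _) hc.symm))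
    refine Or.inr (Or.inr ((totient_le_of_ppKey_le hq hb.le).lt_of_ne fun heq => ?_))
    have hcq : qt (i + 2) < q := by
      have h : ppKey (qt (i + 2)) < ppKey q := hc
      unfold ppKey at h
      rw [hbc, heq] at h
      omega
    have hp1 := prime_of_totient_eq_of_lt (isPrimePow_qt _) (isPrimePow_qt _) hbc.symm hlt
    have hp2 := prime_of_totient_eq_of_lt (isPrimePow_qt _) hq (hbc.trans heq) hcq
    rw [Nat.totient_prime hp1, Nat.totient_prime hp2] at hbc
    have := hp1.two_le
    omega
  · intro q hq
    rw [← hdL, dvd_Lseq_iff hi hq]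
    exact ⟨totient_le_of_ppKey_le (isPrimePow_qt _), hkey q hq⟩

end Enumeration

lemma normOmega_sub_max {a b c n m : ℕ} (h : c.totient = b.totient) :
    normOmega a n m - max (normOmega b n m) (normOmega c n m) =
      (omegaQ m a - max (omegaQ m b : ℝ) (omegaQ m c) -
        (1 / (a.totient : ℝ) - 1 / b.totient) * LL n) / √(LL n) := by
  unfold normOmega
  rw [h, max_div_div_right (Real.sqrt_nonneg _), max_sub_sub_right]
  ring

theorem statement10 (i : ℕ) (hi : 1 ≤ i)
    (h2 : (UFO i).ncard = 1) (h3 : (UFO (i + 1)).ncard = 2)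
    (h1 : i = 1 ∨ (UFO (i - 1)).ncard = 1)
    (d : ℕ) (hd : UFO i = {d}) (J : ℕ → ℕ) (hJ : IsInvCount d J) :
    ∀ x : ℝ, Filter.Tendsto
      (fun n : ℕ => ((cnt (fun m =>
          (J m : ℝ) ≤ muSeq i * LL n + x * sigSeq i * Real.sqrt (LL n)) n : ℝ)) / n)
      Filter.atTop
      (nhds (PhiSkew x (-(nuSeq (i + 1)) / Real.sqrt (sigSeq i ^ 2 + sigAB i 1 2 ^ 2)))) := by
  have hg := isTotientGap_qt hi h2 h3 h1 hd
  have hne : ∀ j, NeZero (qt j) := fun j => ⟨(isPrimePow_qt j).ne_zero⟩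
  have hα1 : (1 : ℝ) ≤ phiQ i := by
    unfold phiQ
    exact_mod_cast Nat.totient_pos.2 (isPrimePow_qt i).pos
  have hβ2 : (2 : ℝ) ≤ phiQ (i + 1) := by
    have h := Nat.totient_pos.2 (isPrimePow_qt i).pos
    have h' := hg.totient_lt
    unfold phiQ
    exact_mod_cast (by omega : 2 ≤ (qt (i + 1)).totient)
  have hα0 : 0 < phiQ i := by linarith
  have hβ0 : 0 < phiQ (i + 1) := by linarith
  have hσ0 : 0 < 1 / phiQ i + 1 / phiQ (i + 1) - 2 / (phiQ i * phiQ (i + 1)) := by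
    have : 1 / phiQ i + 1 / phiQ (i + 1) - 2 / (phiQ i * phiQ (i + 1)) =
        (phiQ i + phiQ (i + 1) - 2) / (phiQ i * phiQ (i + 1)) := by field_simp; ring
    rw [this]
    exact div_pos (by linarith) (by positivity)
  have hτ0 : 0 ≤ 1 / phiQ i ^ 1 + 1 / phiQ (i + 1) ^ 2 - 2 / (phiQ i * phiQ (i + 1)) := by
    have : 1 / phiQ i ^ 1 + 1 / phiQ (i + 1) ^ 2 - 2 / (phiQ i * phiQ (i + 1)) =
        (phiQ (i + 1) * (phiQ (i + 1) - 2) + phiQ i) / (phiQ i * phiQ (i + 1) ^ 2) := by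
      field_simp; ring
    rw [this]
    exact div_nonneg (add_nonneg (mul_nonneg hβ0.le (by linarith)) hα0.le) (by positivity)
  have hν0 : 0 < 1 / phiQ (i + 1) * (1 - 1 / phiQ (i + 1)) := by
    refine mul_pos (by positivity) (sub_pos.2 ?_)
    rw [div_lt_one hβ0]
    linarith
  have hσ2 : sigSeq i ^ 2 = 1 / phiQ i + 1 / phiQ (i + 1) - 2 / (phiQ i * phiQ (i + 1)) :=
    Real.sq_sqrt hσ0.le
  have hτ2 : sigAB i 1 2 ^ 2 =
      1 / phiQ i ^ 1 + 1 / phiQ (i + 1) ^ 2 - 2 / (phiQ i * phiQ (i + 1)) := Real.sq_sqrt hτ0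
  have hν2 : nuSeq (i + 1) ^ 2 = 1 / phiQ (i + 1) * (1 - 1 / phiQ (i + 1)) :=
    Real.sq_sqrt hν0.le
  have hσ : 0 < sigSeq i := Real.sqrt_pos.2 hσ0
  have hν : 0 < nuSeq (i + 1) := Real.sqrt_pos.2 hν0
  have hκ : 0 < √(sigSeq i ^ 2 + sigAB i 1 2 ^ 2) := Real.sqrt_pos.2 (by positivity)
  have hκ2 : √(sigSeq i ^ 2 + sigAB i 1 2 ^ 2) ^ 2 = 2 * sigSeq i ^ 2 - nuSeq (i + 1) ^ 2 := by
    rw [Real.sq_sqrt (by positivity), hσ2, hτ2, hν2]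
    field_simp
    ring
  have hZ := tendsto_dens_sub_max (a := qt i) (b := qt (i + 1)) (c := qt (i + 2))
    hα0.ne' hβ0.ne' hσ hν hκ rfl rfl (by rw [hg.totient_eq]; rfl)
    (by rw [hg.totient_lcm_ab]; push_cast; rfl) (by rw [hg.totient_lcm_ac]; push_cast; rfl)
    (by rw [hg.totient_lcm_bc]; push_cast; rfl) hσ2 hν2 hκ2
  have hY := tendsto_dens_of_close
    (Y := fun n m => ((J m : ℝ) - muSeq i * LL n) / (sigSeq i * √(LL n)))
    (continuous_PhiSkew _) hZ ?_
  · intro x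
    rw [neg_div]
    refine (hY x).congr' ?_
    filter_upwards [tendsto_LL.eventually_gt_atTop 0] with n hn
    refine dens_congr fun m => ?_
    rw [div_le_iff₀ (mul_pos hσ (Real.sqrt_pos.2 hn)), sub_le_iff_le_add', mul_assoc x]
  · intro η hη
    refine (negligible_invCount_sub hg hJ).mono ?_
    have hs := (Real.tendsto_sqrt_atTop.comp tendsto_LL).eventually_ge_atTop (2 / (sigSeq i * η))
    filter_upwards [hs, tendsto_LL.eventually_gt_atTop 0] with n hn hn0 m _ _ hlt
    have hs0 : 0 < √(LL n) := Real.sqrt_pos.2 hn0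
    rw [normOmega_sub_max hg.totient_eq] at hlt
    have hdiff : ((J m : ℝ) - muSeq i * LL n) / (sigSeq i * √(LL n)) -
        (omegaQ m (qt i) - max (omegaQ m (qt (i + 1)) : ℝ) (omegaQ m (qt (i + 2))) -
          (1 / ((qt i).totient : ℝ) - 1 / (qt (i + 1)).totient) * LL n) / √(LL n) / sigSeq i =
        ((J m : ℝ) - (omegaQ m (qt i) - max (omegaQ m (qt (i + 1)) : ℝ) (omegaQ m (qt (i + 2))))) /
          (sigSeq i * √(LL n)) := by
      unfold muSeq phiQ
      field_simp
      ring
    rw [hdiff, abs_div, abs_of_pos (mul_pos hσ hs0), lt_div_iff₀ (mul_pos hσ hs0)] at hlt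
    refine lt_of_le_of_lt ?_ hlt
    have hn' : 2 / (sigSeq i * η) ≤ √(LL n) := hn
    rw [div_le_iff₀ (by positivity)] at hn'
    linarith

end
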